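/- arXiv:2204.03462 — 2 statements merged into one kernel-verified Lean document; each statement's English description precedes it below -/
import Mathlib

section
/- For all integers k, p, t ≥ 2 there exist δ > 0 and n₀ such that for all n ≥ n₀ the following holds: for all positive integers a₁ ≤ a₂ ≤ ⋯ ≤ a_{p−1} ≤ t and a_{p−1} ≤ a_p ≤ δn with a₁ = 1, the Ramsey number satisfies r(K_p(a₁,…,a_p), B_{k,n}) ≤ (p−1)(n−1) + k(p−1)(a₂−1) + 1; that is, every graph G on (p−1)(n−1) + k(p−1)(a₂−1) + 1 vertices contains K_p(a₁,…,a_p) as a subgraph or its complement contains B_{k,n} as a subgraph. -/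
open SimpleGraph

/-- `G` contains a copy of `H` (as a subgraph, i.e. there is an injective graph homomorphism). -/
def HasCopy {V W : Type*} (G : SimpleGraph V) (H : SimpleGraph W) : Prop :=
  ∃ f : H →g G, Function.Injective f

/-- The Ramsey number `r(H₁, H₂)`: the smallest `N` such that every graph `G` on `N` vertices
contains `H₁` as a subgraph or its complement contains `H₂` as a subgraph. -/
noncomputable def ramseyNumber {V W : Type*} (H₁ : SimpleGraph V) (H₂ : SimpleGraph W) : ℕ :=
  sInf {N : ℕ | ∀ G : SimpleGraph (Fin N), HasCopy G H₁ ∨ HasCopy Gᶜ H₂}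

/-- The complete multipartite graph `K_p(a₁,…,a_p)` with parts of sizes `a 0, …, a (p-1)`. -/
def KMulti {p : ℕ} (a : Fin p → ℕ) : SimpleGraph (Σ i : Fin p, Fin (a i)) :=
  completeMultipartiteGraph fun i => Fin (a i)

/-- The book graph `B_{k,n}`: the join of `K_k` with an independent set of `n - k` vertices,
realized as the complete multipartite graph with `k` parts of size `1` and one part of
size `n - k`. -/
def Book (k n : ℕ) : SimpleGraph (Σ i : Fin (k + 1), Fin (if (i : ℕ) < k then 1 else n - k)) :=
  completeMultipartiteGraph fun i : Fin (k + 1) => Fin (if (i : ℕ) < k then 1 else n - k)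

/-- Every vertex of `A` is adjacent to every vertex of `B`. -/
def FullyJoined {V : Type*} (G : SimpleGraph V) (A B : Finset V) : Prop :=
  ∀ x ∈ A, ∀ y ∈ B, G.Adj x y

/-- The vertices of `A` are pairwise nonadjacent. -/
def Indep {V : Type*} (G : SimpleGraph V) (A : Finset V) : Prop :=
  ∀ x ∈ A, ∀ y ∈ A, ¬ G.Adj x y

/-- The vertices of `A` that have no neighbour in `K`. -/
def commonNonneighbors {V : Type*} (G : SimpleGraph V) [DecidableRel G.Adj] (A K : Finset V) :
    Finset V :=
  A.filter fun w => ∀ u ∈ K, ¬ G.Adj u w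

theorem mem_commonNonneighbors {V : Type*} {G : SimpleGraph V} [DecidableRel G.Adj]
    {A K : Finset V} {w : V} :
    w ∈ commonNonneighbors G A K ↔ w ∈ A ∧ ∀ u ∈ K, ¬ G.Adj u w :=
  Finset.mem_filter

theorem commonNonneighbors_subset {V : Type*} {G : SimpleGraph V} [DecidableRel G.Adj]
    (A K : Finset V) : commonNonneighbors G A K ⊆ A :=
  Finset.filter_subset _ _

theorem commonNonneighbors_mono {V : Type*} {G : SimpleGraph V} [DecidableRel G.Adj]
    {A B : Finset V} (h : A ⊆ B) (K : Finset V) :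
    commonNonneighbors G A K ⊆ commonNonneighbors G B K :=
  Finset.filter_subset_filter _ h

/-- Every independent `k`-set `K` has fewer than `n` common non-neighbours, the elements of `K`
included. -/
def BookFree {V : Type*} [Fintype V] (G : SimpleGraph V) [DecidableRel G.Adj] (k n : ℕ) : Prop :=
  ∀ K : Finset V, K.card = k → Indep G K →
    (commonNonneighbors G Finset.univ K).card < n

/-- In every complete multipartite subgraph with `q + 1` parts of which `q` have size at least `t`,
the remaining part has size less than `d`. -/
def BlowupFree {V : Type*} (G : SimpleGraph V) (q t d : ℕ) : Prop :=
  ∀ (P : Fin q → Finset V) (X : Finset V), (∀ i j, i ≠ j → FullyJoined G (P i) (P j)) →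
    (∀ i, FullyJoined G (P i) X) → (∀ i, t ≤ (P i).card) → X.card < d

theorem FullyJoined.symm {V : Type*} {G : SimpleGraph V} {A B : Finset V} (h : FullyJoined G A B) :
    FullyJoined G B A := fun x hx y hy => (h y hy x hx).symm

theorem FullyJoined.mono {V : Type*} {G : SimpleGraph V} {A B A' B' : Finset V}
    (h : FullyJoined G A B) (hA : A' ⊆ A) (hB : B' ⊆ B) : FullyJoined G A' B' :=
  fun x hx y hy => h x (hA hx) y (hB hy)

theorem Indep.mono {V : Type*} {G : SimpleGraph V} {A A' : Finset V} (h : Indep G A)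
    (hA : A' ⊆ A) : Indep G A' :=
  fun x hx y hy => h x (hA hx) y (hA hy)

theorem exists_common_choice {V : Type*} [DecidableEq V] {r m : ℕ} (R : Fin r → Finset V)
    (hR : ∀ j, (R j).card ≤ m) (X : Finset V) (Q : (Fin r → Finset V) → V → Prop)
    (h : ∀ x ∈ X, ∃ f : Fin r → Finset V, (∀ j, f j ⊆ R j) ∧ Q f x) :
    ∃ (f : Fin r → Finset V) (X' : Finset V), X' ⊆ X ∧ (∀ j, f j ⊆ R j) ∧ (∀ x ∈ X', Q f x) ∧
      X.card ≤ X'.card * 2 ^ (m * r) := by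
  classical
  choose! g hg hQ using h
  set S : Finset (Fin r → Finset V) := Fintype.piFinset fun j => (R j).powerset with hS
  have hSne : S.Nonempty := ⟨fun _ => ∅, by simp [hS]⟩
  have hmaps : ∀ x ∈ X, g x ∈ S := by
    intro x hx
    simpa [hS] using hg x hx
  obtain ⟨f, hf, hmax⟩ := S.exists_max_image (fun f => (X.filter fun x => g x = f).card) hSne
  refine ⟨f, X.filter fun x => g x = f, Finset.filter_subset _ _, ?_, ?_, ?_⟩
  · simpa [hS] using hf
  · intro x hx
    obtain ⟨hx, hgx⟩ := Finset.mem_filter.1 hx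
    exact hgx ▸ hQ x hx
  · refine (Finset.card_le_mul_card_image_of_maps_to hmaps _ hmax).trans ?_
    gcongr
    rw [hS, Fintype.card_piFinset]
    calc ∏ j, (R j).powerset.card ≤ ∏ _j : Fin r, 2 ^ m := by
          refine Finset.prod_le_prod' fun j _ => ?_
          rw [Finset.card_powerset]
          exact Nat.pow_le_pow_right (by norm_num) (hR j)
      _ = 2 ^ (m * r) := by simp [pow_mul]

theorem BookFree.sum_choose_le {V : Type*} [Fintype V] [DecidableEq V] {G : SimpleGraph V}
    [DecidableRel G.Adj] {k n : ℕ} (hG : BookFree G k n) {T : Finset V} (hT : Indep G T) :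
    ∑ w, (T.filter fun u => ¬ G.Adj w u).card.choose k ≤ T.card.choose k * n := by
  have h := Finset.sum_card_bipartiteAbove_eq_sum_card_bipartiteBelow
    (s := T.powersetCard k) (t := (Finset.univ : Finset V))
    (fun (K : Finset V) (w : V) => ∀ u ∈ K, ¬ G.Adj u w)
  have h1 : ∀ w : V, (T.filter fun u => ¬ G.Adj w u).card.choose k
      = ((T.powersetCard k).bipartiteBelow (fun K w => ∀ u ∈ K, ¬ G.Adj u w) w).card := by
    intro w
    rw [← Finset.card_powersetCard]
    congr 1
    ext K
    simp only [Finset.mem_powersetCard, Finset.mem_bipartiteBelow, Finset.subset_iff,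
      Finset.mem_filter]
    constructor
    · rintro ⟨h1, h2⟩
      exact ⟨⟨fun x hx => (h1 hx).1, h2⟩, fun u hu h => (h1 hu).2 h.symm⟩
    · rintro ⟨⟨h1, h2⟩, h3⟩
      exact ⟨fun x hx => ⟨h1 hx, fun h => h3 x hx h.symm⟩, h2⟩
  rw [Finset.sum_congr rfl fun w _ => h1 w, ← h, ← Finset.card_powersetCard]
  refine (Finset.sum_le_card_nsmul _ _ n fun K hK => ?_).trans (by simp)
  rw [Finset.mem_powersetCard] at hK
  refine le_of_eq_of_le ?_ (hG K hK.2 (hT.mono hK.1)).le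
  simp only [Finset.bipartiteAbove, commonNonneighbors]
  congr!

/-- If the graph on `U` is sparse and every vertex of `S` has many non-neighbours in `U`, then some
independent `k`-set of `U` has a positive proportion of `S` as common non-neighbours. -/
theorem exists_indep_many_common_nonneighbors {V : Type*} [DecidableEq V] {G : SimpleGraph V}
    [DecidableRel G.Adj] {U S : Finset V} {D b k : ℕ} (hS : S.Nonempty) (hb : 0 < b)
    (hU : ∀ u ∈ U, (U.filter (G.Adj u)).card + 1 ≤ D) (hkD : 2 * (k * D) ≤ b)
    (hSU : ∀ w ∈ S, b ≤ (U.filter fun u => ¬ G.Adj w u).card) :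
    ∃ K ⊆ U, K.card = k ∧ Indep G K ∧
      b ^ k * S.card ≤ (2 * U.card) ^ k * (commonNonneighbors G S K).card := by
  induction k with
  | zero => exact ⟨∅, by simp, by simp, by simp [Indep],
      by simp [commonNonneighbors]⟩
  | succ k ih =>
    obtain ⟨K, hKU, hKc, hKi, hK⟩ := ih (by nlinarith)
    set S' := commonNonneighbors G S K with hS'
    have hS'ne : S'.Nonempty := by
      rw [← Finset.card_pos]
      by_contra h0
      have h0 : S'.card = 0 := by omega
      rw [h0] at hK
      have : 0 < b ^ k * S.card := Nat.mul_pos (pow_pos hb k) hS.card_pos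
      omega
    set Z := K.biUnion fun u => insert u (U.filter (G.Adj u)) with hZ
    have hZc : Z.card ≤ k * D := by
      rw [← hKc]
      refine Finset.card_biUnion_le_card_mul _ _ _ fun u hu => ?_
      exact (Finset.card_insert_le _ _).trans (hU u (hKU hu))
    have hdeg : ∀ w ∈ S', b ≤ 2 * ((U \ Z).filter fun u => ¬ G.Adj w u).card := by
      intro w hw
      have h1 := hSU w (mem_commonNonneighbors.1 hw).1
      have h2 : (U.filter fun u => ¬ G.Adj w u) ⊆ ((U \ Z).filter fun u => ¬ G.Adj w u) ∪ Z := by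
        intro x hx
        simp only [Finset.mem_union, Finset.mem_filter, Finset.mem_sdiff] at hx ⊢
        tauto
      have h3 := (Finset.card_le_card h2).trans (Finset.card_union_le _ _)
      nlinarith
    have hcount := Finset.sum_card_bipartiteAbove_eq_sum_card_bipartiteBelow
      (s := S') (t := U \ Z) (fun w u => ¬ G.Adj w u)
    have hne : (U \ Z).Nonempty := by
      obtain ⟨w, hw⟩ := hS'ne
      have := hdeg w hw
      have h4 : 0 < ((U \ Z).filter fun u => ¬ G.Adj w u).card := by omega
      exact (Finset.card_pos.1 h4).mono (Finset.filter_subset _ _)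
    obtain ⟨u, hu, hmax⟩ := (U \ Z).exists_max_image
      (fun u => (S'.bipartiteBelow (fun w u => ¬ G.Adj w u) u).card) hne
    have hle : S'.card * b ≤ 2 * (U.card *
        (S'.bipartiteBelow (fun w u => ¬ G.Adj w u) u).card) := by
      calc S'.card * b ≤ ∑ w ∈ S', 2 * ((U \ Z).bipartiteAbove (fun w u => ¬ G.Adj w u) w).card :=
            Finset.card_nsmul_le_sum _ _ _ hdeg
        _ = 2 * ∑ u ∈ U \ Z, (S'.bipartiteBelow (fun w u => ¬ G.Adj w u) u).card := by
            rw [← Finset.mul_sum, hcount]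
        _ ≤ 2 * ((U \ Z).card * (S'.bipartiteBelow (fun w u => ¬ G.Adj w u) u).card) := by
            gcongr
            exact Finset.sum_le_card_nsmul _ _ _ hmax
        _ ≤ _ := by
            gcongr
            exact Finset.sdiff_subset
    rw [Finset.mem_sdiff] at hu
    have huZ : ∀ x ∈ K, u ≠ x ∧ ¬ G.Adj x u := by
      intro x hx
      refine ⟨?_, ?_⟩
      · rintro rfl
        exact hu.2 (Finset.mem_biUnion.2 ⟨u, hx, Finset.mem_insert_self _ _⟩)
      · intro h
        exact hu.2 (Finset.mem_biUnion.2 ⟨x, hx, Finset.mem_insert_of_mem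
          (Finset.mem_filter.2 ⟨hu.1, h⟩)⟩)
    refine ⟨insert u K, Finset.insert_subset hu.1 hKU, ?_, ?_, ?_⟩
    · rw [Finset.card_insert_of_notMem fun h => (huZ u h).1 rfl, hKc]
    · intro x hx y hy
      rw [Finset.mem_insert] at hx hy
      rcases hx with rfl | hx <;> rcases hy with rfl | hy
      · exact G.irrefl
      · exact fun h => (huZ y hy).2 h.symm
      · exact (huZ x hx).2
      · exact hKi x hx y hy
    · have heq : S'.bipartiteBelow (fun w u => ¬ G.Adj w u) u
          = commonNonneighbors G S (insert u K) := by
        ext w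
        simp only [Finset.mem_bipartiteBelow, hS', mem_commonNonneighbors,
          Finset.forall_mem_insert, G.adj_comm w u]
        tauto
      rw [← heq]
      calc b ^ (k + 1) * S.card = b * (b ^ k * S.card) := by ring
        _ ≤ b * ((2 * U.card) ^ k * S'.card) := by gcongr
        _ = (2 * U.card) ^ k * (S'.card * b) := by ring
        _ ≤ (2 * U.card) ^ k * (2 * (U.card *
            (S'.bipartiteBelow (fun w u => ¬ G.Adj w u) u).card)) := by gcongr
        _ = _ := by ring

theorem choose_le_pow_mul_choose {M x g k : ℕ} (hM : 2 * g * k ≤ M) (hg : 0 < g)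
    (hx : M ≤ g * x) : M.choose k ≤ (2 * g) ^ k * x.choose k := by
  have hx2 : 2 * k ≤ x := by
    have : g * (2 * k) ≤ g * x := by linarith
    exact Nat.le_of_mul_le_mul_left this hg
  have h : M.descFactorial k ≤ (2 * g) ^ k * x.descFactorial k := by
    calc M.descFactorial k ≤ M ^ k := Nat.descFactorial_le_pow _ _
      _ ≤ (2 * g * (x + 1 - k)) ^ k := by
          refine Nat.pow_le_pow_left (hx.trans ?_) k
          rw [mul_comm 2 g, mul_assoc]
          gcongr
          omega
      _ = (2 * g) ^ k * (x + 1 - k) ^ k := mul_pow _ _ _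
      _ ≤ _ := by
          gcongr
          exact Nat.pow_sub_le_descFactorial _ _
  rw [Nat.descFactorial_eq_factorial_mul_choose, Nat.descFactorial_eq_factorial_mul_choose] at h
  have h2 : k.factorial * M.choose k ≤ k.factorial * ((2 * g) ^ k * x.choose k) := by
    linarith
  exact Nat.le_of_mul_le_mul_left h2 k.factorial_pos

theorem exists_choose_sub_ge (k m : ℕ) {γ : ℝ} (hγ : 0 < γ) :
    ∃ M₀ : ℕ, ∀ M x : ℕ, M₀ ≤ M → M ≤ x + m → (1 - γ) * (M.choose k : ℝ) ≤ x.choose k := by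
  obtain ⟨M₁, hM₁⟩ := exists_nat_gt ((k * (m + k) : ℝ) / γ)
  refine ⟨M₁ + m + k + 1, fun M x hM hx => ?_⟩
  have hMpos : (0 : ℝ) < M := by
    have : 0 < M := by omega
    exact_mod_cast this
  have hM1 : (k * (m + k) : ℝ) ≤ γ * M := by
    rw [div_lt_iff₀ hγ] at hM₁
    have : (M₁ : ℝ) ≤ M := by exact_mod_cast (by omega : M₁ ≤ M)
    nlinarith
  have hber := one_add_mul_le_pow (a := -((m + k : ℝ) / M)) (by
    have : (m + k : ℝ) / M ≤ 1 := by
      rw [div_le_one hMpos]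
      exact_mod_cast (by omega : m + k ≤ M)
    linarith) k
  have h1 : (1 - γ) * (M : ℝ) ^ k ≤ ((x + 1 - k : ℕ) : ℝ) ^ k := by
    calc (1 - γ) * (M : ℝ) ^ k ≤ (1 + k * -((m + k : ℝ) / M)) * (M : ℝ) ^ k := by
          gcongr
          have : (k : ℝ) * ((m + k : ℝ) / M) ≤ γ := by
            rw [mul_div_assoc', div_le_iff₀ hMpos]
            exact hM1
          linarith
      _ ≤ (1 + -((m + k : ℝ) / M)) ^ k * (M : ℝ) ^ k := by gcongr
      _ = ((M : ℝ) - m - k) ^ k := by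
          rw [← mul_pow]
          congr 1
          field_simp
          ring
      _ ≤ _ := by
          have h3 : (M : ℝ) ≤ ((x + 1 - k : ℕ) : ℝ) + m + k := by
            exact_mod_cast (by omega : M ≤ (x + 1 - k) + m + k)
          have h4 : (m + k : ℝ) ≤ M := by exact_mod_cast (by omega : m + k ≤ M)
          exact pow_le_pow_left₀ (by linarith) (by linarith) k
  rcases le_or_gt (1 - γ) 0 with hneg | hpos
  · exact (mul_nonpos_of_nonpos_of_nonneg hneg (by positivity)).trans (by positivity)
  have h2 : (1 - γ) * (M.descFactorial k : ℝ) ≤ x.descFactorial k := by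
    calc (1 - γ) * (M.descFactorial k : ℝ) ≤ (1 - γ) * (M : ℝ) ^ k := by
          gcongr
          exact_mod_cast Nat.descFactorial_le_pow _ _
      _ ≤ _ := h1
      _ ≤ _ := by exact_mod_cast Nat.pow_sub_le_descFactorial _ _
  rw [Nat.descFactorial_eq_factorial_mul_choose, Nat.descFactorial_eq_factorial_mul_choose] at h2
  push_cast at h2
  have h5 : (0 : ℝ) < k.factorial := by exact_mod_cast k.factorial_pos
  refine le_of_mul_le_mul_left ?_ h5
  linarith

theorem exists_bookFree_weight_le (k m g : ℕ) (hg : 0 < g) {γ : ℝ} (hγ : 0 < γ) :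
    ∃ M₀ : ℕ, ∀ M : ℕ, M₀ ≤ M → ∀ {V : Type} [Fintype V] [DecidableEq V] (G : SimpleGraph V)
      [DecidableRel G.Adj] (n : ℕ), BookFree G k n → ∀ T W S : Finset V, Indep G T → T.card = M →
      Disjoint W S → (∀ w ∈ W, (T.filter fun u => G.Adj w u).card ≤ m) →
      (∀ w ∈ S, M ≤ g * (T.filter fun u => ¬ G.Adj w u).card) →
      (1 - γ) * W.card + S.card / (2 * g) ^ k ≤ (n : ℝ) := by
  obtain ⟨M₀, hM₀⟩ := exists_choose_sub_ge k m hγ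
  refine ⟨M₀ + 2 * g * k + k, fun M hM V _ _ G _ n hG T W S hT hTM hWS hW hS => ?_⟩
  have hsum := hG.sum_choose_le hT
  rw [hTM] at hsum
  have hC : (0 : ℝ) < M.choose k := by exact_mod_cast Nat.choose_pos (by omega : k ≤ M)
  have hpow : (0 : ℝ) < (2 * g) ^ k := by
    have : (0 : ℝ) < g := by exact_mod_cast hg
    positivity
  have h1 : ∑ w ∈ W ∪ S, (T.filter fun u => ¬ G.Adj w u).card.choose k ≤ M.choose k * n :=
    (Finset.sum_le_sum_of_subset (Finset.subset_univ _)).trans hsum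
  rw [Finset.sum_union hWS] at h1
  have h2 : (W.card : ℝ) * ((1 - γ) * M.choose k) ≤
      ∑ w ∈ W, ((T.filter fun u => ¬ G.Adj w u).card.choose k : ℝ) := by
    rw [← nsmul_eq_mul]
    refine Finset.card_nsmul_le_sum _ _ _ fun w hw => hM₀ M _ (by omega) ?_
    have := hW w hw
    have h3 := T.card_filter_add_card_filter_not (fun u => G.Adj w u)
    omega
  have h3 : (S.card : ℝ) * (M.choose k / (2 * g) ^ k) ≤
      ∑ w ∈ S, ((T.filter fun u => ¬ G.Adj w u).card.choose k : ℝ) := by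
    rw [← nsmul_eq_mul]
    refine Finset.card_nsmul_le_sum _ _ _ fun w hw => ?_
    rw [div_le_iff₀ hpow, mul_comm]
    exact_mod_cast choose_le_pow_mul_choose (by omega) hg (hS w hw)
  have h4 : (W.card : ℝ) * ((1 - γ) * M.choose k) + (S.card : ℝ) * (M.choose k / (2 * g) ^ k)
      ≤ M.choose k * n := by
    refine (add_le_add h2 h3).trans ?_
    exact_mod_cast h1
  refine le_of_mul_le_mul_left ?_ hC
  calc _ = (W.card : ℝ) * ((1 - γ) * M.choose k) + (S.card : ℝ) * (M.choose k / (2 * g) ^ k) := by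
        ring
    _ ≤ _ := h4

theorem exists_adj_many {V : Type*} [DecidableEq V] {G : SimpleGraph V} [DecidableRel G.Adj]
    {Y : Finset V} {m : ℕ} (hm : m ≤ Y.card) (hY : ∀ I ⊆ Y, Indep G I → I.card < m) :
    ∃ u ∈ Y, Y.card ≤ (Y.filter fun w => G.Adj u w).card * (2 * m) := by
  classical
  obtain ⟨I, hI, hmax⟩ := (Y.powerset.filter fun I => Indep G I).exists_max_image Finset.card
    ⟨∅, Finset.mem_filter.2 ⟨by simp, fun x hx => by simp at hx⟩⟩
  simp only [Finset.mem_filter, Finset.mem_powerset] at hI hmax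
  have hIm := hY I hI.1 hI.2
  have hcover : ∀ y ∈ Y, y ∉ I → ∃ u ∈ I, G.Adj u y := by
    intro y hy hyI
    by_contra! hcon
    have := hmax (insert y I) ⟨Finset.insert_subset hy hI.1, ?_⟩
    · rw [Finset.card_insert_of_notMem hyI] at this
      omega
    · intro a ha b hb
      rw [Finset.mem_insert] at ha hb
      rcases ha with rfl | ha <;> rcases hb with rfl | hb
      · exact G.irrefl
      · exact fun h => hcon b hb h.symm
      · exact hcon a ha
      · exact hI.2 a ha b hb
  obtain ⟨y, hy, hyI⟩ : ∃ y ∈ Y, y ∉ I := by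
    by_contra! hcon
    have := Finset.card_le_card hcon
    omega
  obtain ⟨u₀, hu₀, hadj⟩ := hcover y hy hyI
  obtain ⟨u, hu, hmax⟩ := I.exists_max_image
    (fun u => (Y.filter fun w => G.Adj u w).card) ⟨u₀, hu₀⟩
  refine ⟨u, hI.1 hu, ?_⟩
  have hpos : 1 ≤ (Y.filter fun w => G.Adj u w).card :=
    le_trans (Finset.card_pos.2 ⟨y, Finset.mem_filter.2 ⟨hy, hadj⟩⟩) (hmax u₀ hu₀)
  have hsub : Y ⊆ I ∪ I.biUnion fun u => Y.filter fun w => G.Adj u w := by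
    intro z hz
    by_cases hzI : z ∈ I
    · exact Finset.mem_union_left _ hzI
    · obtain ⟨v, hv, hvz⟩ := hcover z hz hzI
      exact Finset.mem_union_right _ (Finset.mem_biUnion.2 ⟨v, hv, Finset.mem_filter.2 ⟨hz, hvz⟩⟩)
  have h1 := (Finset.card_le_card hsub).trans (Finset.card_union_le _ _)
  have h2 : (I.biUnion fun u => Y.filter fun w => G.Adj u w).card ≤
      I.card * (Y.filter fun w => G.Adj u w).card := Finset.card_biUnion_le_card_mul _ _ _ hmax
  nlinarith

theorem BlowupFree.exists_indep {V : Type*} [DecidableEq V] {G : SimpleGraph V}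
    [DecidableRel G.Adj] {q t d m : ℕ} (hG : BlowupFree G q t d) (hm : 0 < m) {X : Finset V}
    (hX : (m + d) * (2 * m) ^ (q * t) ≤ X.card) : ∃ T ⊆ X, T.card = m ∧ Indep G T := by
  by_contra! hcon
  have hsmall : ∀ I ⊆ X, Indep G I → I.card < m := by
    intro I hI hind
    by_contra! h
    obtain ⟨T, hTI, hT⟩ := Finset.exists_subset_card_eq h
    exact hcon T (hTI.trans hI) hT (hind.mono hTI)
  have hclique : ∀ r ≤ q * t, ∃ C Y : Finset V, C.card = r ∧ Y ⊆ X ∧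
      (∀ x ∈ C, ∀ y ∈ C, x ≠ y → G.Adj x y) ∧ FullyJoined G C Y ∧
      X.card ≤ Y.card * (2 * m) ^ r := by
    intro r
    induction r with
    | zero =>
      intro _
      exact ⟨∅, X, by simp, Finset.Subset.refl X, by simp, by simp [FullyJoined], by simp⟩
    | succ r ih =>
      intro hr
      obtain ⟨C, Y, hC, hYX, hCC, hCY, hY⟩ := ih (by omega)
      have hYm : m ≤ Y.card := by
        by_contra! h
        have h1 : (2 * m) ^ r ≤ (2 * m) ^ (q * t) := Nat.pow_le_pow_right (by omega) (by omega)
        have h2 : 0 < (2 * m) ^ r := by positivity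
        have h3 : Y.card * (2 * m) ^ r < m * (2 * m) ^ r := Nat.mul_lt_mul_of_pos_right h h2
        have h4 : m * (2 * m) ^ r ≤ (m + d) * (2 * m) ^ (q * t) := Nat.mul_le_mul (by omega) h1
        omega
      obtain ⟨u, hu, hdeg⟩ := exists_adj_many hYm fun I hI => hsmall I (hI.trans hYX)
      have huC : ∀ x ∈ C, G.Adj x u := fun x hx => hCY x hx u hu
      refine ⟨insert u C, Y.filter fun w => G.Adj u w, ?_, (Finset.filter_subset _ _).trans hYX,
        ?_, ?_, ?_⟩
      · rw [Finset.card_insert_of_notMem fun h => G.irrefl (huC u h), hC]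
      · intro x hx y hy hxy
        rw [Finset.mem_insert] at hx hy
        rcases hx with rfl | hx <;> rcases hy with rfl | hy
        · exact absurd rfl hxy
        · exact (huC y hy).symm
        · exact huC x hx
        · exact hCC x hx y hy hxy
      · intro x hx y hy
        rw [Finset.mem_filter] at hy
        rcases Finset.mem_insert.1 hx with rfl | hx
        · exact hy.2
        · exact hCY x hx y hy.1
      · calc X.card ≤ Y.card * (2 * m) ^ r := hY
          _ ≤ ((Y.filter fun w => G.Adj u w).card * (2 * m)) * (2 * m) ^ r := by gcongr
          _ = _ := by ring
  obtain ⟨C, Y, hC, hYX, hCC, hCY, hY⟩ := hclique (q * t) le_rfl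
  let e := (C.equivFinOfCardEq hC).symm
  have hinj : ∀ i i' : Fin q, ∀ j j' : Fin t,
      (e (finProdFinEquiv (i, j)) : V) = e (finProdFinEquiv (i', j')) → i = i' ∧ j = j' := by
    intro i i' j j' h
    have := finProdFinEquiv.injective (e.injective (Subtype.ext h))
    simpa using this
  have hd := hG (fun i => Finset.univ.image fun j : Fin t => (e (finProdFinEquiv (i, j)) : V)) Y
    ?_ ?_ ?_
  · have h2 : 0 < (2 * m) ^ (q * t) := by positivity
    have h3 : Y.card * (2 * m) ^ (q * t) < (m + d) * (2 * m) ^ (q * t) :=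
      Nat.mul_lt_mul_of_pos_right (by omega) h2
    omega
  · intro i i' hii x hx y hy
    simp only [Finset.mem_image, Finset.mem_univ, true_and] at hx hy
    obtain ⟨j, rfl⟩ := hx
    obtain ⟨j', rfl⟩ := hy
    exact hCC _ (e _).2 _ (e _).2 fun h => hii (hinj _ _ _ _ h).1
  · intro i x hx y hy
    simp only [Finset.mem_image, Finset.mem_univ, true_and] at hx
    obtain ⟨j, rfl⟩ := hx
    exact hCY _ (e _).2 y hy
  · intro i
    rw [Finset.card_image_of_injective _ fun j j' h => (hinj _ _ _ _ h).2]
    simp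

theorem exists_indep_multipartite (k r : ℕ) : ∀ m : ℕ, ∃ α : ℝ, 0 < α ∧ ∃ M₀ : ℕ, ∀ M ≥ M₀,
    ∀ {V : Type} [Fintype V] [DecidableEq V] (G : SimpleGraph V) [DecidableRel G.Adj] (n : ℕ),
      BookFree G k n → (∀ X : Finset V, α * n ≤ X.card → ∃ T ⊆ X, T.card = M ∧ Indep G T) →
      (r - 1 / 2 : ℝ) * n ≤ Fintype.card V →
      ∃ T : Fin r → Finset V, (∀ i j, i ≠ j → FullyJoined G (T i) (T j)) ∧
        ∀ i, (T i).card = m ∧ Indep G (T i) := by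
  induction r with
  | zero => exact fun m => ⟨1, one_pos, 0, fun M _ V _ _ G _ n _ _ _ =>
      ⟨fun i => i.elim0, fun i => i.elim0, fun i => i.elim0⟩⟩
  | succ r ih =>
    intro m
    have hγ : (0 : ℝ) < 1 / (4 * (r + 1)) := by positivity
    obtain ⟨m', hm'⟩ := exists_bookFree_weight_le k m 1 one_pos hγ
    obtain ⟨α, hα, M₀, hM₀⟩ := ih m'
    refine ⟨min α (1 / (4 * 2 ^ (m' * r))), by positivity, max M₀ m,
      fun M hM V _ _ G _ n hG hrich hV => ?_⟩
    have hn : (0 : ℝ) ≤ n := Nat.cast_nonneg n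
    push_cast at hV
    obtain ⟨T, hTT, hT⟩ := hM₀ M (le_trans (le_max_left _ _) hM) G n hG
      (fun X hX => hrich X (le_trans (by gcongr; exact min_le_left _ _) hX)) (by nlinarith)
    set L : Fin r → Finset V := fun i =>
      Finset.univ.filter fun w => ((T i).filter fun u => G.Adj w u).card ≤ m with hL
    set H : Finset V := Finset.univ \ Finset.univ.biUnion L with hH
    have hLc : ∀ i, ((L i).card : ℝ) * (r : ℝ) ≤ (r + 1 / 4) * n := by
      intro i
      have := hm' m' le_rfl G n hG (T i) (L i) ∅ (hT i).2 (hT i).1 (by simp)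
        (fun w hw => (Finset.mem_filter.1 hw).2) (by simp)
      have h2 : (1 - 1 / (4 * ((r : ℝ) + 1))) * (L i).card ≤ n := by simpa using this
      have hr : (0 : ℝ) ≤ r := Nat.cast_nonneg r
      have h3 : (r : ℝ) ≤ (r + 1 / 4) * (1 - 1 / (4 * (r + 1))) := by
        rw [one_sub_div (by positivity), mul_div_assoc', le_div_iff₀ (by positivity)]
        nlinarith
      calc ((L i).card : ℝ) * r ≤ (L i).card * ((r + 1 / 4) * (1 - 1 / (4 * (r + 1)))) := by gcongr
        _ = (r + 1 / 4) * ((1 - 1 / (4 * (r + 1))) * (L i).card) := by ring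
        _ ≤ _ := by gcongr
    have hunion : ((Finset.univ.biUnion L).card : ℝ) ≤ (r + 1 / 4) * n := by
      have h1 : ((Finset.univ.biUnion L).card : ℝ) ≤ ∑ i, ((L i).card : ℝ) := by
        exact_mod_cast Finset.card_biUnion_le
      rcases Nat.eq_zero_or_pos r with rfl | hr
      · simp
      · have hr' : (0 : ℝ) < r := by exact_mod_cast hr
        have h2 : ∑ i, ((L i).card : ℝ) ≤ ∑ _i : Fin r, (r + 1 / 4) * (n : ℝ) / r :=
          Finset.sum_le_sum fun i _ => by
            rw [le_div_iff₀ hr']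
            exact hLc i
        refine (h1.trans h2).trans ?_
        rw [Finset.sum_const, Finset.card_univ, Fintype.card_fin, nsmul_eq_mul]
        field_simp
        exact le_rfl
    have hHc : (1 / 4 : ℝ) * n ≤ H.card := by
      have h1 : H.card + (Finset.univ.biUnion L).card = Fintype.card V := by
        rw [hH, Finset.card_sdiff_add_card_eq_card (Finset.subset_univ _), Finset.card_univ]
      have h2 : (H.card : ℝ) + (Finset.univ.biUnion L).card = Fintype.card V := by exact_mod_cast h1
      linarith
    obtain ⟨f, X, hXH, hfT, hfX, hcard⟩ := exists_common_choice T (m := m')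
      (fun j => (hT j).1.le) H
      (fun f x => (∀ j, (f j).card = m) ∧ ∀ j, ∀ u ∈ f j, G.Adj x u) (by
        intro x hx
        have h1 : ∀ j, m ≤ ((T j).filter fun u => G.Adj x u).card := by
          intro j
          by_contra! hlt
          refine (Finset.mem_sdiff.1 hx).2 (Finset.mem_biUnion.2 ⟨j, Finset.mem_univ _, ?_⟩)
          exact Finset.mem_filter.2 ⟨Finset.mem_univ _, hlt.le⟩
        choose f hf hfm using fun j => Finset.exists_subset_card_eq (h1 j)
        exact ⟨f, fun j => (hf j).trans (Finset.filter_subset _ _), hfm,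
          fun j u hu => (Finset.mem_filter.1 (hf j hu)).2⟩)
    obtain ⟨T', hT'X, hT'M, hT'⟩ := hrich X (by
      calc min α (1 / (4 * 2 ^ (m' * r))) * (n : ℝ) ≤ 1 / (4 * 2 ^ (m' * r)) * n := by
            gcongr
            exact min_le_right _ _
        _ = (1 / 4 * n) / 2 ^ (m' * r) := by
            field_simp
        _ ≤ X.card := by
            rw [div_le_iff₀ (by positivity)]
            refine hHc.trans ?_
            exact_mod_cast hcard)
    have hmT' : m ≤ T'.card := by
      rw [hT'M]
      exact le_trans (le_max_right _ _) hM
    obtain ⟨T'', hTsub, hT''⟩ := Finset.exists_subset_card_eq hmT'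
    have hT''f : ∀ j, FullyJoined G T'' (f j) := fun j x hx =>
      (hfX x (hT'X (hTsub hx))).2 j
    rcases T''.eq_empty_or_nonempty with rfl | ⟨x, hx⟩
    · have hm0 : m = 0 := by simpa using hT''.symm
      exact ⟨fun _ => ∅, by simp [FullyJoined], by simp [hm0, Indep]⟩
    refine ⟨Fin.cons T'' f, ?_, ?_⟩
    · intro i j
      refine Fin.cases ?_ (fun i => ?_) i <;> refine Fin.cases ?_ (fun j => ?_) j
      · exact fun h => absurd rfl h
      · exact fun _ => by simpa using hT''f j
      · exact fun _ => by simpa using (hT''f i).symm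
      · intro h
        simpa using (hTT i j (by simpa using h)).mono (hfT i) (hfT j)
    · intro i
      refine Fin.cases ?_ (fun i => ?_) i
      · simpa using ⟨hT'', hT'.mono hTsub⟩
      · simpa using ⟨(hfX x (hT'X (hTsub hx))).1 i, (hT i).2.mono (hfT i)⟩

theorem card_le_card_common_nonneighbors_add {V : Type*} [DecidableEq V] {G : SimpleGraph V}
    [DecidableRel G.Adj] {K A : Finset V} {D : ℕ}
    (h : ∀ u ∈ K, (A.filter fun w => G.Adj u w).card ≤ D) :
    A.card ≤ (commonNonneighbors G A K).card + K.card * D := by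
  have hsub : A ⊆ commonNonneighbors G A K ∪
      K.biUnion fun u => A.filter fun w => G.Adj u w := by
    intro w hw
    simp only [Finset.mem_union, mem_commonNonneighbors, Finset.mem_filter, Finset.mem_biUnion]
    by_cases hK : ∀ u ∈ K, ¬ G.Adj u w
    · exact Or.inl ⟨hw, hK⟩
    · push Not at hK
      obtain ⟨u, hu, huw⟩ := hK
      exact Or.inr ⟨u, hu, hw, huw⟩
  refine (Finset.card_le_card hsub).trans ((Finset.card_union_le _ _).trans ?_)
  gcongr
  exact Finset.card_biUnion_le_card_mul _ _ _ h

theorem BlowupFree.card_common_le {V : Type*} [DecidableEq V] {G : SimpleGraph V}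
    [DecidableRel G.Adj] {q t d m : ℕ} (hG : BlowupFree G q t d) {R : Fin q → Finset V}
    (hR : ∀ j, (R j).card ≤ m) {X : Finset V}
    (hX : ∀ x ∈ X, ∃ f : Fin q → Finset V, (∀ j, f j ⊆ R j) ∧
      (∀ i j, i ≠ j → FullyJoined G (f i) (f j)) ∧ (∀ j, t ≤ (f j).card) ∧
      ∀ j, ∀ u ∈ f j, G.Adj x u) :
    X.card ≤ d * 2 ^ (m * q) := by
  rcases X.eq_empty_or_nonempty with rfl | hne
  · simp
  obtain ⟨f, X', -, -, hf, hcard⟩ := exists_common_choice R hR X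
    (fun f x => (∀ i j, i ≠ j → FullyJoined G (f i) (f j)) ∧ (∀ j, t ≤ (f j).card) ∧
      ∀ j, ∀ u ∈ f j, G.Adj x u) hX
  refine hcard.trans ?_
  gcongr
  rcases X'.eq_empty_or_nonempty with rfl | ⟨x, hx⟩
  · simp
  · exact (hG f X' (hf x hx).1 (fun j u hu y hy => ((hf y hy).2.2 j u hu).symm)
      (hf x hx).2.1).le

theorem BlowupFree.card_mul_degree_le {V : Type*} [DecidableEq V] {G : SimpleGraph V}
    [DecidableRel G.Adj] {q t d M c D : ℕ} (hG : BlowupFree G q t d) {T : Fin q → Finset V}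
    (hTT : ∀ i j, i ≠ j → FullyJoined G (T i) (T j)) (hT : ∀ i, (T i).card = M) {i : Fin q}
    {W B : Finset V} (hBW : B ⊆ W)
    (hc : ∀ v ∈ W, ∀ j, j ≠ i → ((T j).filter fun u => ¬ G.Adj v u).card ≤ c)
    (hcM : (t + 1) * c + t ≤ M) (hD : ∀ v ∈ B, D ≤ (W.filter fun w => G.Adj v w).card) :
    B.card * D ≤ B.card * (d * 2 ^ ((M + B.card) * q)) + t * W.card := by
  set X : Finset V := W.filter fun w => t ≤ (B.filter fun v => G.Adj w v).card with hX
  have hXc : X.card ≤ d * 2 ^ ((M + B.card) * q) := by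
    refine hG.card_common_le (R := Function.update T i B) (fun j => ?_) fun x hx => ?_
    · by_cases hj : j = i
      · subst hj
        simp
      · simp [hj, hT]
    · obtain ⟨hxW, hx⟩ := Finset.mem_filter.1 hx
      obtain ⟨P, hPB, hP⟩ := Finset.exists_subset_card_eq hx
      have hPB' : P ⊆ B := hPB.trans (Finset.filter_subset _ _)
      have hcommon : ∀ j, j ≠ i → ∃ Z ⊆ T j, Z.card = t ∧
          ∀ z ∈ Z, G.Adj x z ∧ ∀ v ∈ P, G.Adj v z := by
        intro j hj
        set N := (insert x P).biUnion fun v => (T j).filter fun u => ¬ G.Adj v u with hN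
        have hNc : N.card ≤ (t + 1) * c := by
          refine (Finset.card_biUnion_le_card_mul _ _ c fun v hv => ?_).trans ?_
          · rcases Finset.mem_insert.1 hv with rfl | hv
            · exact hc _ hxW j hj
            · exact hc v (hBW (hPB' hv)) j hj
          · gcongr
            exact (Finset.card_insert_le _ _).trans (by omega)
        have h1 : t ≤ (T j \ N).card := by
          have := Finset.le_card_sdiff N (T j)
          rw [hT j] at this
          omega
        obtain ⟨Z, hZ, hZt⟩ := Finset.exists_subset_card_eq h1
        refine ⟨Z, hZ.trans Finset.sdiff_subset, hZt, fun z hz => ?_⟩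
        have h2 : ∀ v ∈ insert x P, G.Adj v z := by
          intro v hv
          by_contra hvz
          obtain ⟨hzT, hzN⟩ := Finset.mem_sdiff.1 (hZ hz)
          exact hzN (Finset.mem_biUnion.2 ⟨v, hv, Finset.mem_filter.2 ⟨hzT, hvz⟩⟩)
        exact ⟨h2 x (Finset.mem_insert_self _ _), fun v hv => h2 v (Finset.mem_insert_of_mem hv)⟩
      choose! Z hZT hZt hZ using hcommon
      refine ⟨Function.update Z i P, fun j => ?_, fun j j' hjj => ?_, fun j => ?_, fun j u hu => ?_⟩
      · by_cases hj : j = i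
        · subst hj
          simpa using hPB'
        · simpa [hj] using hZT j hj
      · by_cases hj : j = i
        · subst hj
          rw [Function.update_self, Function.update_of_ne hjj.symm]
          exact fun v hv z hz => (hZ j' hjj.symm z hz).2 v hv
        · by_cases hj' : j' = i
          · subst hj'
            rw [Function.update_self, Function.update_of_ne hjj]
            exact fun z hz v hv => ((hZ j hjj z hz).2 v hv).symm
          · rw [Function.update_of_ne hj, Function.update_of_ne hj']
            exact (hTT j j' hjj).mono (hZT j hj) (hZT j' hj')
      · by_cases hj : j = i
        · subst hj
          simp [hP]
        · simp [hj, hZt]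
      · by_cases hj : j = i
        · subst hj
          rw [Function.update_self] at hu
          exact (Finset.mem_filter.1 (hPB hu)).2
        · rw [Function.update_of_ne hj] at hu
          exact (hZ j hj u hu).1
  have hcount := Finset.sum_card_bipartiteAbove_eq_sum_card_bipartiteBelow
    (s := B) (t := W) (fun v w => G.Adj v w)
  have hbelow : ∀ w ∈ W, (B.bipartiteBelow (fun v w => G.Adj v w) w).card ≤
      (if w ∈ X then B.card else 0) + t := by
    intro w hw
    have heq : B.bipartiteBelow (fun v w => G.Adj v w) w = B.filter fun v => G.Adj w v := by
      ext v
      simp [Finset.mem_bipartiteBelow, G.adj_comm]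
    split_ifs with h
    · exact (Finset.card_filter_le _ _).trans (by omega)
    · rw [heq]
      have : ¬ t ≤ (B.filter fun v => G.Adj w v).card := fun h' =>
        h (Finset.mem_filter.2 ⟨hw, h'⟩)
      omega
  calc B.card * D ≤ ∑ v ∈ B, (W.bipartiteAbove (fun v w => G.Adj v w) v).card :=
        Finset.card_nsmul_le_sum _ _ _ hD
    _ = ∑ w ∈ W, (B.bipartiteBelow (fun v w => G.Adj v w) w).card := hcount
    _ ≤ ∑ w ∈ W, ((if w ∈ X then B.card else 0) + t) := Finset.sum_le_sum hbelow
    _ = X.card * B.card + W.card * t := by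
        rw [Finset.sum_add_distrib, Finset.sum_ite_mem, Finset.sum_const, Finset.sum_const,
          Finset.inter_eq_right.2 (Finset.filter_subset _ _), smul_eq_mul, smul_eq_mul]
    _ ≤ _ := by
        rw [mul_comm X.card, mul_comm W.card]
        gcongr

set_option maxHeartbeats 800000 in
/-- A large graph without the two forbidden configurations contains `q` disjoint sets `W i` of
almost `n` vertices and a complete multipartite graph on sets `T i` of bounded size such that the
vertices of `W i` are adjacent to almost all of `T j` for `j ≠ i`. -/
theorem exists_parts_of_template (q k t : ℕ) {γ : ℝ} (hγ : 0 < γ) :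
    ∃ M c : ℕ, (t + 1) * c + t ≤ M ∧ ∃ δ : ℝ, 0 < δ ∧ ∃ n₀ : ℕ, ∀ n ≥ n₀,
      ∀ {V : Type} [Fintype V] [DecidableEq V] (G : SimpleGraph V) [DecidableRel G.Adj] (d : ℕ),
      (d : ℝ) ≤ δ * n → BookFree G k n → BlowupFree G q t d → q * (n - 1) ≤ Fintype.card V →
      ∃ T W : Fin q → Finset V, (∀ i j, i ≠ j → FullyJoined G (T i) (T j)) ∧
        (∀ i, (T i).card = M) ∧ (∀ i j, i ≠ j → Disjoint (W i) (W j)) ∧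
        ∀ i, (1 - γ) * n ≤ (W i).card ∧ ((W i).card : ℝ) ≤ 2 * n ∧
          ∀ v ∈ W i, ∀ j, j ≠ i → ((T j).filter fun u => ¬ G.Adj v u).card ≤ c := by
  set g : ℕ := 2 * (t + 1) with hg
  set c₀ : ℝ := 2 * q + q * ((2 * g) ^ k * (1 + 2 * q)) + 1 with hc₀
  have hc₀pos : 0 < c₀ := by positivity
  set γ₁ : ℝ := min (1 / 2) (γ / c₀) with hγ₁
  have hγ₁pos : 0 < γ₁ := by positivity
  have hγ₁half : γ₁ ≤ 1 / 2 := min_le_left _ _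
  have hγ₁c : γ₁ * c₀ ≤ γ := by
    rw [← le_div_iff₀ hc₀pos]
    exact min_le_right _ _
  obtain ⟨M₁, hM₁⟩ := exists_bookFree_weight_le k t g (by omega) hγ₁pos
  set M : ℕ := M₁ + 2 * t + 1 with hM
  obtain ⟨α, hα, M₀, hM₀⟩ := exists_indep_multipartite k q M
  set M' : ℕ := M₀ + 1 with hM'
  set δ₁ : ℝ := α / (2 * (2 * M') ^ (q * t)) with hδ₁
  set δ₂ : ℝ := γ₁ / 2 ^ (M * q) with hδ₂
  have hM'pos : (0 : ℝ) < M' := by positivity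
  obtain ⟨n₁, hn₁⟩ := exists_nat_gt (2 * (M' * (2 * M') ^ (q * t)) / α : ℝ)
  obtain ⟨n₂, hn₂⟩ := exists_nat_gt (q / γ₁ : ℝ)
  refine ⟨M, (M - 1) / g, ?_, min δ₁ δ₂, by positivity, n₁ + n₂ + 2 * q + 1,
    fun n hn V _ _ G _ d hd hbook hblow hV => ?_⟩
  · have := Nat.div_mul_le_self (M - 1) g
    rw [hg] at this ⊢
    have h2 : 2 * ((t + 1) * ((M - 1) / (2 * (t + 1)))) ≤ M - 1 := by linarith
    omega
  have hnpos : (0 : ℝ) < n := by exact_mod_cast (by omega : 0 < n)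
  have hd₁ : (d : ℝ) ≤ δ₁ * n := hd.trans (by gcongr; exact min_le_left _ _)
  have hd₂ : (d : ℝ) ≤ δ₂ * n := hd.trans (by gcongr; exact min_le_right _ _)
  have hn₁' : 2 * (M' * (2 * M') ^ (q * t)) ≤ α * n := by
    rw [div_lt_iff₀ hα] at hn₁
    have : (n₁ : ℝ) ≤ n := by exact_mod_cast (by omega : n₁ ≤ n)
    nlinarith
  have hn₂' : (q : ℝ) ≤ γ₁ * n := by
    rw [div_lt_iff₀ hγ₁pos] at hn₂
    have : (n₂ : ℝ) ≤ n := by exact_mod_cast (by omega : n₂ ≤ n)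
    nlinarith
  have hVr : (q : ℝ) * n - q ≤ Fintype.card V := by
    have h1 : q * n ≤ Fintype.card V + q := by
      have : q * n = q * (n - 1) + q := by
        obtain ⟨n, rfl⟩ : ∃ n', n = n' + 1 := ⟨n - 1, by omega⟩
        simp [mul_add]
      omega
    have h2 : (q : ℝ) * n ≤ Fintype.card V + q := by exact_mod_cast h1
    linarith
  have hrich : ∀ X : Finset V, α * n ≤ X.card → ∃ T ⊆ X, T.card = M' ∧ Indep G T := by
    intro X hX
    refine hblow.exists_indep (by omega) ?_
    have h1 : (d : ℝ) * (2 * M') ^ (q * t) ≤ α * n / 2 := by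
      calc (d : ℝ) * (2 * M') ^ (q * t) ≤ δ₁ * n * (2 * M') ^ (q * t) := by gcongr
        _ = α * n / 2 := by
          rw [hδ₁]
          field_simp
    have h2 : ((M' + d : ℕ) * (2 * M' : ℕ) ^ (q * t) : ℝ) ≤ X.card := by
      push_cast
      linarith
    exact_mod_cast h2
  obtain ⟨T, hTT, hT⟩ := hM₀ M' (by omega) G n hbook hrich (by
    have : (2 * q : ℝ) ≤ n := by exact_mod_cast (by omega : 2 * q ≤ n)
    linarith)
  have hTc : ∀ i, (T i).card = M := fun i => (hT i).1
  -- vertices with at least `t` neighbours in every `T i`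
  set H : Finset V := Finset.univ.filter fun v => ∀ i, t ≤ ((T i).filter fun u => G.Adj v u).card
    with hH
  have hHc : (H.card : ℝ) ≤ γ₁ * n := by
    have h1 : H.card ≤ d * 2 ^ (M * q) := by
      refine hblow.card_common_le (R := T) (fun j => (hTc j).le) fun x hx => ?_
      refine ⟨fun j => (T j).filter fun u => G.Adj x u, fun j => Finset.filter_subset _ _,
        fun i j hij => (hTT i j hij).mono (Finset.filter_subset _ _) (Finset.filter_subset _ _),
        (Finset.mem_filter.1 hx).2, fun j u hu => (Finset.mem_filter.1 hu).2⟩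
    have h2 : (H.card : ℝ) ≤ d * 2 ^ (M * q) := by exact_mod_cast h1
    calc (H.card : ℝ) ≤ d * 2 ^ (M * q) := h2
      _ ≤ δ₂ * n * 2 ^ (M * q) := by gcongr
      _ = γ₁ * n := by
        rw [hδ₂]
        field_simp
  have hidx : ∀ v : V, v ∉ H → ∃ i, ((T i).filter fun u => G.Adj v u).card ≤ t := by
    intro v hv
    by_contra! hcon
    exact hv (Finset.mem_filter.2 ⟨Finset.mem_univ _, fun i => (hcon i).le⟩)
  rcases Nat.eq_zero_or_pos q with rfl | hq
  · exact ⟨T, fun i => i.elim0, hTT, hTc, fun i => i.elim0, fun i => i.elim0⟩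
  have : Nonempty (Fin q) := ⟨⟨0, hq⟩⟩
  choose! ι hι using hidx
  set L : Fin q → Finset V := fun i => (Finset.univ \ H).filter fun v => ι v = i with hL
  have hLdisj : ∀ i j, i ≠ j → Disjoint (L i) (L j) := by
    intro i j hij
    rw [Finset.disjoint_left]
    intro v hv hv'
    exact hij ((Finset.mem_filter.1 hv).2.symm.trans (Finset.mem_filter.1 hv').2)
  have hLT : ∀ i, ∀ v ∈ L i, ((T i).filter fun u => G.Adj v u).card ≤ t := by
    intro i v hv
    obtain ⟨hvH, rfl⟩ := Finset.mem_filter.1 hv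
    exact hι v (Finset.mem_sdiff.1 hvH).2
  set S : Fin q → Finset V := fun i => (Finset.univ \ L i).filter fun v =>
    M ≤ g * ((T i).filter fun u => ¬ G.Adj v u).card with hS
  have hweight : ∀ i, (1 - γ₁) * (L i).card + (S i).card / (2 * g) ^ k ≤ (n : ℝ) := by
    intro i
    refine hM₁ M (by omega) G n hbook (T i) (L i) (S i) (hT i).2 (hTc i) ?_ (hLT i)
      fun w hw => (Finset.mem_filter.1 hw).2
    exact Finset.disjoint_left.2 fun v hv hv' =>
      (Finset.mem_sdiff.1 (Finset.mem_filter.1 hv').1).2 hv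
  have hLup : ∀ i, ((L i).card : ℝ) ≤ (1 + 2 * γ₁) * n := by
    intro i
    have h1 := hweight i
    have h2 : (0 : ℝ) ≤ (S i).card / (2 * g) ^ k := by positivity
    have h3 : 1 ≤ (1 - γ₁) * (1 + 2 * γ₁) := by nlinarith
    have h4 : (0 : ℝ) ≤ (L i).card := Nat.cast_nonneg _
    calc ((L i).card : ℝ) ≤ (1 - γ₁) * (1 + 2 * γ₁) * (L i).card := le_mul_of_one_le_left h4 h3
      _ = (1 + 2 * γ₁) * ((1 - γ₁) * (L i).card) := by ring
      _ ≤ _ := by gcongr; linarith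
  have hLlow : ∀ i, (1 - 2 * q * γ₁) * n ≤ (L i).card := by
    intro i
    have h1 : H.card + ∑ j, (L j).card = Fintype.card V := by
      have h2 : (Finset.univ \ H).card = ∑ j, (L j).card :=
        Finset.card_eq_sum_card_fiberwise (s := Finset.univ \ H) (t := Finset.univ)
        (f := ι) (fun _ _ => Finset.mem_coe.2 (Finset.mem_univ _))
      have h3 := Finset.card_sdiff_add_card_eq_card (Finset.subset_univ H)
      rw [Finset.card_univ] at h3
      omega
    have h2 : (H.card : ℝ) + ∑ j, ((L j).card : ℝ) = Fintype.card V := by exact_mod_cast h1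
    rw [← Finset.add_sum_erase _ _ (Finset.mem_univ i)] at h2
    have h3 : ∑ j ∈ Finset.univ.erase i, ((L j).card : ℝ) ≤ (q - 1) * ((1 + 2 * γ₁) * n) := by
      refine (Finset.sum_le_card_nsmul _ _ _ fun j _ => hLup j).trans ?_
      rw [Finset.card_erase_of_mem (Finset.mem_univ _), Finset.card_univ, Fintype.card_fin,
        nsmul_eq_mul, Nat.cast_sub hq, Nat.cast_one]
    linarith
  have hSc : ∀ i, ((S i).card : ℝ) ≤ (2 * g) ^ k * (1 + 2 * q) * γ₁ * n := by
    intro i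
    have h1 := hweight i
    have h2 : (1 - γ₁) * ((1 - 2 * q * γ₁) * n) ≤ (1 - γ₁) * (L i).card := by
      gcongr
      · linarith
      · exact hLlow i
    have h3 : ((S i).card : ℝ) / (2 * g) ^ k ≤ (1 + 2 * q) * γ₁ * n := by
      have h4 : 0 ≤ γ₁ * γ₁ * q * n := by positivity
      linarith
    rw [div_le_iff₀ (by positivity)] at h3
    linarith
  set W₁ : Fin q → Finset V := fun i => L i \ Finset.univ.biUnion S with hW₁
  have hW₁L : ∀ i, W₁ i ⊆ L i := fun i => Finset.sdiff_subset
  have hW₁up : ∀ i, ((W₁ i).card : ℝ) ≤ 2 * n := by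
    intro i
    have h1 : ((W₁ i).card : ℝ) ≤ (L i).card := by exact_mod_cast Finset.card_le_card (hW₁L i)
    refine h1.trans ((hLup i).trans ?_)
    gcongr
    linarith
  have hW₁low : ∀ i, (1 - 2 * q * γ₁ - q * ((2 * g) ^ k * (1 + 2 * q) * γ₁)) * n ≤
      (W₁ i).card := by
    intro i
    have h1 : ((Finset.univ.biUnion S).card : ℝ) ≤ q * ((2 * g) ^ k * (1 + 2 * q) * γ₁ * n) := by
      have h2 : ((Finset.univ.biUnion S).card : ℝ) ≤ ∑ i, ((S i).card : ℝ) := by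
        exact_mod_cast Finset.card_biUnion_le
      refine h2.trans ((Finset.sum_le_card_nsmul _ _ _ fun j _ => hSc j).trans ?_)
      simp
    have h2 : ((L i).card : ℝ) ≤ (W₁ i).card + (Finset.univ.biUnion S).card := by
      have := Finset.le_card_sdiff (Finset.univ.biUnion S) (L i)
      exact_mod_cast (by omega : (L i).card ≤ (L i \ Finset.univ.biUnion S).card + _)
    have := hLlow i
    linarith
  refine ⟨T, W₁, hTT, hTc, fun i j hij => (hLdisj i j hij).mono (hW₁L i) (hW₁L j),
    fun i => ⟨?_, hW₁up i, fun v hv j hj => ?_⟩⟩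
  · refine le_trans ?_ (hW₁low i)
    refine mul_le_mul_of_nonneg_right ?_ hnpos.le
    rw [hc₀] at hγ₁c
    linarith
  · by_contra! hlt
    have h1 : M ≤ g * ((T j).filter fun u => ¬ G.Adj v u).card := by
      have := (Nat.div_lt_iff_lt_mul (by omega)).1 hlt
      rw [mul_comm]
      omega
    refine (Finset.mem_sdiff.1 hv).2 (Finset.mem_biUnion.2 ⟨j, Finset.mem_univ _,
      Finset.mem_filter.2 ⟨Finset.mem_sdiff.2 ⟨Finset.mem_univ _, fun hvj => ?_⟩, h1⟩⟩)
    exact Finset.disjoint_left.1 (hLdisj j i hj) hvj (hW₁L i hv)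

/-- A large graph without the two forbidden configurations contains `q` disjoint sets of almost
`n` vertices, each inducing a sparse graph. -/
theorem exists_sparse_parts (q k t : ℕ) {γ : ℝ} (hγ : 0 < γ) :
    ∃ δ : ℝ, 0 < δ ∧ ∃ n₀ : ℕ, ∀ n ≥ n₀, ∀ {V : Type} [Fintype V] [DecidableEq V]
      (G : SimpleGraph V) [DecidableRel G.Adj] (d : ℕ), (d : ℝ) ≤ δ * n → BookFree G k n →
      BlowupFree G q t d → q * (n - 1) ≤ Fintype.card V →
      ∃ W : Fin q → Finset V, (∀ i j, i ≠ j → Disjoint (W i) (W j)) ∧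
        ∀ i, (1 - γ) * n ≤ (W i).card ∧ ((W i).card : ℝ) ≤ 2 * n ∧
          ∀ v ∈ W i, (((W i).filter fun w => G.Adj v w).card : ℝ) ≤ γ * n := by
  obtain ⟨M, c, hcM, δ₁, hδ₁, n₁, hn₁⟩ := exists_parts_of_template q k t (half_pos hγ)
  obtain ⟨s, hs⟩ := exists_nat_gt (8 * t / γ : ℝ)
  have hspos : (0 : ℝ) < s := lt_of_le_of_lt (by positivity) hs
  rw [div_lt_iff₀ hγ] at hs
  set δ₂ : ℝ := γ / (4 * 2 ^ ((M + s) * q)) with hδ₂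
  obtain ⟨n₂, hn₂⟩ := exists_nat_gt (2 * s / γ : ℝ)
  refine ⟨min δ₁ δ₂, by positivity, n₁ + n₂ + 1, fun n hn V _ _ G _ d hd hbook hblow hV => ?_⟩
  have hnpos : (0 : ℝ) < n := by exact_mod_cast (by omega : 0 < n)
  have hd₂ : (d : ℝ) ≤ δ₂ * n := hd.trans (by gcongr; exact min_le_right _ _)
  have hn₂' : 2 * (s : ℝ) ≤ γ * n := by
    rw [div_lt_iff₀ hγ] at hn₂
    have : (n₂ : ℝ) ≤ n := by exact_mod_cast (by omega : n₂ ≤ n)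
    nlinarith
  obtain ⟨T, W, hTT, hT, hWdisj, hW⟩ := hn₁ n (by omega) G d
    (hd.trans (by gcongr; exact min_le_left _ _)) hbook hblow hV
  set B : Fin q → Finset V := fun i => (W i).filter fun v =>
    γ * n < ((W i).filter fun w => G.Adj v w).card with hB
  have hBc : ∀ i, (B i).card < s := by
    intro i
    by_contra! hle
    obtain ⟨B', hB'B, hB's⟩ := Finset.exists_subset_card_eq hle
    have h1 := hblow.card_mul_degree_le hTT hT (hB'B.trans (Finset.filter_subset _ _))
      (hW i).2.2 hcM (D := ⌈γ * n⌉₊)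
      fun v hv => Nat.ceil_le.2 (Finset.mem_filter.1 (hB'B hv)).2.le
    rw [hB's] at h1
    have h2 : (s : ℝ) * ⌈γ * n⌉₊ ≤ s * (d * 2 ^ ((M + s) * q)) + t * (W i).card := by
      exact_mod_cast h1
    have h3 : (d : ℝ) * 2 ^ ((M + s) * q) ≤ γ * n / 4 := by
      calc (d : ℝ) * 2 ^ ((M + s) * q) ≤ δ₂ * n * 2 ^ ((M + s) * q) := by gcongr
        _ = γ * n / 4 := by
          rw [hδ₂]
          field_simp
    have h4 : (s : ℝ) * (γ * n) ≤ s * (γ * n / 4) + t * (2 * n) := by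
      calc (s : ℝ) * (γ * n) ≤ s * ⌈γ * n⌉₊ := by gcongr; exact Nat.le_ceil _
        _ ≤ _ := h2
        _ ≤ _ := by
          gcongr
          exact (hW i).2.1
    have h5 : (8 * t : ℝ) * n < s * γ * n := by gcongr
    have h6 : 0 < (s : ℝ) * (γ * n) := by positivity
    linarith
  refine ⟨fun i => W i \ B i, fun i j hij => (hWdisj i j hij).mono Finset.sdiff_subset
    Finset.sdiff_subset, fun i => ⟨?_, ?_, fun v hv => ?_⟩⟩
  · have h1 : ((W i).card : ℝ) ≤ (W i \ B i).card + s := by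
      have := Finset.le_card_sdiff (B i) (W i)
      have := hBc i
      exact_mod_cast (by omega : (W i).card ≤ (W i \ B i).card + s)
    have := (hW i).1
    linarith
  · refine le_trans ?_ (hW i).2.1
    exact_mod_cast Finset.card_le_card Finset.sdiff_subset
  · obtain ⟨hvW, hvB⟩ := Finset.mem_sdiff.1 hv
    have h1 : (((W i).filter fun w => G.Adj v w).card : ℝ) ≤ γ * n := by
      by_contra! hlt
      exact hvB (Finset.mem_filter.2 ⟨hvW, hlt⟩)
    refine le_trans ?_ h1
    exact_mod_cast Finset.card_le_card (Finset.filter_subset_filter _ Finset.sdiff_subset)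

/-- A large graph without the two forbidden configurations contains `q` disjoint sets of almost
`n` vertices, with almost all edges present between any two of them. -/
theorem exists_core (q k t : ℕ) {η : ℝ} (hη : 0 < η) :
    ∃ δ : ℝ, 0 < δ ∧ ∃ n₀ : ℕ, ∀ n ≥ n₀, ∀ {V : Type} [Fintype V] [DecidableEq V]
      (G : SimpleGraph V) [DecidableRel G.Adj] (d : ℕ), (d : ℝ) ≤ δ * n → BookFree G k n →
      BlowupFree G q t d → q * (n - 1) ≤ Fintype.card V →
      ∃ C : Fin q → Finset V, (∀ i j, i ≠ j → Disjoint (C i) (C j)) ∧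
        (∀ i, (1 - η) * n ≤ (C i).card) ∧ ∀ i j, i ≠ j → ∀ v ∈ C i,
          (((C j).filter fun w => ¬ G.Adj v w).card : ℝ) ≤ η * n := by
  set c : ℝ := 1 + q * ((4 / η) ^ k * (k + 1)) with hc
  have hcpos : 0 < c := by positivity
  set γ : ℝ := min (η / (4 * (k + 1))) (η / c) with hγ
  have hγpos : 0 < γ := by positivity
  have hγ₁ : γ * (4 * (k + 1)) ≤ η := by
    rw [← le_div_iff₀ (by positivity)]
    exact min_le_left _ _
  have hγ₂ : γ * c ≤ η := by
    rw [← le_div_iff₀ hcpos]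
    exact min_le_right _ _
  obtain ⟨δ, hδ, n₁, hn₁⟩ := exists_sparse_parts q k t hγpos
  obtain ⟨n₂, hn₂⟩ := exists_nat_gt (4 * k / η : ℝ)
  refine ⟨δ, hδ, n₁ + n₂ + 1, fun n hn V _ _ G _ d hd hbook hblow hV => ?_⟩
  have hnpos : (0 : ℝ) < n := by exact_mod_cast (by omega : 0 < n)
  have hn₂' : 4 * (k : ℝ) ≤ η * n := by
    rw [div_lt_iff₀ hη] at hn₂
    have : (n₂ : ℝ) ≤ n := by exact_mod_cast (by omega : n₂ ≤ n)
    nlinarith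
  obtain ⟨W, hWdisj, hW⟩ := hn₁ n (by omega) G d hd hbook hblow hV
  set b : ℕ := ⌈η * n⌉₊ with hb
  have hbr : η * n ≤ b := Nat.le_ceil _
  set D : ℕ := ⌊γ * n⌋₊ with hD
  have hDr : (D : ℝ) ≤ γ * n := Nat.floor_le (by positivity)
  have hdeg : ∀ i, ∀ v ∈ W i, ((W i).filter fun w => G.Adj v w).card ≤ D :=
    fun i v hv => Nat.le_floor ((hW i).2.2 v hv)
  have hkD : 2 * (k * (D + 1)) ≤ b := by
    have h1 : (2 * (k * (D + 1)) : ℝ) ≤ b := by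
      have h2 : (k : ℝ) * D ≤ k * (γ * n) := by gcongr
      have h3 : γ * (4 * (k + 1)) * n ≤ η * n := by gcongr
      have h4 : 0 < γ * n := by positivity
      linarith
    exact_mod_cast h1
  set S : Fin q → Finset V := fun i => (Finset.univ \ W i).filter fun w =>
    b ≤ ((W i).filter fun u => ¬ G.Adj w u).card with hS
  have hSc : ∀ i, ((S i).card : ℝ) ≤ (4 / η) ^ k * (k + 1) * γ * n := by
    intro i
    rcases (S i).eq_empty_or_nonempty with h0 | hne
    · rw [h0]
      simp only [Finset.card_empty, Nat.cast_zero]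
      positivity
    obtain ⟨K, hKW, hKc, hKi, hK⟩ := exists_indep_many_common_nonneighbors (k := k) (b := b) hne
      (Nat.ceil_pos.2 (by positivity)) (fun u hu => Nat.add_le_add_right (hdeg i u hu) 1) hkD
      fun w hw => (Finset.mem_filter.1 hw).2
    set Z := commonNonneighbors G (S i) K with hZ
    have hW1 := card_le_card_common_nonneighbors_add fun u hu => hdeg i u (hKW hu)
    have hbk := hbook K hKc hKi
    have hdisj : Disjoint (commonNonneighbors G (W i) K) Z := by
      rw [Finset.disjoint_left]
      intro w hw hw'
      exact (Finset.mem_sdiff.1 (Finset.mem_filter.1 (mem_commonNonneighbors.1 hw').1).1).2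
        (mem_commonNonneighbors.1 hw).1
    have hle : (commonNonneighbors G (W i) K).card + Z.card ≤
        (commonNonneighbors G Finset.univ K).card := by
      rw [← Finset.card_union_of_disjoint hdisj]
      exact Finset.card_le_card (Finset.union_subset
        (commonNonneighbors_mono (Finset.subset_univ _) _)
        (commonNonneighbors_mono (Finset.subset_univ _) _))
    rw [hKc] at hW1
    have h1 : ((W i).card : ℝ) + Z.card ≤ n + k * D := by
      exact_mod_cast (by omega : (W i).card + Z.card ≤ n + k * D)
    have hZc : (Z.card : ℝ) ≤ (k + 1) * γ * n := by
      have h2 : (k : ℝ) * D ≤ k * (γ * n) := by gcongr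
      have := (hW i).1
      linarith
    have h3 : (b : ℝ) ^ k * (S i).card ≤ (2 * (W i).card) ^ k * Z.card := by exact_mod_cast hK
    have h4 : (η * n) ^ k * (S i).card ≤ (4 * n) ^ k * Z.card := by
      calc (η * n) ^ k * (S i).card ≤ (b : ℝ) ^ k * (S i).card := by gcongr
        _ ≤ _ := h3
        _ ≤ (2 * (2 * n)) ^ k * Z.card := by
          gcongr
          exact (hW i).2.1
        _ = _ := by ring
    have h5 : ((S i).card : ℝ) ≤ (4 / η) ^ k * Z.card := by
      refine le_of_mul_le_mul_left ?_ (by positivity : 0 < (η * n) ^ k)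
      calc (η * n) ^ k * (S i).card ≤ (4 * n) ^ k * Z.card := h4
        _ = (η * n * (4 / η)) ^ k * Z.card := by
          congr 2
          field_simp
        _ = _ := by
          rw [mul_pow]
          ring
    calc ((S i).card : ℝ) ≤ (4 / η) ^ k * Z.card := h5
      _ ≤ (4 / η) ^ k * ((k + 1) * γ * n) := by gcongr
      _ = _ := by ring
  refine ⟨fun i => W i \ Finset.univ.biUnion S, fun i j hij => (hWdisj i j hij).mono
    Finset.sdiff_subset Finset.sdiff_subset, fun i => ?_, fun i j hij v hv => ?_⟩
  · have h1 : ((Finset.univ.biUnion S).card : ℝ) ≤ q * ((4 / η) ^ k * (k + 1) * γ * n) := by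
      have h2 : ((Finset.univ.biUnion S).card : ℝ) ≤ ∑ i, ((S i).card : ℝ) := by
        exact_mod_cast Finset.card_biUnion_le
      refine h2.trans ((Finset.sum_le_card_nsmul _ _ _ fun j _ => hSc j).trans ?_)
      simp
    have h2 : ((W i).card : ℝ) ≤ (W i \ Finset.univ.biUnion S).card +
        (Finset.univ.biUnion S).card := by
      have := Finset.le_card_sdiff (Finset.univ.biUnion S) (W i)
      exact_mod_cast (by omega : (W i).card ≤ (W i \ Finset.univ.biUnion S).card + _)
    have h3 := (hW i).1
    have h4 : γ * c * n ≤ η * n := by gcongr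
    rw [hc] at h4
    linarith
  · obtain ⟨hvW, hvS⟩ := Finset.mem_sdiff.1 hv
    have h1 : ((W j).filter fun u => ¬ G.Adj v u).card < b := by
      by_contra! hle
      refine hvS (Finset.mem_biUnion.2 ⟨j, Finset.mem_univ _, Finset.mem_filter.2
        ⟨Finset.mem_sdiff.2 ⟨Finset.mem_univ _, fun hvj => ?_⟩, hle⟩⟩)
      exact Finset.disjoint_left.1 (hWdisj i j hij) hvW hvj
    have h2 := Nat.lt_ceil.1 h1
    refine le_trans ?_ h2.le
    exact_mod_cast Finset.card_le_card (Finset.filter_subset_filter _ Finset.sdiff_subset)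

/-- There is no complete multipartite subgraph consisting of a single vertex, a part of size `s`,
a part of size `d` and `q - 2` further parts of size `t`. -/
def StarBlowupFree {V : Type*} (G : SimpleGraph V) (q s t d : ℕ) : Prop :=
  ∀ (v : V) (P : Fin q → Finset V) (i j : Fin q), i ≠ j →
    (∀ a b, a ≠ b → FullyJoined G (P a) (P b)) → (∀ l, ∀ x ∈ P l, G.Adj v x) →
    s ≤ (P i).card → (∀ l, l ≠ i → l ≠ j → t ≤ (P l).card) → (P j).card < d

theorem hasCopy_KMulti_of_parts {V : Type*} {G : SimpleGraph V} {p : ℕ} {a : Fin p → ℕ}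
    (P : Fin p → Finset V) (hP : ∀ i j, i ≠ j → FullyJoined G (P i) (P j))
    (ha : ∀ i, a i ≤ (P i).card) : HasCopy G (KMulti a) := by
  have hadj : ∀ {x y : Σ i : Fin p, Fin (a i)}, x.1 ≠ y.1 →
      G.Adj ((P x.1).equivFin.symm (Fin.castLE (ha x.1) x.2))
        ((P y.1).equivFin.symm (Fin.castLE (ha y.1) y.2)) :=
    fun h => hP _ _ h _ (Subtype.prop _) _ (Subtype.prop _)
  refine ⟨⟨fun x => (P x.1).equivFin.symm (Fin.castLE (ha x.1) x.2), fun h => hadj h⟩, ?_⟩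
  rintro ⟨i, x⟩ ⟨j, y⟩ h
  by_cases hij : i = j
  · subst hij
    have h1 := (P i).equivFin.symm.injective (Subtype.ext h)
    have h2 : x = y := Fin.castLE_injective (ha i) h1
    rw [h2]
  · exact absurd h (hadj (x := ⟨i, x⟩) (y := ⟨j, y⟩) hij).ne

theorem hasCopy_Book_of_indep {V : Type*} [Fintype V] [DecidableEq V] {G : SimpleGraph V}
    [DecidableRel G.Adj] {k n : ℕ} {K : Finset V} (hKc : K.card = k) (hK : Indep G K)
    (hn : n ≤ (commonNonneighbors G Finset.univ K).card) : HasCopy Gᶜ (Book k n) := by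
  set P : Fin (k + 1) → Finset V :=
    Fin.snoc (α := fun _ => Finset V)
      (fun i => {((K.equivFinOfCardEq hKc).symm i : V)}) (commonNonneighbors G Finset.univ K \ K)
    with hP
  refine hasCopy_KMulti_of_parts P (fun i j hij => ?_) fun i => ?_
  · have key : ∀ i : Fin k, FullyJoined Gᶜ (P i.castSucc) (P (Fin.last k)) := by
      intro i x hx y hy
      simp only [hP, Fin.snoc_castSucc, Fin.snoc_last, Finset.mem_singleton,
        Finset.mem_sdiff, mem_commonNonneighbors] at hx hy
      have hxK : x ∈ K := hx ▸ Subtype.prop _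
      refine (compl_adj _ _ _).2 ⟨?_, hy.1.2 x hxK⟩
      rintro rfl
      exact hy.2 hxK
    induction i using Fin.lastCases with
    | last =>
      induction j using Fin.lastCases with
      | last => exact absurd rfl hij
      | cast j => exact (key j).symm
    | cast i =>
      induction j using Fin.lastCases with
      | last => exact key i
      | cast j =>
        intro x hx y hy
        simp only [hP, Fin.snoc_castSucc, Finset.mem_singleton] at hx hy
        subst hx hy
        refine (compl_adj _ _ _).2 ⟨fun h => hij ?_, hK _ (Subtype.prop _) _ (Subtype.prop _)⟩
        rw [(K.equivFinOfCardEq hKc).symm.injective (Subtype.ext h)]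
  · induction i using Fin.lastCases with
    | last =>
      have := Finset.le_card_sdiff K (commonNonneighbors G Finset.univ K)
      simp only [hP, Fin.snoc_last, Fin.val_last, lt_irrefl, if_false]
      omega
    | cast i => simp [hP]

theorem bookFree_of_not_hasCopy {V : Type*} [Fintype V] [DecidableEq V] {G : SimpleGraph V}
    [DecidableRel G.Adj] {k n : ℕ} (h : ¬ HasCopy Gᶜ (Book k n)) : BookFree G k n := by
  intro K hKc hK
  by_contra! hle
  exact h (hasCopy_Book_of_indep hKc hK hle)

theorem blowupFree_of_not_hasCopy {V : Type*} {G : SimpleGraph V} {q t : ℕ} {a : Fin (q + 1) → ℕ}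
    (h : ¬ HasCopy G (KMulti a)) (ha : ∀ i : Fin q, a i.castSucc ≤ t) :
    BlowupFree G q t (a (Fin.last q)) := by
  intro P X hP hX ht
  by_contra! hle
  refine h (hasCopy_KMulti_of_parts (Fin.snoc (α := fun _ => Finset V) P X) (fun i j hij => ?_)
    fun i => ?_)
  · induction i using Fin.lastCases with
    | last =>
      induction j using Fin.lastCases with
      | last => exact absurd rfl hij
      | cast j => simpa using (hX j).symm
    | cast i =>
      induction j using Fin.lastCases with
      | last => simpa using hX i
      | cast j => simpa using hP i j fun h => hij (by rw [h])
  · induction i using Fin.lastCases with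
    | last => simpa using hle
    | cast i => simpa using (ha i).trans (ht i)

theorem starBlowupFree_of_not_hasCopy {V : Type*} {G : SimpleGraph V} {r t : ℕ}
    {a : Fin (r + 3) → ℕ} (h : ¬ HasCopy G (KMulti a))
    (ha : ∀ i : Fin (r + 2), a i.castSucc ≤ t) (ha0 : a 0 = 1) :
    StarBlowupFree G (r + 2) (a 1) t (a (Fin.last (r + 2))) := by
  intro v P i j hij hP hv hs ht
  by_contra! hle
  obtain ⟨σ, hσ0, hσl⟩ : ∃ σ : Equiv.Perm (Fin (r + 2)), σ 0 = i ∧ σ (Fin.last _) = j := by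
    set τ : Equiv.Perm (Fin (r + 2)) := Equiv.swap 0 i with hτ
    have hτj : τ j ≠ 0 := by
      intro h0
      have : τ j = τ i := by rw [h0, hτ, Equiv.swap_apply_right]
      exact hij (τ.injective this).symm
    refine ⟨(Equiv.swap (Fin.last _) (τ j)).trans τ, ?_, ?_⟩
    · rw [Equiv.trans_apply, Equiv.swap_apply_of_ne_of_ne (Fin.last_pos.ne) hτj.symm, hτ,
        Equiv.swap_apply_left]
    · rw [Equiv.trans_apply, Equiv.swap_apply_left, hτ, Equiv.swap_apply_self]
  refine h (hasCopy_KMulti_of_parts (Fin.cons (α := fun _ => Finset V) {v} fun l => P (σ l))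
    (fun x y hxy => ?_) fun x => ?_)
  · have key : ∀ l, FullyJoined G {v} (P l) := by
      intro l x hx y hy
      rw [Finset.mem_singleton.1 hx]
      exact hv l y hy
    induction x using Fin.cases with
    | zero =>
      induction y using Fin.cases with
      | zero => exact absurd rfl hxy
      | succ y => simpa using key (σ y)
    | succ x =>
      induction y using Fin.cases with
      | zero => simpa using (key (σ x)).symm
      | succ y => simpa using hP _ _ fun h => hxy (by rw [σ.injective h])
  · induction x using Fin.cases with
    | zero => simp [ha0]
    | succ x =>
      simp only [Fin.cons_succ]
      by_cases h0 : x = 0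
      · subst h0
        rw [hσ0]
        exact hs
      by_cases hl : x = Fin.last _
      · subst hl
        rw [hσl]
        exact hle
      · refine le_trans ?_ (ht (σ x) (fun h => h0 (σ.injective (h.trans hσ0.symm)))
          fun h => hl (σ.injective (h.trans hσl.symm)))
        obtain ⟨y, rfl⟩ := Fin.exists_castSucc_eq.2 hl
        exact ha y.succ

/-- A vertex with many neighbours in all parts but one has fewer than `s` neighbours
in that part. -/
theorem StarBlowupFree.card_filter_adj_lt {V : Type*} [DecidableEq V] {G : SimpleGraph V}
    [DecidableRel G.Adj] {q s t d D m : ℕ} (hG : StarBlowupFree G q s t d) (hq : 2 ≤ q)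
    {C : Fin q → Finset V}
    (hC : ∀ i j, i ≠ j → ∀ v ∈ C i, ((C j).filter fun w => ¬ G.Adj v w).card ≤ D)
    (hm : (s + q * t) * D + t + d ≤ m) {v : V} {i : Fin q}
    (hv : ∀ j, j ≠ i → m ≤ ((C j).filter (G.Adj v)).card) :
    ((C i).filter (G.Adj v)).card < s := by
  by_contra! hle
  obtain ⟨W, hWi, hWs⟩ := Finset.exists_subset_card_eq hle
  have hnt : Nontrivial (Fin q) := Fin.nontrivial_iff_two_le.2 hq
  obtain ⟨j₀, hj₀⟩ := exists_ne i
  have hext : ∀ (P : Fin q → Finset V) (j : Fin q), j ≠ i → P j = ∅ →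
      (∀ l, P l ⊆ (C l).filter (G.Adj v)) → (P i).card = s → (∀ l, l ≠ i → (P l).card ≤ t) →
      ∃ A ⊆ (C j).filter (G.Adj v), t + d ≤ A.card ∧ ∀ l, FullyJoined G (P l) A := by
    intro P j hj hPj hPC hPi hPl
    set Z := Finset.univ.biUnion P with hZ
    have hZc : Z.card ≤ s + q * t := by
      refine Finset.card_biUnion_le.trans ?_
      rw [← Finset.add_sum_erase _ _ (Finset.mem_univ i), hPi]
      refine Nat.add_le_add_left ((Finset.sum_le_card_nsmul _ _ t fun l hl =>
        hPl l (Finset.ne_of_mem_erase hl)).trans ?_) s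
      rw [smul_eq_mul]
      gcongr
      exact (Finset.card_le_univ _).trans (Fintype.card_fin q).le
    set Y := Z.biUnion fun u => (C j).filter fun w => ¬ G.Adj u w with hY
    have hYc : Y.card ≤ (s + q * t) * D := by
      refine (Finset.card_biUnion_le_card_mul _ _ D fun u hu => ?_).trans (by gcongr)
      obtain ⟨l, -, hl⟩ := Finset.mem_biUnion.1 hu
      refine hC l j ?_ u (Finset.mem_filter.1 (hPC l hl)).1
      rintro rfl
      rw [hPj] at hl
      exact absurd hl (Finset.notMem_empty _)
    refine ⟨(C j).filter (G.Adj v) \ Y, Finset.sdiff_subset, ?_, fun l u hu w hw => ?_⟩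
    · have h1 := Finset.le_card_sdiff Y ((C j).filter (G.Adj v))
      have h2 := hv j hj
      omega
    · obtain ⟨hw, hwY⟩ := Finset.mem_sdiff.1 hw
      by_contra hadj
      exact hwY (Finset.mem_biUnion.2 ⟨u, Finset.mem_biUnion.2 ⟨l, Finset.mem_univ _, hu⟩,
        Finset.mem_filter.2 ⟨(Finset.mem_filter.1 hw).1, hadj⟩⟩)
  have hupd : ∀ (P : Fin q → Finset V) (j : Fin q) (A : Finset V),
      (∀ a b, a ≠ b → FullyJoined G (P a) (P b)) → (∀ l, FullyJoined G (P l) A) →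
      ∀ a b, a ≠ b → FullyJoined G (Function.update P j A a) (Function.update P j A b) := by
    intro P j A hP hA a b hab
    by_cases ha : a = j
    · subst ha
      rw [Function.update_self, Function.update_of_ne hab.symm]
      exact (hA b).symm
    · rw [Function.update_of_ne ha]
      by_cases hb : b = j
      · subst hb
        rw [Function.update_self]
        exact hA a
      · rw [Function.update_of_ne hb]
        exact hP a b hab
  have hgreedy : ∀ J : Finset (Fin q), i ∉ J → ∃ P : Fin q → Finset V,
      (P i).card = s ∧ (∀ l ∈ J, (P l).card = t) ∧ (∀ l, l ≠ i → l ∉ J → P l = ∅) ∧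
      (∀ l, P l ⊆ (C l).filter (G.Adj v)) ∧ ∀ a b, a ≠ b → FullyJoined G (P a) (P b) := by
    intro J
    induction J using Finset.induction_on with
    | empty =>
      intro _
      refine ⟨Function.update (fun _ => ∅) i W, by simpa using hWs, by simp, fun l hl _ => by
        simp [hl], fun l => ?_, hupd _ _ _ (fun _ _ _ => by simp [FullyJoined])
        fun _ => by simp [FullyJoined]⟩
      by_cases hl : l = i
      · subst hl
        simpa using hWi
      · simp [hl]
    | insert j J hjJ ih =>
      intro hi
      rw [Finset.mem_insert, not_or] at hi
      obtain ⟨P, hPi, hPJ, hPe, hPC, hPP⟩ := ih hi.2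
      obtain ⟨A, hA, hAc, hPA⟩ := hext P j (Ne.symm hi.1) (hPe j (Ne.symm hi.1) hjJ) hPC hPi
        fun l hl => by
          by_cases hlJ : l ∈ J
          · exact (hPJ l hlJ).le
          · simp [hPe l hl hlJ]
      obtain ⟨A', hA'A, hA'c⟩ := Finset.exists_subset_card_eq (by omega : t ≤ A.card)
      refine ⟨Function.update P j A', ?_, fun l hl => ?_, fun l hl hlJ => ?_, fun l => ?_,
        hupd P j A' hPP fun l => (hPA l).mono subset_rfl hA'A⟩
      · rwa [Function.update_of_ne hi.1]
      · by_cases hlj : l = j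
        · subst hlj
          rwa [Function.update_self]
        · rw [Function.update_of_ne hlj]
          exact hPJ l (Finset.mem_of_mem_insert_of_ne hl hlj)
      · rw [Finset.mem_insert, not_or] at hlJ
        rw [Function.update_of_ne hlJ.1]
        exact hPe l hl hlJ.2
      · by_cases hlj : l = j
        · subst hlj
          rw [Function.update_self]
          exact hA'A.trans hA
        · rw [Function.update_of_ne hlj]
          exact hPC l
  obtain ⟨P, hPi, hPJ, hPe, hPC, hPP⟩ := hgreedy ((Finset.univ.erase i).erase j₀) (by simp)
  obtain ⟨A, hA, hAc, hPA⟩ := hext P j₀ hj₀ (hPe j₀ hj₀ (by simp)) hPC hPi fun l hl => by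
    by_cases hlj : l = j₀
    · subst hlj
      simp [hPe l hl (by simp)]
    · exact (hPJ l (by simp [hl, hlj])).le
  have hlt := hG v (Function.update P j₀ A) i j₀ hj₀.symm (hupd P j₀ A hPP hPA) (fun l x hx => by
    by_cases hlj : l = j₀
    · subst hlj
      rw [Function.update_self] at hx
      exact (Finset.mem_filter.1 (hA hx)).2
    · rw [Function.update_of_ne hlj] at hx
      exact (Finset.mem_filter.1 (hPC l hx)).2)
    (by rw [Function.update_of_ne hj₀.symm, hPi]) fun l hl hlj => by
      rw [Function.update_of_ne hlj]
      exact (hPJ l (by simp [hl, hlj])).ge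
  rw [Function.update_self] at hlt
  omega

/-- The vertices of `C` outside a small exceptional set have no neighbour in `A \ C` and at most
the proportion `1 / (2 * k)` of `B` as neighbours. -/
theorem exists_subset_few_neighbors {V : Type*} [DecidableEq V] {G : SimpleGraph V}
    [DecidableRel G.Adj] {A B C : Finset V} {k s m : ℕ}
    (hA : ∀ v ∈ A, (C.filter (G.Adj v)).card ≤ s) (hB : ∀ v ∈ B, (C.filter (G.Adj v)).card ≤ m) :
    ∃ C' ⊆ C, C.card ≤ C'.card + (A \ C).card * s + 2 * k * m ∧
      (∀ u ∈ C', A.filter (G.Adj u) ⊆ C.filter (G.Adj u)) ∧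
      ∀ u ∈ C', 2 * k * (B.filter (G.Adj u)).card ≤ B.card := by
  set Y := (A \ C).biUnion fun v => C.filter (G.Adj v) with hY
  set Z := C.filter fun u => B.card < 2 * k * (B.filter (G.Adj u)).card with hZ
  have hYc : Y.card ≤ (A \ C).card * s :=
    Finset.card_biUnion_le_card_mul _ _ _ fun v hv => hA v (Finset.mem_sdiff.1 hv).1
  have hZc : Z.card ≤ 2 * k * m := by
    rcases B.eq_empty_or_nonempty with rfl | hne
    · simp [hZ]
    refine Nat.le_of_mul_le_mul_right ?_ hne.card_pos
    have hcount := Finset.sum_card_bipartiteAbove_eq_sum_card_bipartiteBelow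
      (s := Z) (t := B) (fun u v => G.Adj u v)
    calc Z.card * B.card ≤ ∑ u ∈ Z, 2 * k * (B.bipartiteAbove (fun u v => G.Adj u v) u).card :=
          Finset.card_nsmul_le_sum _ _ _ fun u hu => (Finset.mem_filter.1 hu).2.le
      _ = 2 * k * ∑ v ∈ B, (Z.bipartiteBelow (fun u v => G.Adj u v) v).card := by
          rw [← Finset.mul_sum, hcount]
      _ ≤ 2 * k * (B.card * m) := by
          gcongr
          refine Finset.sum_le_card_nsmul _ _ _ fun v hv => (Finset.card_le_card ?_).trans (hB v hv)
          intro u hu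
          obtain ⟨hu, huv⟩ := Finset.mem_filter.1 hu
          exact Finset.mem_filter.2 ⟨(Finset.mem_filter.1 hu).1, huv.symm⟩
      _ = _ := by ring
  refine ⟨C \ (Y ∪ Z), Finset.sdiff_subset, ?_, fun u hu w hw => ?_, fun u hu => ?_⟩
  · have h1 := Finset.le_card_sdiff (Y ∪ Z) C
    have h2 := Finset.card_union_le Y Z
    omega
  · obtain ⟨hw, huw⟩ := Finset.mem_filter.1 hw
    obtain ⟨hu, huY⟩ := Finset.mem_sdiff.1 hu
    refine Finset.mem_filter.2 ⟨?_, huw⟩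
    by_contra hwC
    exact huY (Finset.mem_union_left _ (Finset.mem_biUnion.2
      ⟨w, Finset.mem_sdiff.2 ⟨hw, hwC⟩, Finset.mem_filter.2 ⟨hu, huw.symm⟩⟩))
  · obtain ⟨hu, huY⟩ := Finset.mem_sdiff.1 hu
    by_contra! hlt
    exact huY (Finset.mem_union_right _ (Finset.mem_filter.2 ⟨hu, hlt⟩))

/-- Weighted bound for the vertices assigned to the part `C`, where `A` are those assigned to `C`
only and `B` those assigned to `C` and to some other part. -/
theorem BookFree.two_mul_card_add_card_le {V : Type*} [Fintype V] [DecidableEq V]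
    {G : SimpleGraph V} [DecidableRel G.Adj] {k n s m : ℕ} (hG : BookFree G k n) (hk : 1 ≤ k)
    {A B C : Finset V} (hCA : C ⊆ A) (hAB : Disjoint A B)
    (hA : ∀ v ∈ A, (C.filter (G.Adj v)).card ≤ s) (hB : ∀ v ∈ B, (C.filter (G.Adj v)).card ≤ m)
    (hC : (A \ C).card * s + 2 * k * m + 2 * (k * (s + 1)) + s ≤ C.card) :
    2 * A.card + B.card ≤ 2 * (n - 1 + k * s) := by
  obtain ⟨C', hC'C, hC', hA', hB'⟩ := exists_subset_few_neighbors (k := k) hA hB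
  have hdeg : ∀ u ∈ C', (C'.filter (G.Adj u)).card ≤ s := fun u hu =>
    (Finset.card_le_card (Finset.filter_subset_filter _ hC'C)).trans (hA u (hCA (hC'C hu)))
  have hpos : 0 < 2 * (k * (s + 1)) := by positivity
  obtain ⟨K, hKC, hKc, hK, -⟩ := exists_indep_many_common_nonneighbors (U := C') (S := C')
    (k := k) (D := s + 1) (Finset.card_pos.1 (by omega)) hpos
    (fun u hu => Nat.add_le_add_right (hdeg u hu) 1) le_rfl fun w hw => by
      have h1 := Finset.card_filter_add_card_filter_not (s := C') (G.Adj w)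
      have h2 := hdeg w hw
      omega
  have h1 : A.card ≤ (commonNonneighbors G A K).card + K.card * s :=
    card_le_card_common_nonneighbors_add fun u hu =>
      (Finset.card_le_card (hA' u (hKC hu))).trans (hA u (hCA (hC'C (hKC hu))))
  have h2 : B.card ≤ (commonNonneighbors G B K).card + K.card * (B.card / (2 * k)) :=
    card_le_card_common_nonneighbors_add fun u hu => by
      rw [Nat.le_div_iff_mul_le (by positivity), mul_comm]
      exact hB' u (hKC hu)
  have h3 := Nat.div_mul_le_self B.card (2 * k)
  have h4 : (commonNonneighbors G A K).card + (commonNonneighbors G B K).card < n := by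
    refine lt_of_le_of_lt ?_ (hG K hKc hK)
    have hdisj : Disjoint (commonNonneighbors G A K) (commonNonneighbors G B K) :=
      hAB.mono (commonNonneighbors_subset _ _) (commonNonneighbors_subset _ _)
    rw [← Finset.card_union_of_disjoint hdisj]
    exact Finset.card_le_card (Finset.union_subset
      (commonNonneighbors_mono (Finset.subset_univ _) _)
      (commonNonneighbors_mono (Finset.subset_univ _) _))
  rw [hKc] at h1 h2
  have h5 : B.card / (2 * k) * (2 * k) = 2 * (k * (B.card / (2 * k))) := by ring
  omega

theorem two_le_sum_indicator {q : ℕ} {J : Finset (Fin q)} (hJ : J.Nonempty) :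
    2 ≤ ∑ i, (2 * (if J = {i} then 1 else 0) + if i ∈ J ∧ 2 ≤ J.card then 1 else 0) := by
  rcases lt_or_ge J.card 2 with h | h
  · obtain ⟨i, rfl⟩ := Finset.card_eq_one.1 (by have := hJ.card_pos; omega : J.card = 1)
    refine le_trans ?_ (Finset.single_le_sum (fun _ _ => Nat.zero_le _) (Finset.mem_univ i))
    simp
  · refine h.trans ?_
    calc J.card = ∑ i, if i ∈ J ∧ 2 ≤ J.card then 1 else 0 := by simp [h]
      _ ≤ _ := Finset.sum_le_sum fun i _ => Nat.le_add_left _ _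

theorem card_ne_of_core {V : Type*} [Fintype V] [DecidableEq V] {G : SimpleGraph V}
    [DecidableRel G.Adj] {q k s t d n D : ℕ} (hq : 2 ≤ q) (hk : 1 ≤ k) (hst : s + 1 ≤ t)
    (hbook : BookFree G k n) (hstar : StarBlowupFree G q (s + 1) t d) {C : Fin q → Finset V}
    (hdisj : ∀ i j, i ≠ j → Disjoint (C i) (C j)) (hCc : ∀ i, n ≤ (C i).card + D)
    (hCD : ∀ i j, i ≠ j → ∀ v ∈ C i, ((C j).filter fun w => ¬ G.Adj v w).card ≤ D)
    (hn : 2 * D + (q * D + q * (k * t) + 1) * t + 2 * k * ((t + q * t) * D + t + d) +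
      2 * (k * t) + t ≤ n) :
    Fintype.card V ≠ q * (n - 1 + k * s) + 1 := by
  intro hV
  set m : ℕ := (t + q * t) * D + t + d with hm
  have hkm : 2 * m ≤ 2 * k * m := by
    have := Nat.mul_le_mul_right (2 * m) hk
    linarith
  set J : V → Finset (Fin q) := fun v =>
    Finset.univ.filter fun i => ((C i).filter (G.Adj v)).card < m with hJ
  have hmem : ∀ v i, i ∈ J v ↔ ((C i).filter (G.Adj v)).card < m := fun v i => by simp [hJ]
  have hlt : ∀ v i, (∀ j, j ≠ i → j ∉ J v) → ((C i).filter (G.Adj v)).card < s + 1 := by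
    intro v i hv
    refine hstar.card_filter_adj_lt hq hCD (m := m) ?_ fun j hj => ?_
    · rw [hm]
      gcongr
    · have := hv j hj
      rw [hmem] at this
      omega
  have hJne : ∀ v, (J v).Nonempty := by
    intro v
    by_contra! hJv
    have h1 := hlt v ⟨0, by omega⟩ fun j _ => by simp [hJv]
    have h2 : (⟨0, by omega⟩ : Fin q) ∈ J v := by
      rw [hmem]
      omega
    rw [hJv] at h2
    exact absurd h2 (Finset.notMem_empty _)
  have hJC : ∀ i, ∀ v ∈ C i, J v = {i} := by
    intro i v hv
    refine (Finset.Nonempty.subset_singleton_iff (hJne v)).1 fun j hj => ?_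
    rw [Finset.mem_singleton]
    by_contra hji
    rw [hmem] at hj
    have h1 := hCD i j (Ne.symm hji) v hv
    have h2 := hCc j
    have h3 := Finset.card_filter_add_card_filter_not (s := C j) (G.Adj v)
    omega
  set A : Fin q → Finset V := fun i => Finset.univ.filter fun v => J v = {i} with hA
  set B : Fin q → Finset V := fun i => Finset.univ.filter fun v => i ∈ J v ∧ 2 ≤ (J v).card
    with hB
  have hCA : ∀ i, C i ⊆ A i := fun i v hv =>
    Finset.mem_filter.2 ⟨Finset.mem_univ _, hJC i v hv⟩
  have hrest : (Finset.univ \ Finset.univ.biUnion C).card ≤ q * D + q * (k * t) + 1 := by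
    have h1 : (Finset.univ.biUnion C).card = ∑ i, (C i).card :=
      Finset.card_biUnion fun i _ j _ hij => hdisj i j hij
    have h2 : q * n ≤ ∑ i, ((C i).card + D) := by
      simpa using Finset.card_nsmul_le_sum Finset.univ _ n fun i _ => hCc i
    rw [Finset.sum_add_distrib, ← h1, Finset.sum_const, Finset.card_univ, Fintype.card_fin,
      smul_eq_mul] at h2
    have h3 := Finset.card_sdiff_add_card_eq_card (Finset.subset_univ (Finset.univ.biUnion C))
    rw [Finset.card_univ, hV] at h3
    have h4 : q * (n - 1 + k * s) ≤ q * (n + k * t) := by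
      gcongr
      · omega
      · omega
    rw [mul_add q n] at h4
    omega
  have hAC : ∀ i, (A i \ C i).card ≤ q * D + q * (k * t) + 1 := by
    intro i
    refine (Finset.card_le_card fun v hv => ?_).trans hrest
    obtain ⟨hvA, hvC⟩ := Finset.mem_sdiff.1 hv
    refine Finset.mem_sdiff.2 ⟨Finset.mem_univ _, fun hvU => ?_⟩
    obtain ⟨j, -, hj⟩ := Finset.mem_biUnion.1 hvU
    have h1 : ({i} : Finset (Fin q)) = {j} :=
      (Finset.mem_filter.1 hvA).2.symm.trans (hJC j v hj)
    rw [Finset.singleton_inj.1 h1] at hvC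
    exact hvC hj
  have hle : ∀ i, 2 * (A i).card + (B i).card ≤ 2 * (n - 1 + k * s) := by
    intro i
    refine hbook.two_mul_card_add_card_le hk (hCA i) ?_ (fun v hv => ?_) (m := m) (fun v hv => ?_)
      ?_
    · rw [Finset.disjoint_left]
      intro v hv hv'
      have h1 := (Finset.mem_filter.1 hv').2.2
      rw [(Finset.mem_filter.1 hv).2, Finset.card_singleton] at h1
      omega
    · refine Nat.lt_succ_iff.1 (hlt v i fun j hj => ?_)
      rw [(Finset.mem_filter.1 hv).2, Finset.mem_singleton]
      exact hj
    · exact ((hmem v i).1 (Finset.mem_filter.1 hv).2.1).le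
    · have h1 : (A i \ C i).card * s ≤ (q * D + q * (k * t) + 1) * t := by
        gcongr
        · exact hAC i
        · omega
      have h2 : k * (s + 1) ≤ k * t := by gcongr
      have h3 := hCc i
      omega
  have hsum : 2 * Fintype.card V ≤ ∑ i, (2 * (A i).card + (B i).card) := by
    calc 2 * Fintype.card V = ∑ _v : V, 2 := by simp [mul_comm]
      _ ≤ ∑ v, ∑ i, (2 * (if J v = {i} then 1 else 0) +
          if i ∈ J v ∧ 2 ≤ (J v).card then 1 else 0) :=
        Finset.sum_le_sum fun v _ => two_le_sum_indicator (hJne v)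
      _ = _ := by
        rw [Finset.sum_comm]
        refine Finset.sum_congr rfl fun i _ => ?_
        rw [Finset.sum_add_distrib, ← Finset.mul_sum, Finset.card_filter, Finset.card_filter]
  have hsum' : ∑ i, (2 * (A i).card + (B i).card) ≤ q * (2 * (n - 1 + k * s)) := by
    simpa using Finset.sum_le_card_nsmul Finset.univ _ _ fun i _ => hle i
  rw [hV] at hsum
  have h1 : q * (2 * (n - 1 + k * s)) = 2 * (q * (n - 1 + k * s)) := by ring
  omega

/-- A graph without a book and without the complete multipartite graphs excluded by `BlowupFree`
and `StarBlowupFree` cannot have the critical number of vertices. -/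
theorem exists_card_ne (q k t : ℕ) (hq : 2 ≤ q) (hk : 1 ≤ k) :
    ∃ δ : ℝ, 0 < δ ∧ ∃ n₀ : ℕ, ∀ n ≥ n₀, ∀ {V : Type} [Fintype V] [DecidableEq V]
      (G : SimpleGraph V) [DecidableRel G.Adj] (s d : ℕ), s + 1 ≤ t → (d : ℝ) ≤ δ * n →
      BookFree G k n → BlowupFree G q t d → StarBlowupFree G q (s + 1) t d →
      Fintype.card V ≠ q * (n - 1 + k * s) + 1 := by
  set c₁ : ℝ := 2 + q * t + 2 * k * (t + q * t) with hc₁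
  set c₂ : ℝ := (q * (k * t) + 1) * t + 2 * k * t + 2 * (k * t) + t with hc₂
  have hc₁pos : 0 < c₁ := by positivity
  obtain ⟨δ, hδ, n₁, hn₁⟩ := exists_core q k t (η := 1 / (4 * c₁)) (by positivity)
  obtain ⟨n₂, hn₂⟩ := exists_nat_gt (4 * c₂)
  have hkpos : (0 : ℝ) < k := by exact_mod_cast hk
  refine ⟨min δ (1 / (8 * k)), by positivity, n₁ + n₂,
    fun n hn V _ _ G _ s d hst hd hbook hblow hstar hV => ?_⟩
  obtain ⟨C, hdisj, hCc, hCD⟩ := hn₁ n (by omega) G d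
    (hd.trans (by gcongr; exact min_le_left _ _)) hbook hblow (by
      rw [hV, mul_add]
      omega)
  set D : ℕ := ⌊1 / (4 * c₁) * (n : ℝ)⌋₊ with hD
  have hDr : (D : ℝ) ≤ 1 / (4 * c₁) * n := Nat.floor_le (by positivity)
  refine card_ne_of_core hq hk hst hbook hstar hdisj (D := D) (fun i => ?_)
    (fun i j hij v hv => Nat.le_floor (hCD i j hij v hv)) ?_ hV
  · have h1 : n - (C i).card ≤ D := by
      refine Nat.le_floor ?_
      rcases le_total n (C i).card with h | h
      · rw [Nat.sub_eq_zero_of_le h, Nat.cast_zero]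
        positivity
      · rw [Nat.cast_sub h]
        have := hCc i
        linarith
    omega
  · have h1 : c₁ * D ≤ n / 4 := by
      calc c₁ * D ≤ c₁ * (1 / (4 * c₁) * n) := by gcongr
        _ = n / 4 := by field_simp
    have h2 : 2 * k * (d : ℝ) ≤ n / 4 := by
      calc 2 * k * (d : ℝ) ≤ 2 * k * (1 / (8 * k) * n) := by
            gcongr
            exact hd.trans (by gcongr; exact min_le_right _ _)
        _ = n / 4 := by
            field_simp
            ring
    have h3 : 4 * c₂ ≤ n := hn₂.le.trans (by exact_mod_cast (by omega : n₂ ≤ n))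
    rw [hc₁] at h1
    rw [hc₂] at h3
    have h4 : (2 * D + (q * D + q * (k * t) + 1) * t + 2 * k * ((t + q * t) * D + t + d) +
        2 * (k * t) + t : ℝ) ≤ n := by
      have : (0 : ℝ) ≤ n := Nat.cast_nonneg n
      linarith
    exact_mod_cast h4

/-- The case of two parts, where the multipartite graph is a star. -/
theorem card_ne_of_star {V : Type*} [Fintype V] [DecidableEq V] {G : SimpleGraph V}
    [DecidableRel G.Adj] {k s n : ℕ} (hk : 1 ≤ k) (hbook : BookFree G k n)
    (hs : ∀ v, (Finset.univ.filter (G.Adj v)).card ≤ s) (hn : 2 * (k * (s + 1)) + s + 1 ≤ n) :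
    Fintype.card V ≠ n - 1 + k * s + 1 := by
  intro hV
  have h := hbook.two_mul_card_add_card_le hk (subset_refl Finset.univ)
    (Finset.disjoint_empty_right _) (fun v _ => hs v) (m := 0) (by simp) (by
      simp only [Finset.sdiff_self, Finset.card_empty, Finset.card_univ]
      omega)
  rw [Finset.card_univ, Finset.card_empty] at h
  omega

theorem ramseyNumber_le_of_forall {V W : Type*} {H₁ : SimpleGraph V} {H₂ : SimpleGraph W} {N : ℕ}
    (h : ∀ G : SimpleGraph (Fin N), ¬ HasCopy G H₁ → ¬ HasCopy Gᶜ H₂ → False) :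
    ramseyNumber H₁ H₂ ≤ N :=
  Nat.sInf_le fun G => by
    by_contra! hcon
    exact h G hcon.1 hcon.2

/-- Theorem 1.5 (upper bound): for all `k, p, t ≥ 2` there are `δ > 0` and `n₀` such that for
all `n ≥ n₀` and positive `a₁ ≤ ⋯ ≤ a_{p-1} ≤ t`, `a_{p-1} ≤ a_p ≤ δn` with `a₁ = 1`,
`r(K_p(a₁,…,a_p), B_{k,n}) ≤ (p-1)(n-1) + k(p-1)(a₂-1) + 1`. -/
theorem ramsey_multipartite_book_upper (k p t : ℕ) (hk : 2 ≤ k) (hp : 2 ≤ p) (ht : 2 ≤ t) :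
    ∃ δ : ℝ, 0 < δ ∧ ∃ n₀ : ℕ, ∀ n : ℕ, n₀ ≤ n →
      ∀ a : Fin p → ℕ, (∀ i, 1 ≤ a i) → Monotone a →
        (∀ i : Fin p, (i : ℕ) < p - 1 → a i ≤ t) →
        ((a ⟨p - 1, by omega⟩ : ℕ) : ℝ) ≤ δ * n →
        a ⟨0, by omega⟩ = 1 →
        ramseyNumber (KMulti a) (Book k n) ≤
          (p - 1) * (n - 1) + k * (p - 1) * (a ⟨1, by omega⟩ - 1) + 1 := by
  classical
  obtain rfl | ⟨r, rfl⟩ : p = 2 ∨ ∃ r, p = r + 3 :=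
    (Nat.eq_or_lt_of_le hp).imp Eq.symm fun h => ⟨p - 3, by omega⟩
  · have hkpos : (0 : ℝ) < k := by exact_mod_cast (by omega : 0 < k)
    refine ⟨1 / (2 * k + 1), by positivity, 1, fun n hn a ha _ _ had ha0 =>
      ramseyNumber_le_of_forall fun G hG hGc => ?_⟩
    obtain ⟨s, hs⟩ : ∃ s, a 1 = s + 1 := ⟨a 1 - 1, by have := ha 1; omega⟩
    have hsn : 2 * (k * (s + 1)) + s + 1 ≤ n := by
      change ((a 1 : ℕ) : ℝ) ≤ _ at had
      rw [hs, one_div, inv_mul_eq_div, le_div_iff₀ (by positivity)] at had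
      have h1 : (s + 1) * (2 * k + 1) ≤ n := by exact_mod_cast had
      linarith
    refine card_ne_of_star (n := n) (s := s) (by omega) (bookFree_of_not_hasCopy hGc)
      (fun v => ?_) hsn ?_
    · by_contra! hlt
      refine hG (hasCopy_KMulti_of_parts ![{v}, Finset.univ.filter (G.Adj v)] (fun i j hij => ?_)
        fun i => ?_)
      · have key : FullyJoined G {v} (Finset.univ.filter (G.Adj v)) := by
          intro x hx y hy
          rw [Finset.mem_singleton.1 hx]
          exact (Finset.mem_filter.1 hy).2
        fin_cases i <;> fin_cases j
        · exact absurd rfl hij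
        · exact key
        · exact key.symm
        · exact absurd rfl hij
      · fin_cases i
        · exact ha0.le
        · exact hs.trans_le hlt
    · change Fintype.card (Fin ((2 - 1) * (n - 1) + k * (2 - 1) * (a 1 - 1) + 1)) = _
      simp [hs]
  · obtain ⟨δ, hδ, n₀, hn₀⟩ := exists_card_ne (r + 2) k t (by omega) (by omega)
    refine ⟨δ, hδ, n₀, fun n hn a ha _ hat had ha0 =>
      ramseyNumber_le_of_forall fun G hG hGc => ?_⟩
    obtain ⟨s, hs⟩ : ∃ s, a 1 = s + 1 := ⟨a 1 - 1, by have := ha 1; omega⟩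
    have hat' : ∀ i : Fin (r + 2), a i.castSucc ≤ t := fun i => hat _ i.isLt
    have hstar := starBlowupFree_of_not_hasCopy hG hat' ha0
    rw [hs] at hstar
    refine hn₀ n hn G s (a (Fin.last (r + 2))) ?_ had (bookFree_of_not_hasCopy hGc)
      (blowupFree_of_not_hasCopy hG hat') hstar ?_
    · rw [← hs]
      exact hat' 1
    · change Fintype.card (Fin ((r + 2) * (n - 1) + k * (r + 2) * (a 1 - 1) + 1)) = _
      rw [hs, Fintype.card_fin, Nat.add_sub_cancel]
      ring
end

section
/- For all integers k, p, t ≥ 2 there exist δ > 0 and n₀ such that for all n ≥ n₀ the following holds: for all positive integers a₁ ≤ a₂ ≤ ⋯ ≤ a_{p−1} ≤ t and a_{p−1} ≤ a_p ≤ δn with a₁ = 1, if moreover a₂ divides n−1−k, then r(K_p(a₁,…,a_p), B_{k,n}) = (p−1)(n−1) + k(p−1)(a₂−1) + 1. -/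
open SimpleGraph

section RamseyBook

open Finset
open scoped Classical

variable {V : Type*} {G : SimpleGraph V}

/-- No two vertices of `S` are adjacent. -/
def Independent (G : SimpleGraph V) (S : Finset V) : Prop :=
  ∀ u ∈ S, ∀ v ∈ S, ¬ G.Adj u v

/-- Vertices in different members of the family `T` are adjacent. -/
def CrossComplete {ι : Type*} (G : SimpleGraph V) (T : ι → Finset V) : Prop :=
  ∀ i j, i ≠ j → ∀ u ∈ T i, ∀ v ∈ T j, G.Adj u v

theorem Independent.mono {S T : Finset V} (h : Independent G T) (hST : S ⊆ T) :
    Independent G S := fun u hu v hv => h u (hST hu) v (hST hv)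

theorem CrossComplete.mono {ι : Type*} {S T : ι → Finset V} (h : CrossComplete G T)
    (hST : ∀ i, S i ⊆ T i) : CrossComplete G S :=
  fun i j hij u hu v hv => h i j hij u (hST i hu) v (hST j hv)

/-- The greedy independent set in a set of bounded degree. -/
theorem exists_independent_of_degree_le (s r : ℕ) (U : Finset V)
    (hdeg : ∀ v ∈ U, #{u ∈ U | G.Adj v u} ≤ r) (hU : s * (r + 1) ≤ #U) :
    ∃ S ⊆ U, #S = s ∧ Independent G S := by
  induction s generalizing U with
  | zero => exact ⟨∅, by simp, by simp, by simp [Independent]⟩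
  | succ s ih =>
    have hne : U.Nonempty := by
      rw [← Finset.card_pos]
      nlinarith
    obtain ⟨v, hv⟩ := hne
    set U' := {u ∈ U | u ≠ v ∧ ¬ G.Adj v u} with hU'
    have hsub : U' ⊆ U := filter_subset _ _
    have hcard : #U ≤ #U' + (r + 1) := by
      have h1 : U ⊆ U' ∪ insert v {u ∈ U | G.Adj v u} := by
        intro u hu
        simp only [hU', mem_union, mem_filter, mem_insert]
        tauto
      calc #U ≤ #(U' ∪ insert v {u ∈ U | G.Adj v u}) := card_le_card h1
        _ ≤ #U' + #(insert v {u ∈ U | G.Adj v u}) := card_union_le _ _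
        _ ≤ #U' + (#{u ∈ U | G.Adj v u} + 1) := by gcongr; exact card_insert_le _ _
        _ ≤ _ := by gcongr; exact hdeg v hv
    obtain ⟨S, hS, hSc, hSi⟩ := ih U'
      (fun w hw => (card_le_card (filter_subset_filter _ hsub)).trans (hdeg w (hsub hw)))
      (by rw [add_mul] at hU; omega)
    have hvS : v ∉ S := fun h => by have := hS h; simp [hU'] at this
    have hvadj : ∀ u ∈ S, ¬ G.Adj v u := fun u hu => by
      have := hS hu
      simp only [hU', mem_filter] at this
      exact this.2.2
    refine ⟨insert v S, insert_subset hv (hS.trans hsub), by rw [card_insert_of_notMem hvS, hSc],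
      ?_⟩
    intro x hx y hy
    rcases mem_insert.1 hx with rfl | hx <;> rcases mem_insert.1 hy with rfl | hy
    · exact G.irrefl
    · exact hvadj y hy
    · rename_i hx'
      exact fun h => hvadj x hx' h.symm
    · exact hSi x hx y hy

/-- A large set contains a large independent set or a clique with many common neighbours. -/
theorem exists_independent_or_clique {s m : ℕ} (hs : 1 ≤ s) (hm : 1 ≤ m) (M : ℕ)
    (U : Finset V) (hU : s ^ M * m ≤ #U) :
    (∃ S ⊆ U, #S = s ∧ Independent G S) ∨
      ∃ C ⊆ U, #C = M ∧ (∀ u ∈ C, ∀ v ∈ C, u ≠ v → G.Adj u v) ∧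
        ∃ Y ⊆ U, m ≤ #Y ∧ ∀ y ∈ Y, ∀ u ∈ C, G.Adj u y := by
  induction M generalizing U with
  | zero => exact Or.inr ⟨∅, by simp, by simp, by simp, U, subset_rfl, by simpa using hU, by simp⟩
  | succ M ih =>
    have hpos : 1 ≤ s ^ M * m := Nat.mul_pos (pow_pos hs M) hm
    by_cases h : ∀ v ∈ U, #{u ∈ U | G.Adj v u} ≤ s ^ M * m - 1
    · refine Or.inl (exists_independent_of_degree_le s _ U h ?_)
      rw [Nat.sub_add_cancel hpos]
      calc s * (s ^ M * m) = s ^ (M + 1) * m := by ring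
        _ ≤ _ := hU
    · push Not at h
      obtain ⟨v, hv, hvd⟩ := h
      have hvd' : s ^ M * m ≤ #{u ∈ U | G.Adj v u} := by omega
      set U' := {u ∈ U | G.Adj v u} with hU'
      have hadj : ∀ u ∈ U', G.Adj v u := fun u hu => (mem_filter.1 hu).2
      have hsub : U' ⊆ U := filter_subset _ _
      rcases ih U' hvd' with ⟨S, h1, h2⟩ | ⟨C, hCU, hC, hcl, Y, hY, hYm, hCY⟩
      · exact Or.inl ⟨S, h1.trans hsub, h2⟩
      have hvC : v ∉ C := fun h => G.irrefl (hadj v (hCU h))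
      refine Or.inr ⟨insert v C, insert_subset hv (hCU.trans hsub),
        by rw [card_insert_of_notMem hvC, hC], ?_, Y, hY.trans hsub, hYm, ?_⟩
      · intro x hx y hy hxy
        rcases mem_insert.1 hx with hx | hx <;> rcases mem_insert.1 hy with hy | hy
        · exact absurd (hx.trans hy.symm) hxy
        · exact hx ▸ hadj y (hCU hy)
        · exact hy ▸ (hadj x (hCU hx)).symm
        · exact hcl x hx y hy hxy
      · intro y hy u hu
        rcases mem_insert.1 hu with rfl | hu
        · exact hadj y (hY hy)
        · exact hCY y hy u hu

/-- Pigeonhole: many vertices of `Z` have the same neighbourhoods in all the `W i`. -/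
theorem exists_common_pattern {j s c : ℕ} (W : Fin j → Finset V) (hW : ∀ i, #(W i) = s)
    (Z : Finset V) (hZ : 2 ^ (s * j) * c ≤ #Z) :
    ∃ P : Fin j → Finset V, ∃ Z' ⊆ Z, c ≤ #Z' ∧ ∀ v ∈ Z', ∀ i, {u ∈ W i | G.Adj u v} = P i := by
  have hcard : #(Fintype.piFinset fun i => (W i).powerset) = 2 ^ (s * j) := by
    simp [Fintype.card_piFinset, hW, pow_mul]
  obtain ⟨P, -, hP⟩ := exists_le_card_fiber_of_mul_le_card_of_maps_to
    (s := Z) (t := Fintype.piFinset fun i => (W i).powerset)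
    (f := fun v i => {u ∈ W i | G.Adj u v}) (n := c)
    (fun v _ => by simp [Fintype.mem_piFinset, filter_subset])
    (by rw [← Finset.card_pos, hcard]; positivity) (by rwa [hcard])
  exact ⟨P, _, filter_subset _ _, hP, fun v hv i => congrFun (mem_filter.1 hv).2 i⟩

theorem card_filter_adj_add (W : Finset V) (v : V) :
    #{u ∈ W | G.Adj u v} + #{u ∈ W | ¬ G.Adj u v} = #W :=
  card_filter_add_card_filter_not _

/-- Greedy embedding of a complete multipartite graph. -/
theorem exists_crossComplete (j r t : ℕ) (b : Fin j → ℕ) (X : Fin j → Finset V)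
    (hb : ∀ i : Fin j, (i : ℕ) + 1 < j → b i ≤ t)
    (hr : ∀ i i', i ≠ i' → ∀ x ∈ X i, #{u ∈ X i' | ¬ G.Adj x u} ≤ r)
    (hX : ∀ i, b i + r * (i * t) ≤ #(X i)) :
    ∃ T : Fin j → Finset V, (∀ i, T i ⊆ X i) ∧ (∀ i, #(T i) = b i) ∧ CrossComplete G T := by
  induction j with
  | zero => exact ⟨X, fun i => i.elim0, fun i => i.elim0, fun i => i.elim0⟩
  | succ j ih =>
    obtain ⟨S, hSX, hSc⟩ := exists_subset_card_eq (le_of_add_le_left (hX 0))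
    set Y : Fin j → Finset V := fun i => {u ∈ X i.succ | ∀ x ∈ S, G.Adj x u} with hY
    have hYX : ∀ i, Y i ⊆ X i.succ := fun i => filter_subset _ _
    have hYc : ∀ i, b i.succ + r * (i * t) ≤ #(Y i) := by
      intro i
      have hsub : X i.succ ⊆ Y i ∪ S.biUnion fun x => {u ∈ X i.succ | ¬ G.Adj x u} := by
        intro u hu
        simp only [hY, mem_union, mem_filter, mem_biUnion]
        by_cases hc : ∀ x ∈ S, G.Adj x u
        · exact Or.inl ⟨hu, hc⟩
        · push Not at hc
          obtain ⟨x, hx, hxu⟩ := hc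
          exact Or.inr ⟨x, hx, hu, hxu⟩
      have h1 : #(X i.succ) ≤ #(Y i) + #S * r :=
        (card_le_card hsub).trans ((card_union_le _ _).trans (by
          gcongr
          exact card_biUnion_le_card_mul _ _ _ fun x hx =>
            hr 0 i.succ (Fin.succ_ne_zero i).symm x (hSX hx)))
      have h2 := hX i.succ
      have h3 : b 0 ≤ t := hb 0 (by have := i.2; simp; omega)
      have h4 : #S * r ≤ t * r := Nat.mul_le_mul_right _ (hSc ▸ h3)
      rw [Fin.val_succ] at h2
      nlinarith
    obtain ⟨T, hTY, hTc, hT⟩ := ih (fun i => b i.succ) Y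
      (fun i hi => hb i.succ (by simpa using hi))
      (fun i i' hii x hx => (card_le_card (filter_subset_filter _ (hYX i'))).trans
        (hr i.succ i'.succ (fun h => hii (Fin.succ_injective _ h)) x (hYX i hx))) hYc
    have hTS : ∀ i, ∀ u ∈ T i, ∀ x ∈ S, G.Adj x u := fun i u hu => (mem_filter.1 (hTY i hu)).2
    refine ⟨Fin.cons S T, Fin.cases hSX fun i => (hTY i).trans (hYX i), Fin.cases hSc hTc, ?_⟩
    intro i₁ i₂
    refine Fin.cases ?_ (fun i₁ => ?_) i₁ <;> refine Fin.cases ?_ (fun i₂ => ?_) i₂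
    · exact fun h => absurd rfl h
    · exact fun _ u hu v hv => hTS i₂ v hv u hu
    · exact fun _ u hu v hv => (hTS i₁ u hu v hv).symm
    · exact fun hi => hT i₁ i₂ fun h => hi (congrArg _ h)

variable [Fintype V]

/-- The vertices with no neighbour in `S`. -/
noncomputable def nonNeighbours (G : SimpleGraph V) (S : Finset V) : Finset V :=
  {v | ∀ u ∈ S, ¬ G.Adj u v}

theorem mem_nonNeighbours {S : Finset V} {v : V} :
    v ∈ nonNeighbours G S ↔ ∀ u ∈ S, ¬ G.Adj u v := by
  simp [nonNeighbours]

/-- The hypotheses shared by the approximate steps: `G` has about `q * n` vertices, contains no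
`K_{q+1}(t, …, t, m)`, and its complement contains no book `B_{k,n}`. -/
structure BookContext (G : SimpleGraph V) (k q t n m : ℕ) : Prop where
  q_pos : 1 ≤ q
  m_pos : 1 ≤ m
  card_ge : q * n ≤ Fintype.card V + q
  card_le : Fintype.card V ≤ 2 * q * n
  multipartite : ∀ T : Fin q → Finset V, (∀ i, #(T i) = t) → CrossComplete G T →
    ∀ Y : Finset V, (∀ y ∈ Y, ∀ i, ∀ u ∈ T i, G.Adj u y) → #Y < m
  book : ∀ S : Finset V, #S = k → Independent G S → #(nonNeighbours G S) < n

/-- `q` pairwise completely joined independent sets of size `s`. -/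
structure IsBlowup {j : ℕ} (G : SimpleGraph V) (s : ℕ) (W : Fin j → Finset V) : Prop where
  card_eq : ∀ i, #(W i) = s
  independent : ∀ i, Independent G (W i)
  cross : CrossComplete G W

variable {k q t n m : ℕ}

theorem BookContext.exists_independent (h : BookContext G k q t n m) {s : ℕ} (hs : 1 ≤ s)
    (U : Finset V) (hU : s ^ (q * t) * m ≤ #U) : ∃ S ⊆ U, #S = s ∧ Independent G S := by
  refine (exists_independent_or_clique hs h.m_pos _ U hU).resolve_right ?_
  rintro ⟨C, -, hC, hcl, Y, -, hYm, hCY⟩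
  obtain ⟨f, hf, hfC⟩ : ∃ f : Fin q × Fin t → V, Function.Injective f ∧ ∀ x, f x ∈ C := by
    have e : Fin q × Fin t ≃ C := Fintype.equivOfCardEq (by simp [hC])
    exact ⟨fun x => e x, Subtype.val_injective.comp e.injective, fun x => (e x).2⟩
  have := h.multipartite (fun i => univ.image fun x => f (i, x))
    (fun i => by
      rw [card_image_of_injective _ fun x y hxy => (Prod.ext_iff.1 (hf hxy)).2]
      simp)
    (fun i j hij u hu v hv => by
      simp only [mem_image, mem_univ, true_and] at hu hv
      obtain ⟨x, rfl⟩ := hu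
      obtain ⟨y, rfl⟩ := hv
      exact hcl _ (hfC _) _ (hfC _) fun he => hij (Prod.ext_iff.1 (hf he)).1)
    Y (fun y hy i u hu => by
      simp only [mem_image, mem_univ, true_and] at hu
      obtain ⟨x, rfl⟩ := hu
      exact hCY y hy _ (hfC _))
  omega

/-- Double counting the `k`-subsets of an independent set. -/
theorem BookContext.sum_pow_le (h : BookContext G k q t n m) {s : ℕ} {W : Finset V}
    (hW : #W = s) (hWi : Independent G W) :
    ∑ v : V, (s + 1 - k - #{u ∈ W | G.Adj u v}) ^ k ≤ n * s ^ k := by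
  have key : ∑ v : V, (#{u ∈ W | ¬ G.Adj u v}).choose k ≤ s.choose k * n := by
    calc ∑ v : V, (#{u ∈ W | ¬ G.Adj u v}).choose k
        = ∑ v : V, ∑ S ∈ powersetCard k W, if v ∈ nonNeighbours G S then 1 else 0 := by
          refine sum_congr rfl fun v _ => ?_
          rw [← card_powersetCard, ← card_filter]
          congr 1
          ext S
          simp only [mem_powersetCard, mem_filter, mem_nonNeighbours, subset_iff]
          exact ⟨fun ⟨h1, h2⟩ => ⟨⟨fun x hx => (h1 hx).1, h2⟩, fun x hx => (h1 hx).2⟩,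
            fun ⟨⟨h1, h2⟩, h3⟩ => ⟨fun x hx => ⟨h1 hx, h3 x hx⟩, h2⟩⟩
      _ = ∑ S ∈ powersetCard k W, #(nonNeighbours G S) := by
          rw [sum_comm]
          refine sum_congr rfl fun S _ => ?_
          rw [← card_filter]
          simp
      _ ≤ ∑ S ∈ powersetCard k W, n := by
          refine sum_le_sum fun S hS => ?_
          rw [mem_powersetCard] at hS
          exact (h.book S hS.2 (hWi.mono hS.1)).le
      _ = s.choose k * n := by simp [hW]
  calc ∑ v : V, (s + 1 - k - #{u ∈ W | G.Adj u v}) ^ k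
      ≤ ∑ v : V, k.factorial * (#{u ∈ W | ¬ G.Adj u v}).choose k := by
        refine sum_le_sum fun v _ => ?_
        rw [← Nat.descFactorial_eq_factorial_mul_choose]
        refine le_trans ?_ (Nat.pow_sub_le_descFactorial _ _)
        have := card_filter_add_card_filter_not (s := W) (fun u => G.Adj u v)
        exact Nat.pow_le_pow_left (by omega) k
    _ ≤ k.factorial * (s.choose k * n) := by
        rw [← mul_sum]
        gcongr
    _ = n * s.descFactorial k := by rw [Nat.descFactorial_eq_factorial_mul_choose]; ring
    _ ≤ n * s ^ k := by gcongr; exact Nat.descFactorial_le_pow _ _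

theorem BookContext.card_rich_le (h : BookContext G k q t n m) {s : ℕ} {W : Fin q → Finset V}
    (hW : IsBlowup G s W) :
    #{v : V | ∀ i, t ≤ #{u ∈ W i | G.Adj u v}} ≤ 2 ^ (s * q) * m := by
  by_contra! hlt
  obtain ⟨P, Z, hZ, hZm, hP⟩ := exists_common_pattern (G := G) W hW.card_eq _ hlt.le
  obtain ⟨z, hz⟩ := card_pos.1 (h.m_pos.trans hZm)
  have hPt : ∀ i, t ≤ #(P i) := fun i => by
    rw [← hP z hz i]
    exact (mem_filter.1 (hZ hz)).2 i
  choose T hTP hTt using fun i => exists_subset_card_eq (hPt i)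
  have := h.multipartite T hTt
    (hW.cross.mono fun i => (hTP i).trans ((hP z hz i) ▸ filter_subset _ _)) Z
    (fun y hy i u hu => by
      have := hTP i hu
      rw [← hP y hy i] at this
      exact (mem_filter.1 this).2)
  omega

theorem pow_mul_one_sub_le {k c s : ℕ} (hs : 0 < s) (hc : c ≤ s) :
    (s : ℝ) ^ k * (1 - k * c / s) ≤ ((s - c : ℕ) : ℝ) ^ k := by
  have hs' : (0 : ℝ) < s := by exact_mod_cast hs
  have hc' : (c : ℝ) / s ≤ 1 := by rw [div_le_one hs']; exact_mod_cast hc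
  have h := one_add_mul_le_pow (a := -((c : ℝ) / s)) (by linarith) k
  calc (s : ℝ) ^ k * (1 - k * c / s) = s ^ k * (1 + k * -((c : ℝ) / s)) := by ring
    _ ≤ s ^ k * (1 + -((c : ℝ) / s)) ^ k := by gcongr
    _ = (s - c : ℕ) ^ k := by
      rw [← mul_pow, Nat.cast_sub hc]
      congr 1
      field_simp
      ring

theorem exists_scale (k q s' : ℕ) :
    ∃ s, 1 ≤ s ∧ 2 * q * s ^ k ≤ (2 * q + 1) * (s + 1 - k - s') ^ k := by
  set c := k + s' with hc
  set s := c * (k + 1) * (2 * q + 1) + 1 with hs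
  have hcs : c ≤ s := by
    have : c * 1 ≤ c * ((k + 1) * (2 * q + 1)) := Nat.mul_le_mul_left _ (by nlinarith)
    rw [hs, mul_assoc]
    omega
  refine ⟨s, by omega, ?_⟩
  have hb := pow_mul_one_sub_le (k := k) (by omega : 0 < s) hcs
  have hpos : (0 : ℝ) < s := by positivity
  have hfrac : (k * c / s : ℝ) ≤ 1 / (2 * q + 1) := by
    rw [div_le_div_iff₀ hpos (by positivity)]
    have : k * c * (2 * q + 1) ≤ 1 * s := by rw [hs]; nlinarith
    exact_mod_cast this
  have h1 : (s : ℝ) ^ k * (1 - 1 / (2 * q + 1)) ≤ ((s - c : ℕ) : ℝ) ^ k :=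
    le_trans (by gcongr) hb
  have h2 : (2 * q * s ^ k : ℝ) ≤ (2 * q + 1) * ((s - c : ℕ) : ℝ) ^ k := by
    calc (2 * q * s ^ k : ℝ) = (2 * q + 1) * (s ^ k * (1 - 1 / (2 * q + 1))) := by
          field_simp
          ring
      _ ≤ _ := by gcongr
  have h3 : 2 * q * s ^ k ≤ (2 * q + 1) * (s - c) ^ k := by exact_mod_cast h2
  exact h3.trans (Nat.mul_le_mul_left _ (Nat.pow_le_pow_left (by omega) k))

theorem BookContext.card_sparse_le (h : BookContext G k q t n m) {s s' : ℕ} {W : Finset V}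
    (hs : 1 ≤ s) (hss : 2 * q * s ^ k ≤ (2 * q + 1) * (s + 1 - k - s') ^ k)
    (hW : #W = s) (hWi : Independent G W) :
    2 * q * #{v : V | #{u ∈ W | G.Adj u v} < s'} ≤ (2 * q + 1) * n := by
  set F : Finset V := {v | #{u ∈ W | G.Adj u v} < s'} with hF
  have h1 : #F * (s + 1 - k - s') ^ k ≤ n * s ^ k := by
    refine le_trans ?_ (h.sum_pow_le hW hWi)
    rw [← smul_eq_mul, ← sum_const]
    refine le_trans (sum_le_sum fun v hv => ?_)
      (sum_le_sum_of_subset (f := fun v => (s + 1 - k - #{u ∈ W | G.Adj u v}) ^ k)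
        (subset_univ F))
    have : #{u ∈ W | G.Adj u v} < s' := by simpa [hF] using hv
    exact Nat.pow_le_pow_left (by omega) k
  have hpos : 0 < s ^ k := by positivity
  refine Nat.le_of_mul_le_mul_right ?_ hpos
  calc 2 * q * #F * s ^ k = #F * (2 * q * s ^ k) := by ring
    _ ≤ #F * ((2 * q + 1) * (s + 1 - k - s') ^ k) := by gcongr
    _ = (2 * q + 1) * (#F * (s + 1 - k - s') ^ k) := by ring
    _ ≤ (2 * q + 1) * (n * s ^ k) := by gcongr
    _ = _ := by ring

/-- Existence of blow-ups of `K_j` with independent parts, for `j ≤ q`. -/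
theorem exists_isBlowup (k q t : ℕ) (j : ℕ) (hj : j ≤ q) (s' : ℕ) (hs' : 1 ≤ s') :
    ∃ D : ℕ, ∀ (V : Type) [Fintype V] (G : SimpleGraph V) (n m : ℕ),
      BookContext G k q t n m → D * m ≤ n → ∃ W : Fin j → Finset V, IsBlowup G s' W := by
  induction j generalizing s' with
  | zero =>
    exact ⟨0, fun V _ G n m _ _ => ⟨fun i => i.elim0, fun i => i.elim0, fun i => i.elim0,
      fun i => i.elim0⟩⟩
  | succ j ih =>
    obtain ⟨s, hs, hss⟩ := exists_scale k q s'
    obtain ⟨D, hD⟩ := ih (by omega) s hs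
    refine ⟨D + 2 * q ^ 2 + 2 * (2 ^ (s * j) * s' ^ (q * t)), fun V _ G n m h hn => ?_⟩
    have hm := h.m_pos
    have hn1 : D * m ≤ n := le_trans (by nlinarith [Nat.zero_le (2 ^ (s * j) * s' ^ (q * t) * m)]) hn
    have hn2 : 2 * q ^ 2 ≤ n :=
      le_trans (by nlinarith [Nat.zero_le (2 ^ (s * j) * s' ^ (q * t) * m), Nat.zero_le (D * m)]) hn
    have hn3 : 2 * (2 ^ (s * j) * (s' ^ (q * t) * m)) ≤ n :=
      le_trans (by nlinarith [Nat.zero_le (D * m)]) hn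
    obtain ⟨W, hW⟩ := hD V G n m h hn1
    set Z : Finset V := {v | ∀ i, s' ≤ #{u ∈ W i | G.Adj u v}} with hZ
    have hcompl : #(univ \ Z) * (2 * q) ≤ j * ((2 * q + 1) * n) := by
      have hsub : univ \ Z ⊆ univ.biUnion fun i => {v : V | #{u ∈ W i | G.Adj u v} < s'} := by
        intro v hv
        simpa [hZ] using hv
      calc #(univ \ Z) * (2 * q)
          ≤ (∑ i, #{v : V | #{u ∈ W i | G.Adj u v} < s'}) * (2 * q) := by
            gcongr
            exact (card_le_card hsub).trans card_biUnion_le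
        _ = ∑ i, 2 * q * #{v : V | #{u ∈ W i | G.Adj u v} < s'} := by
            rw [sum_mul]
            exact sum_congr rfl fun _ _ => mul_comm _ _
        _ ≤ ∑ _i : Fin j, (2 * q + 1) * n :=
            sum_le_sum fun i _ => h.card_sparse_le hs hss (hW.card_eq i) (hW.independent i)
        _ = _ := by simp
    have hZn : n ≤ 2 * #Z := by
      have h1 : #(univ \ Z) + #Z = Fintype.card V := by
        rw [card_sdiff_add_card_eq_card (subset_univ _), card_univ]
      have h2 := h.card_ge
      have h3 := h.q_pos
      have h4 : j * ((2 * q + 1) * n) + (2 * q + 1) * n ≤ q * ((2 * q + 1) * n) := by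
        calc j * ((2 * q + 1) * n) + (2 * q + 1) * n = (j + 1) * ((2 * q + 1) * n) := by ring
          _ ≤ _ := Nat.mul_le_mul_right _ hj
      have h5 : q * n ≤ q * (2 * #Z) := by nlinarith
      exact Nat.le_of_mul_le_mul_left h5 h3
    obtain ⟨P, Z', hZ', hZm, hP⟩ := exists_common_pattern (G := G) W hW.card_eq Z
      (c := s' ^ (q * t) * m) (by omega)
    obtain ⟨S, hSZ, hSc, hSi⟩ := h.exists_independent hs' Z' hZm
    obtain ⟨z, hz⟩ := card_pos.1 (lt_of_lt_of_le (Nat.mul_pos (pow_pos hs' _) hm) hZm)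
    have hPs : ∀ i, s' ≤ #(P i) := fun i => by
      rw [← hP z hz i]
      exact (mem_filter.1 (hZ' hz)).2 i
    choose T hTP hTc using fun i => exists_subset_card_eq (hPs i)
    have hTW : ∀ i, T i ⊆ W i := fun i => (hTP i).trans (hP z hz i ▸ filter_subset _ _)
    have hTS : ∀ i, ∀ u ∈ T i, ∀ v ∈ S, G.Adj u v := fun i u hu v hv => by
      have := hTP i hu
      rw [← hP v (hSZ hv) i] at this
      exact (mem_filter.1 this).2
    refine ⟨Fin.cons S T, ?_, ?_, ?_⟩
    · exact Fin.cases hSc hTc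
    · exact Fin.cases hSi fun i => (hW.independent i).mono (hTW i)
    · intro i₁ i₂
      refine Fin.cases ?_ (fun i₁ => ?_) i₁ <;> refine Fin.cases ?_ (fun i₂ => ?_) i₂
      · exact fun h => absurd rfl h
      · exact fun _ u hu v hv => (hTS i₂ v hv u hu).symm
      · exact fun _ u hu v hv => hTS i₁ u hu v hv
      · exact fun hi u hu v hv => hW.cross i₁ i₂ (fun h => hi (congrArg _ h)) u (hTW i₁ hu) v
          (hTW i₂ hv)

/-- `v` behaves like a vertex of the `i`-th part with respect to the blow-up `W`. -/
def IsTypical (G : SimpleGraph V) (t e s : ℕ) (W : Fin q → Finset V) (i : Fin q) (v : V) : Prop :=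
  #{u ∈ W i | G.Adj u v} < t ∧ ∀ j, j ≠ i → e * #{u ∈ W j | ¬ G.Adj u v} ≤ s

theorem exists_card_atypical_le (k q t e : ℕ) (he : 1 ≤ e) :
    ∃ s₀ : ℕ, ∀ s, s₀ ≤ s → ∃ D : ℕ, ∀ (V : Type) [Fintype V] (G : SimpleGraph V) (n m : ℕ),
      BookContext G k q t n m → D * m ≤ n → ∀ W : Fin q → Finset V, IsBlowup G s W →
        e * #{v : V | ¬ ∃ i, IsTypical G t e s W i v} ≤ n := by
  refine ⟨2 * e * k + (k + t + 1) + 2 * e * q * k * (k + t) * (2 * e) ^ k, fun s hs =>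
    ⟨2 * e * (2 * e) ^ k * (q + 2 * 2 ^ (s * q)), fun V _ G n m h hn W hW => ?_⟩⟩
  have hs1 : 2 * e * k ≤ s := by omega
  have hs2 : k + t + 1 ≤ s := by omega
  have hs3 : 2 * e * q * k * (k + t) * (2 * e) ^ k ≤ s := by omega
  set R : Finset V := {v | ∀ i, t ≤ #{u ∈ W i | G.Adj u v}} with hR
  set A : Finset V := {v | ¬ ∃ i, IsTypical G t e s W i v} with hA
  have hRm : #R ≤ 2 ^ (s * q) * m := h.card_rich_le hW
  have hspos : (0 : ℝ) < s := by exact_mod_cast (by omega : 0 < s)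
  have hepos : (0 : ℝ) < e := by exact_mod_cast he
  set κ : ℝ := (1 / (2 * e)) ^ k with hκ
  have hκpos : 0 < κ := by positivity
  have hκ1 : κ ≤ 1 := by
    refine pow_le_one₀ (by positivity) ?_
    rw [div_le_one (by positivity)]
    have : (1 : ℝ) ≤ e := by exact_mod_cast he
    linarith
  set θ : ℝ := k * (k + t : ℕ) / s with hθ
  have hθ0 : 0 ≤ θ := by positivity
  have hκinv : κ * (2 * e) ^ k = 1 := by
    rw [hκ, ← mul_pow]
    rw [one_div, inv_mul_cancel₀ (by positivity), one_pow]
  have hθq : 2 * e * (θ * q) ≤ κ := by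
    have h3 : (2 * e * q * k * ((k + t : ℕ) : ℝ) * (2 * e) ^ k) ≤ s := by exact_mod_cast hs3
    have : 2 * e * (θ * q) = (2 * e * q * k * ((k + t : ℕ) : ℝ) * (2 * e) ^ k) * κ / s := by
      rw [mul_assoc _ _ κ, mul_comm _ κ, hκinv, hθ]
      ring
    rw [this, div_le_iff₀ hspos, mul_comm κ]
    gcongr
  have hpoint : ∀ v : V, (s : ℝ) ^ k * ((1 - θ) * (1 - (if v ∈ R then 1 else 0)) +
      κ * ((if v ∈ A then 1 else 0) - (if v ∈ R then 1 else 0))) ≤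
      ∑ i, (((s + 1 - k - #{u ∈ W i | G.Adj u v}) ^ k : ℕ) : ℝ) := by
    intro v
    by_cases hvR : v ∈ R
    · rw [if_pos hvR]
      refine le_trans ?_ (sum_nonneg fun i _ => by positivity)
      have : (if v ∈ A then (1 : ℝ) else 0) ≤ 1 := by split_ifs <;> norm_num
      have hp : (0 : ℝ) < s ^ k := by positivity
      have : κ * ((if v ∈ A then (1 : ℝ) else 0) - 1) ≤ 0 :=
        mul_nonpos_of_nonneg_of_nonpos hκpos.le (by linarith)
      nlinarith
    · rw [if_neg hvR]
      obtain ⟨i, hi⟩ : ∃ i, #{u ∈ W i | G.Adj u v} < t := by simpa [hR] using hvR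
      have hfi : (s : ℝ) ^ k * (1 - θ) ≤
          (((s + 1 - k - #{u ∈ W i | G.Adj u v}) ^ k : ℕ) : ℝ) := by
        refine (pow_mul_one_sub_le (by omega) (by omega : k + t ≤ s)).trans ?_
        exact_mod_cast Nat.pow_le_pow_left (by omega) k
      by_cases hvA : v ∈ A
      · rw [if_pos hvA]
        have hnt : ¬ IsTypical G t e s W i v := fun hc => by
          simp only [hA, mem_filter, mem_univ, true_and] at hvA
          exact hvA ⟨i, hc⟩
        obtain ⟨j, hji, hj⟩ : ∃ j, j ≠ i ∧ s < e * #{u ∈ W j | ¬ G.Adj u v} := by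
          by_contra! hcon
          exact hnt ⟨hi, hcon⟩
        have hfj : (s : ℝ) ^ k * κ ≤
            (((s + 1 - k - #{u ∈ W j | G.Adj u v}) ^ k : ℕ) : ℝ) := by
          have h1 := card_filter_add_card_filter_not (s := W j) (fun u => G.Adj u v)
          rw [hW.card_eq j] at h1
          have h2 : s ≤ 2 * e * (s + 1 - k - #{u ∈ W j | G.Adj u v}) := by
            have h3 : #{u ∈ W j | ¬ G.Adj u v} ≤ (s + 1 - k - #{u ∈ W j | G.Adj u v}) + k := by
              omega
            have h4 := Nat.mul_le_mul_left (2 * e) h3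
            nlinarith
          have h5 : (s : ℝ) * (1 / (2 * e)) ≤ ((s + 1 - k - #{u ∈ W j | G.Adj u v} : ℕ) : ℝ) := by
            rw [mul_one_div, div_le_iff₀ (by positivity)]
            have : (s : ℝ) ≤ 2 * e * ((s + 1 - k - #{u ∈ W j | G.Adj u v} : ℕ) : ℝ) := by
              exact_mod_cast h2
            linarith
          rw [hκ, ← mul_pow]
          push_cast
          gcongr
        have hpair := sum_le_sum_of_subset_of_nonneg (s := {i, j}) (t := univ)
          (f := fun i => (((s + 1 - k - #{u ∈ W i | G.Adj u v}) ^ k : ℕ) : ℝ))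
          (subset_univ _) (fun _ _ _ => by positivity)
        rw [sum_pair hji.symm] at hpair
        refine le_trans ?_ hpair
        linarith
      · rw [if_neg hvA]
        refine le_trans ?_ (single_le_sum
          (f := fun i => (((s + 1 - k - #{u ∈ W i | G.Adj u v}) ^ k : ℕ) : ℝ))
          (fun _ _ => by positivity) (mem_univ i))
        simpa using hfi
  have hsum := sum_le_sum fun v (_ : v ∈ (univ : Finset V)) => hpoint v
  have hup : ∑ v : V, ∑ i, (((s + 1 - k - #{u ∈ W i | G.Adj u v}) ^ k : ℕ) : ℝ) ≤
      q * (n * (s : ℝ) ^ k) := by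
    rw [sum_comm]
    calc _ ≤ ∑ _i : Fin q, (n * (s : ℝ) ^ k) := by
          refine sum_le_sum fun i _ => ?_
          exact_mod_cast h.sum_pow_le (hW.card_eq i) (hW.independent i)
      _ = _ := by simp
  rw [← mul_sum, sum_add_distrib, ← mul_sum, ← mul_sum, sum_sub_distrib, sum_sub_distrib] at hsum
  simp only [sum_ite_mem, univ_inter, sum_const, card_univ, nsmul_eq_mul, mul_one] at hsum
  have hmain : (1 - θ) * (Fintype.card V - #R) + κ * (#A - #R) ≤ (q * n : ℝ) := by
    have hp : (0 : ℝ) < s ^ k := by positivity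
    refine le_of_mul_le_mul_left ?_ hp
    linarith [hsum.trans hup]
  have hV : (q * n : ℝ) ≤ Fintype.card V + q := by exact_mod_cast h.card_ge
  have hθ1 : θ ≤ 1 := by
    have hq : (1 : ℝ) ≤ q := by exact_mod_cast h.q_pos
    have he1 : (1 : ℝ) ≤ e := by exact_mod_cast he
    have : θ ≤ θ * q := by nlinarith
    have : θ * q ≤ e * (θ * q) := by nlinarith [mul_nonneg hθ0 (by linarith : (0:ℝ) ≤ q)]
    nlinarith
  have hκA : κ * #A ≤ θ * q * n + (q + 2 * #R) := by
    have h1 : (1 - θ) * (q * n - q) ≤ (1 - θ) * Fintype.card V :=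
      mul_le_mul_of_nonneg_left (by linarith) (by linarith)
    have h2 : κ * #R ≤ #R := mul_le_of_le_one_left (by positivity) hκ1
    have h3 : 0 ≤ θ * q := by positivity
    have h4 : 0 ≤ θ * #R := by positivity
    nlinarith
  have hqR : 2 * e * (q + 2 * #R : ℝ) ≤ κ * n := by
    have h1 : 2 * e * (2 * e) ^ k * (q + 2 * #R) ≤ n := by
      refine le_trans ?_ hn
      rw [mul_assoc (2 * e * (2 * e) ^ k)]
      refine Nat.mul_le_mul_left _ ?_
      nlinarith [h.m_pos]
    have h2 : (2 * e * (2 * e) ^ k * (q + 2 * #R) : ℝ) ≤ n := by exact_mod_cast h1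
    have h3 := mul_le_mul_of_nonneg_left h2 hκpos.le
    calc 2 * e * (q + 2 * #R : ℝ) = (κ * (2 * e) ^ k) * (2 * e * (q + 2 * #R)) := by
          rw [hκinv, one_mul]
      _ = κ * (2 * e * (2 * e) ^ k * (q + 2 * #R)) := by ring
      _ ≤ _ := h3
  have hfin : κ * (e * #A) ≤ κ * n := by
    have h1 : e * (κ * #A) ≤ e * (θ * q * n + (q + 2 * #R)) := by gcongr
    have h2 : 2 * e * (θ * q) * n ≤ κ * n := by gcongr
    nlinarith
  exact_mod_cast le_of_mul_le_mul_left hfin hκpos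

/-- The vertices whose adjacency to `v` differs from that of a complete multipartite graph with
parts `A`, if `v` is regarded as a vertex of the `i`-th part. -/
noncomputable def misplaced (G : SimpleGraph V) (A : Fin q → Finset V) (i : Fin q) (v : V) :
    Finset V :=
  {u | ∃ j, u ∈ A j ∧ (j = i ↔ G.Adj v u)}

/-- A set of misplaced vertices is small, as otherwise it contains a large independent set that
can replace one part of the blow-up. -/
theorem BookContext.card_misplaced_le (h : BookContext G k q t n m) {e e₁ s : ℕ}
    (he : e₁ = 2 * (2 * q + 1) * e) (he0 : 1 ≤ e) (hs : t * e₁ + 1 ≤ s)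
    {W : Fin q → Finset V} (hW : IsBlowup G (2 * s) W)
    (hatyp : ∀ W' : Fin q → Finset V, IsBlowup G s W' →
      e₁ * #{v : V | ¬ ∃ i, IsTypical G t e₁ s W' i v} ≤ n)
    (hm : 2 * q * e * (2 ^ (2 * s * q) * (s ^ (q * t) * m)) ≤ n) (i : Fin q) :
    2 * q * e * #{v : V | IsTypical G t e₁ (2 * s) W i v ∧
      n < e * #(misplaced G (fun j => {v | IsTypical G t e₁ (2 * s) W j v}) i v)} ≤ n := by
  set A : Fin q → Finset V := fun j => {v | IsTypical G t e₁ (2 * s) W j v} with hA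
  set Z : Finset V := {v : V | IsTypical G t e₁ (2 * s) W i v ∧ n < e * #(misplaced G A i v)}
    with hZ
  by_contra! hlt
  have he₁ : 6 ≤ e₁ := by have := h.q_pos; rw [he]; nlinarith
  have hts : 6 * t + 1 ≤ s := le_trans (by nlinarith) hs
  obtain ⟨P, Z', hZ', hZm, hP⟩ := exists_common_pattern (G := G) W hW.card_eq Z
    (c := s ^ (q * t) * m) (Nat.lt_of_mul_lt_mul_left (hm.trans_lt hlt)).le
  obtain ⟨S, hSZ, hSc, hSi⟩ := h.exists_independent (by omega) Z' hZm
  obtain ⟨z, hz⟩ := card_pos.1 (lt_of_lt_of_le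
    (Nat.mul_pos (pow_pos (by omega : 0 < s) _) h.m_pos) hZm)
  have hPs : ∀ j, j ≠ i → s ≤ #(P j) := fun j hj => by
    have h1 := ((mem_filter.1 (hZ' hz)).2.1.2 j hj)
    have h2 := card_filter_adj_add (G := G) (W j) z
    rw [hP z hz j, hW.card_eq] at h2
    nlinarith
  have hex : ∀ j, ∃ T ⊆ W j, #T = s ∧ (j ≠ i → T ⊆ P j) := fun j => by
    by_cases hj : j = i
    · obtain ⟨T, hT, hTc⟩ := exists_subset_card_eq
        (show s ≤ #(W j) by rw [hW.card_eq]; omega)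
      exact ⟨T, hT, hTc, fun h => absurd hj h⟩
    · obtain ⟨T, hT, hTc⟩ := exists_subset_card_eq (hPs j hj)
      exact ⟨T, hT.trans (hP z hz j ▸ filter_subset _ _), hTc, fun _ => hT⟩
  choose T hTW hTc hTP using hex
  have hTS : ∀ j, j ≠ i → ∀ u ∈ T j, ∀ v ∈ S, G.Adj u v := fun j hj u hu v hv => by
    have := hTP j hj hu
    rw [← hP v (hSZ hv) j] at this
    exact (mem_filter.1 this).2
  set W' := Function.update T i S with hW'
  have hWi : W' i = S := Function.update_self ..
  have hWj : ∀ j, j ≠ i → W' j = T j := fun j hj => Function.update_of_ne hj ..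
  have hblow : IsBlowup G s W' := by
    refine ⟨fun j => ?_, fun j => ?_, fun j₁ j₂ hj => ?_⟩
    · by_cases hj : j = i
      · rw [hj, hWi, hSc]
      · rw [hWj j hj, hTc]
    · by_cases hj : j = i
      · rw [hj, hWi]; exact hSi
      · rw [hWj j hj]; exact (hW.independent j).mono (hTW j)
    · by_cases h1 : j₁ = i
      · have h2 : j₂ ≠ i := fun h2 => hj (h1.trans h2.symm)
        rw [h1, hWi, hWj j₂ h2]
        exact fun u hu v hv => (hTS j₂ h2 v hv u hu).symm
      · rw [hWj j₁ h1]
        by_cases h2 : j₂ = i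
        · rw [h2, hWi]
          exact hTS j₁ h1
        · rw [hWj j₂ h2]
          exact fun u hu v hv => hW.cross j₁ j₂ hj u (hTW j₁ hu) v (hTW j₂ hv)
  have hsame : ∀ v j i', IsTypical G t e₁ (2 * s) W j v → IsTypical G t e₁ s W' i' v →
      i' = j := by
    intro v j i' hj hi'
    by_contra hne
    by_cases hji : j = i
    · have h1 := hi'.1
      rw [hWj i' (fun h => hne (h.trans hji.symm))] at h1
      have h2 := hj.2 i' hne
      have h3 := card_filter_adj_add (G := G) (T i') v
      rw [hTc] at h3
      have h4 : #{u ∈ T i' | ¬ G.Adj u v} ≤ #{u ∈ W i' | ¬ G.Adj u v} :=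
        card_le_card (filter_subset_filter _ (hTW i'))
      nlinarith
    · have h1 := hi'.2 j (Ne.symm hne)
      rw [hWj j hji] at h1
      have h2 := hj.1
      have h3 := card_filter_adj_add (G := G) (T j) v
      rw [hTc] at h3
      have h4 : #{u ∈ T j | G.Adj u v} ≤ #{u ∈ W j | G.Adj u v} :=
        card_le_card (filter_subset_filter _ (hTW j))
      nlinarith
  set B : Finset V := {v | ¬ ∃ i, IsTypical G t e₁ s W' i v} with hB
  have hpoint : ∀ u : V, e₁ * #{w ∈ S | u ∈ misplaced G A i w} ≤
      s + e₁ * s * (if u ∈ B then 1 else 0) := by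
    intro u
    by_cases hu : u ∈ B
    · rw [if_pos hu]
      have : #{w ∈ S | u ∈ misplaced G A i w} ≤ s := hSc ▸ card_filter_le _ _
      nlinarith [Nat.mul_le_mul_left e₁ this]
    · rw [if_neg hu]
      obtain ⟨i', hi'⟩ : ∃ i, IsTypical G t e₁ s W' i u := by simpa [hB] using hu
      by_cases hi : i' = i
      · have h1 : #{w ∈ S | u ∈ misplaced G A i w} ≤ #{w ∈ W' i' | G.Adj w u} := by
          rw [hi, hWi]
          refine card_le_card fun w hw => ?_
          simp only [misplaced, mem_filter, mem_univ, true_and, hA] at hw ⊢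
          obtain ⟨hwS, j, hj, hiff⟩ := hw
          exact ⟨hwS, hiff.1 ((hsame u j i' hj hi').symm.trans hi)⟩
        have h2 := hi'.1
        have h3 := Nat.mul_le_mul_left e₁ (h1.trans h2.le)
        nlinarith
      · have h1 : #{w ∈ S | u ∈ misplaced G A i w} ≤ #{w ∈ W' i | ¬ G.Adj w u} := by
          rw [hWi]
          refine card_le_card fun w hw => ?_
          simp only [misplaced, mem_filter, mem_univ, true_and, hA] at hw ⊢
          obtain ⟨hwS, j, hj, hiff⟩ := hw
          exact ⟨hwS, fun hadj => hi ((hsame u j i' hj hi').trans (hiff.2 hadj))⟩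
        have h2 := hi'.2 i (Ne.symm hi)
        have h3 := Nat.mul_le_mul_left e₁ h1
        omega
  have hcount : ∑ w ∈ S, #(misplaced G A i w) = ∑ u : V, #{w ∈ S | u ∈ misplaced G A i w} := by
    simp_rw [card_filter]
    rw [sum_comm]
    refine sum_congr rfl fun w _ => ?_
    rw [← card_filter]
    simp
  have hup : e₁ * ∑ w ∈ S, #(misplaced G A i w) ≤ (2 * q + 1) * n * s := by
    calc e₁ * ∑ w ∈ S, #(misplaced G A i w)
        = ∑ u : V, e₁ * #{w ∈ S | u ∈ misplaced G A i w} := by rw [hcount, mul_sum]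
      _ ≤ ∑ u : V, (s + e₁ * s * (if u ∈ B then 1 else 0)) := sum_le_sum fun u _ => hpoint u
      _ = Fintype.card V * s + (e₁ * #B) * s := by
          rw [sum_add_distrib, ← mul_sum]
          simp
          ring
      _ ≤ 2 * q * n * s + n * s := by
          gcongr
          · exact h.card_le
          · exact hatyp W' hblow
      _ = _ := by ring
  have hlow : s * (n + 1) ≤ e * ∑ w ∈ S, #(misplaced G A i w) := by
    rw [mul_sum, ← hSc, ← smul_eq_mul, ← sum_const]
    exact sum_le_sum fun w hw => (mem_filter.1 (hZ' (hSZ hw))).2.2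
  have : 2 * (2 * q + 1) * (s * (n + 1)) ≤ (2 * q + 1) * n * s := by
    calc 2 * (2 * q + 1) * (s * (n + 1))
        ≤ 2 * (2 * q + 1) * (e * ∑ w ∈ S, #(misplaced G A i w)) := by gcongr
      _ = e₁ * ∑ w ∈ S, #(misplaced G A i w) := by rw [he]; ring
      _ ≤ _ := hup
  have hs0 : 0 < s := by omega
  have hpos : 0 < (2 * q + 1) * s := by positivity
  nlinarith [Nat.zero_le ((2 * q + 1) * s * n)]

/-- Stability: `G` is close to a complete `q`-partite graph. -/
theorem exists_partition (k q t e : ℕ) (he : 1 ≤ e) :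
    ∃ D : ℕ, ∀ (V : Type) [Fintype V] (G : SimpleGraph V) (n m : ℕ),
      BookContext G k q t n m → D * m ≤ n → ∃ A : Fin q → Finset V,
        (∀ i j, i ≠ j → Disjoint (A i) (A j)) ∧ e * #(univ \ univ.biUnion A) ≤ n ∧
        ∀ i, ∀ v ∈ A i, e * #(misplaced G A i v) ≤ n := by
  obtain ⟨e₁, he₁⟩ : ∃ e₁, e₁ = 2 * (2 * q + 1) * e := ⟨_, rfl⟩
  have he₁' : 1 ≤ e₁ := by rw [he₁]; nlinarith
  obtain ⟨s₀, hs₀⟩ := exists_card_atypical_le k q t e₁ he₁'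
  obtain ⟨s, hs⟩ : ∃ s, s = s₀ + t * e₁ + 1 := ⟨_, rfl⟩
  obtain ⟨D₁, hD₁⟩ := hs₀ (2 * s) (by omega)
  obtain ⟨D₂, hD₂⟩ := hs₀ s (by omega)
  obtain ⟨D₃, hD₃⟩ := exists_isBlowup k q t q le_rfl (2 * s) (by omega)
  obtain ⟨D₄, hD₄⟩ : ∃ D₄, D₄ = 2 * q * e * (2 ^ (2 * s * q) * s ^ (q * t)) := ⟨_, rfl⟩
  refine ⟨D₁ + D₂ + D₃ + D₄, fun V _ G n m h hn => ?_⟩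
  simp only [add_mul] at hn
  obtain ⟨W, hW⟩ := hD₃ V G n m h (by omega)
  have hatyp := hD₁ V G n m h (by omega) W hW
  have hZ := h.card_misplaced_le he₁ he (by omega) hW
    (fun W' hW' => hD₂ V G n m h (by omega) W' hW')
    (by
      calc _ = D₄ * m := by rw [hD₄]; ring
        _ ≤ n := by omega)
  set A : Fin q → Finset V := fun j => {v | IsTypical G t e₁ (2 * s) W j v} with hA
  set Z : Fin q → Finset V := fun i =>
    {v : V | IsTypical G t e₁ (2 * s) W i v ∧ n < e * #(misplaced G A i v)} with hZdef
  set B : Finset V := {v | ¬ ∃ i, IsTypical G t e₁ (2 * s) W i v} with hB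
  refine ⟨fun i => A i \ Z i, fun i j hij => ?_, ?_, fun i v hv => ?_⟩
  · refine Disjoint.mono sdiff_subset sdiff_subset (disjoint_left.2 fun v hvi hvj => ?_)
    have h1 := (mem_filter.1 hvi).2.1
    have h2 := (mem_filter.1 hvj).2.2 i hij
    have h3 := card_filter_adj_add (G := G) (W i) v
    rw [hW.card_eq] at h3
    have h4 : 6 ≤ e₁ := by have := h.q_pos; rw [he₁]; nlinarith
    have h5 : 6 * t ≤ s := by nlinarith
    nlinarith
  · have hsub : univ \ univ.biUnion (fun i => A i \ Z i) ⊆ B ∪ univ.biUnion Z := by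
      intro v hv
      simp only [mem_sdiff, mem_univ, true_and, mem_biUnion, not_exists, not_and, not_not] at hv
      rw [mem_union]
      by_cases hvB : v ∈ B
      · exact Or.inl hvB
      · obtain ⟨i, hi⟩ : ∃ i, IsTypical G t e₁ (2 * s) W i v := by simpa [hB] using hvB
        exact Or.inr (mem_biUnion.2 ⟨i, mem_univ i, hv i (by simpa [hA] using hi)⟩)
    have hcard : #(univ \ univ.biUnion (fun i => A i \ Z i)) ≤ #B + ∑ i, #(Z i) :=
      (card_le_card hsub).trans ((card_union_le _ _).trans (by gcongr; exact card_biUnion_le))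
    have hsum : 2 * q * e * ∑ i, #(Z i) ≤ q * n := by
      rw [mul_sum]
      refine (sum_le_sum fun i _ => hZ i).trans ?_
      simp
    have hBn : 2 * q * e * #B ≤ q * n := by
      have : 2 * e * #B ≤ n := le_trans (by rw [he₁]; gcongr; nlinarith) hatyp
      calc 2 * q * e * #B = q * (2 * e * #B) := by ring
        _ ≤ _ := by gcongr
    have hqpos := h.q_pos
    have : 2 * q * (e * #(univ \ univ.biUnion (fun i => A i \ Z i))) ≤ 2 * q * n := by
      calc _ ≤ 2 * q * (e * (#B + ∑ i, #(Z i))) := by gcongr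
        _ = 2 * q * e * #B + 2 * q * e * ∑ i, #(Z i) := by ring
        _ ≤ _ := by linarith
    exact Nat.le_of_mul_le_mul_left this (by omega)
  · obtain ⟨hvA, hvZ⟩ := mem_sdiff.1 hv
    have h1 : e * #(misplaced G A i v) ≤ n := by
      by_contra! hcon
      exact hvZ (mem_filter.2 ⟨mem_univ _, (mem_filter.1 hvA).2, hcon⟩)
    refine le_trans ?_ h1
    gcongr
    intro u hu
    simp only [misplaced, mem_filter, mem_univ, true_and, mem_sdiff] at hu ⊢
    obtain ⟨j, hj, hiff⟩ := hu
    exact ⟨j, hj.1, hiff⟩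

/-- In an almost complete `q`-partite graph without `K_{q+1}(a)`, a vertex with large degree
to all parts but the `i`-th has fewer than `a 1` neighbours in the `i`-th part. -/
theorem card_adj_lt_of_partition {q r t m : ℕ} (hq : 2 ≤ q) (a : Fin (q + 1) → ℕ)
    (ha0 : a 0 = 1) (hat : ∀ i : Fin (q + 1), (i : ℕ) < q → a i ≤ t) (ham : a (Fin.last q) = m)
    (hcopy : ∀ T : Fin (q + 1) → Finset V, (∀ i, #(T i) = a i) → ¬ CrossComplete G T)
    (A : Fin q → Finset V) (hmis : ∀ i, ∀ v ∈ A i, #(misplaced G A i v) ≤ r) (v : V) (i : Fin q)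
    (hv : ∀ j, j ≠ i → m + t + r * (q * t) ≤ #{u ∈ A j | G.Adj v u}) :
    #{u ∈ A i | G.Adj v u} < a ⟨1, by omega⟩ := by
  by_contra! hlt
  set z : Fin q := ⟨0, by omega⟩ with hz
  set σ := Equiv.swap i z with hσ
  obtain ⟨T, hTX, hTc, hT⟩ := exists_crossComplete (G := G) q r t (fun j => a j.succ)
    (fun j => {u ∈ A (σ j) | G.Adj v u})
    (fun j hj => hat _ (by simpa using hj))
    (fun j j' hjj x hx => by
      refine le_trans (card_le_card fun u hu => ?_) (hmis (σ j) x (mem_filter.1 hx).1)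
      simp only [mem_filter, misplaced, mem_univ, true_and] at hu ⊢
      exact ⟨σ j', hu.1.1, iff_of_false (fun h => hjj (σ.injective h).symm) hu.2⟩)
    (fun j => by
      by_cases hj : j = z
      · rw [hj]
        have : σ z = i := Equiv.swap_apply_right i z
        simp only [this]
        simpa [hz] using hlt
      · have hji : σ j ≠ i := fun h => hj (by
          rw [← Equiv.swap_apply_left i z, ← hσ, ← h, hσ, Equiv.swap_apply_self])
        refine le_trans ?_ (hv _ hji)
        have h1 : a j.succ ≤ m + t := by
          by_cases hjl : (j.succ : ℕ) < q
          · exact (hat _ hjl).trans (Nat.le_add_left _ _)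
          · have : j.succ = Fin.last q := Fin.ext (by
              have := j.succ.2
              rw [Fin.val_last]
              omega)
            rw [this, ham]
            exact Nat.le_add_right _ _
        have := j.2
        gcongr)
  have hadj : ∀ j, ∀ u ∈ T j, G.Adj v u := fun j u hu => (mem_filter.1 (hTX j hu)).2
  refine hcopy (Fin.cons {v} T) (Fin.cases (by simp [ha0]) hTc) ?_
  intro i₁ i₂
  refine Fin.cases ?_ (fun i₁ => ?_) i₁ <;> refine Fin.cases ?_ (fun i₂ => ?_) i₂
  · exact fun h => absurd rfl h
  · intro _ u hu w hw
    rw [Fin.cons_zero, mem_singleton] at hu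
    exact hu ▸ hadj i₂ w hw
  · intro _ u hu w hw
    rw [Fin.cons_zero, mem_singleton] at hw
    exact hw ▸ (hadj i₁ u hu).symm
  · exact fun hi => hT i₁ i₂ fun h => hi (congrArg _ h)

/-- The parts to which `v` has few neighbours. -/
noncomputable def sparseParts (G : SimpleGraph V) (A : Fin q → Finset V) (x : ℕ) (v : V) :
    Finset (Fin q) :=
  {j | #{u ∈ A j | G.Adj v u} < x}

/-- A part of the partition contains an independent `k`-set with many common non-neighbours. -/
theorem exists_spine {q k r x α : ℕ} (hk : 1 ≤ k) (hα : 1 ≤ α) (A : Fin q → Finset V)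
    (hAB : ∀ i, ∀ v ∈ A i, sparseParts G A x v = {i}) (hrest : #(univ \ univ.biUnion A) ≤ r)
    (hdeg : ∀ v i, sparseParts G A x v = {i} → #{u ∈ A i | G.Adj v u} < α) (i : Fin q)
    (hlarge : r * α + 2 * k * x + k * α ≤ #(A i)) :
    ∃ S : Finset V, #S = k ∧ Independent G S ∧
      2 * #{v : V | sparseParts G A x v = {i}} +
        #{v : V | i ∈ sparseParts G A x v ∧ 2 ≤ #(sparseParts G A x v)} ≤
      2 * (#(nonNeighbours G S) + k * (α - 1)) := by
  set B : Finset V := {v | sparseParts G A x v = {i}} with hB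
  set D : Finset V := {v | i ∈ sparseParts G A x v ∧ 2 ≤ #(sparseParts G A x v)} with hD
  have hAiB : A i ⊆ B := fun v hv => mem_filter.2 ⟨mem_univ _, hAB i v hv⟩
  have hBdeg : ∀ v ∈ B, #{u ∈ A i | G.Adj v u} < α := fun v hv => hdeg v i (mem_filter.1 hv).2
  set K₁ := (B \ A i).biUnion fun b => {u ∈ A i | G.Adj b u} with hK₁
  set K₂ := {w ∈ A i | #D < 2 * k * #{b ∈ D | G.Adj w b}} with hK₂
  have hK₁c : #K₁ ≤ r * α := by
    have h1 : #(B \ A i) ≤ r := by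
      refine (card_le_card fun v hv => ?_).trans hrest
      simp only [mem_sdiff, mem_univ, true_and, mem_biUnion, not_exists, hB, mem_filter] at hv ⊢
      intro j hj
      have := (hAB j v hj).symm.trans hv.1
      rw [singleton_inj] at this
      exact hv.2 (this ▸ hj)
    exact (card_biUnion_le_card_mul _ _ α fun b hb => (hBdeg b (mem_sdiff.1 hb).1).le).trans
      (by gcongr)
  have hK₂c : #K₂ ≤ 2 * k * x := by
    rcases Nat.eq_zero_or_pos #D with h0 | hpos
    · have : K₂ = ∅ := by
        refine filter_eq_empty_iff.2 fun w _ => ?_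
        rw [card_eq_zero.1 h0]
        simp
      simp [this]
    · refine Nat.le_of_mul_le_mul_right ?_ hpos
      calc #K₂ * #D ≤ ∑ w ∈ K₂, 2 * k * #{b ∈ D | G.Adj w b} := by
            rw [← smul_eq_mul, ← sum_const]
            exact sum_le_sum fun w hw => (mem_filter.1 hw).2.le
        _ ≤ ∑ w ∈ A i, 2 * k * #{b ∈ D | G.Adj w b} := sum_le_sum_of_subset (filter_subset _ _)
        _ = 2 * k * ∑ b ∈ D, #{w ∈ A i | G.Adj b w} := by
            rw [← mul_sum]
            simp_rw [card_filter]
            rw [sum_comm]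
            simp_rw [G.adj_comm]
        _ ≤ 2 * k * ∑ _b ∈ D, x := by
            gcongr with b hb
            have := (mem_filter.1 hb).2.1
            exact (mem_filter.1 this).2.le
        _ = 2 * k * x * #D := by rw [sum_const, smul_eq_mul]; ring
  have hPA : A i \ (K₁ ∪ K₂) ⊆ A i := sdiff_subset
  obtain ⟨S, hSP, hSc, hSi⟩ := exists_independent_of_degree_le (G := G) k (α - 1)
    (A i \ (K₁ ∪ K₂))
    (fun v hv => by
      have h1 := hBdeg v (hAiB (hPA hv))
      have h2 : #{u ∈ A i \ (K₁ ∪ K₂) | G.Adj v u} ≤ #{u ∈ A i | G.Adj v u} :=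
        card_le_card (filter_subset_filter _ hPA)
      omega)
    (by
      rw [Nat.sub_add_cancel hα]
      have h1 := le_card_sdiff (K₁ ∪ K₂) (A i)
      have h2 := card_union_le K₁ K₂
      omega)
  refine ⟨S, hSc, hSi, ?_⟩
  have hBN : #B ≤ #(B ∩ nonNeighbours G S) + k * (α - 1) := by
    have hsub : B ⊆ (B ∩ nonNeighbours G S) ∪ S.biUnion fun w => {u ∈ A i | G.Adj w u} := by
      intro v hv
      simp only [mem_union, mem_inter, mem_nonNeighbours, mem_biUnion, mem_filter]
      by_cases hc : ∀ u ∈ S, ¬ G.Adj u v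
      · exact Or.inl ⟨hv, hc⟩
      · push Not at hc
        obtain ⟨w, hw, hwv⟩ := hc
        refine Or.inr ⟨w, hw, ?_, hwv⟩
        by_contra hvA
        refine (mem_sdiff.1 (hSP hw)).2 (mem_union_left _ (mem_biUnion.2
          ⟨v, mem_sdiff.2 ⟨hv, hvA⟩, mem_filter.2 ⟨hPA (hSP hw), hwv.symm⟩⟩))
    refine (card_le_card hsub).trans ((card_union_le _ _).trans ?_)
    gcongr
    rw [← hSc]
    refine card_biUnion_le_card_mul _ _ _ fun w hw => ?_
    have := hBdeg w (hAiB (hPA (hSP hw)))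
    omega
  have hDN : #D ≤ 2 * #(D ∩ nonNeighbours G S) := by
    have hsub : D ⊆ (D ∩ nonNeighbours G S) ∪ S.biUnion fun w => {u ∈ D | G.Adj w u} := by
      intro v hv
      simp only [mem_union, mem_inter, mem_nonNeighbours, mem_biUnion, mem_filter]
      by_cases hc : ∀ u ∈ S, ¬ G.Adj u v
      · exact Or.inl ⟨hv, hc⟩
      · push Not at hc
        obtain ⟨w, hw, hwv⟩ := hc
        exact Or.inr ⟨w, hw, hv, hwv⟩
    have h1 := (card_le_card hsub).trans (card_union_le _ _)
    have h2 : 2 * k * #(S.biUnion fun w => {u ∈ D | G.Adj w u}) ≤ k * #D := by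
      calc _ ≤ 2 * k * ∑ w ∈ S, #{u ∈ D | G.Adj w u} := by gcongr; exact card_biUnion_le
        _ = ∑ w ∈ S, 2 * k * #{u ∈ D | G.Adj w u} := mul_sum _ _ _
        _ ≤ ∑ _w ∈ S, #D := by
            refine sum_le_sum fun w hw => ?_
            by_contra! hcon
            exact (mem_sdiff.1 (hSP hw)).2 (mem_union_right _
              (mem_filter.2 ⟨hPA (hSP hw), hcon⟩))
        _ = _ := by rw [sum_const, smul_eq_mul, hSc]
    have h3 : 2 * #(S.biUnion fun w => {u ∈ D | G.Adj w u}) ≤ #D :=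
      Nat.le_of_mul_le_mul_left (by nlinarith) (by omega : 0 < k)
    omega
  have hdisj : Disjoint (B ∩ nonNeighbours G S) (D ∩ nonNeighbours G S) := by
    refine Disjoint.mono inter_subset_left inter_subset_left (disjoint_left.2 fun v hv hv' => ?_)
    have h1 := (mem_filter.1 hv).2
    have h2 := (mem_filter.1 hv').2.2
    rw [h1, card_singleton] at h2
    omega
  have hle : #(B ∩ nonNeighbours G S) + #(D ∩ nonNeighbours G S) ≤ #(nonNeighbours G S) := by
    rw [← card_union_of_disjoint hdisj]
    exact card_le_card (union_subset inter_subset_right inter_subset_right)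
  omega

theorem BookContext.card_part_le (h : BookContext G k q t n m) {r : ℕ} (hkn : k ≤ n)
    (A : Fin q → Finset V) (hmis : ∀ i, ∀ v ∈ A i, #(misplaced G A i v) ≤ r) (i : Fin q) :
    #(A i) ≤ n + k * r := by
  have hdeg : ∀ v ∈ A i, #{u ∈ A i | G.Adj v u} ≤ r := fun v hv =>
    (card_le_card fun u hu => by
      simp only [mem_filter, misplaced, mem_univ, true_and] at hu ⊢
      exact ⟨i, hu.1, iff_of_true rfl hu.2⟩).trans (hmis i v hv)
  rcases le_or_gt (k * (r + 1)) #(A i) with hle | hlt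
  · obtain ⟨S, hSA, hSc, hSi⟩ := exists_independent_of_degree_le (G := G) k r (A i) hdeg hle
    have hsub : A i ⊆ nonNeighbours G S ∪ S.biUnion fun w => {u ∈ A i | G.Adj w u} := by
      intro v hv
      simp only [mem_union, mem_nonNeighbours, mem_biUnion, mem_filter]
      by_cases hc : ∀ u ∈ S, ¬ G.Adj u v
      · exact Or.inl hc
      · push Not at hc
        obtain ⟨w, hw, hwv⟩ := hc
        exact Or.inr ⟨w, hw, hv, hwv⟩
    refine (card_le_card hsub).trans ((card_union_le _ _).trans ?_)
    refine add_le_add (h.book S hSc hSi).le ?_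
    rw [← hSc]
    exact card_biUnion_le_card_mul _ _ _ fun w hw => hdeg w (hSA hw)
  · nlinarith

lemma large_part_bound {E F r x α A N : ℕ} (hE : E = 2 + t + q * k + (2 * k + 1) * (q * t))
    (hF : F = q + k * t + (2 * k + 1) * (1 + t)) (hx : x = m + t + r * (q * t)) (hq : 2 ≤ q)
    (hm : 1 ≤ m) (hα : α ≤ t) (hn : E * r + F * m ≤ n) (hN : q * n ≤ N + q)
    (hA : N ≤ r + (A + (q - 1) * (n + k * r))) :
    r + x + r * α + 2 * k * x + k * α ≤ A := by
  obtain ⟨q', rfl⟩ : ∃ q', q = q' + 1 := ⟨q - 1, by omega⟩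
  rw [Nat.add_sub_cancel] at hA
  have h1 : r * α ≤ r * t := Nat.mul_le_mul_left _ hα
  have h2 : k * α ≤ k * t := Nat.mul_le_mul_left _ hα
  have h3 : q' + 1 + k * t + (2 * k + 1) * t ≤ (q' + 1 + k * t + (2 * k + 1) * t) * m :=
    Nat.le_mul_of_pos_right _ hm
  have h4 : F * m = (q' + 1 + k * t + (2 * k + 1) * t) * m + (2 * k + 1) * m := by
    rw [hF]; ring
  have h5 : E * r = 2 * r + t * r + (q' + 1) * k * r + (2 * k + 1) * (r * ((q' + 1) * t)) := by
    rw [hE]; ring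
  have h6 : r + x + r * α + 2 * k * x + k * α = r + r * α + k * α +
      ((2 * k + 1) * m + (2 * k + 1) * t + (2 * k + 1) * (r * ((q' + 1) * t))) := by
    rw [hx]; ring
  have h7 : n ≤ r + A + q' * k * r + (q' + 1) := by linarith
  have h8 : (q' + 1) * k * r = q' * k * r + k * r := by ring
  have h9 : t * r = r * t := mul_comm _ _
  rw [h6]
  generalize (2 * k + 1) * (r * ((q' + 1) * t)) = W at *
  generalize (q' + 1 + k * t + (2 * k + 1) * t) * m = Z at *
  generalize E * r = e at *
  generalize F * m = f at *
  omega

lemma two_mul_card_le_sum_sparseParts {A : Fin q → Finset V} {x : ℕ}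
    (h : ∀ v, (sparseParts G A x v).Nonempty) :
    2 * Fintype.card V ≤ ∑ i, (2 * #{v : V | sparseParts G A x v = {i}} +
      #{v : V | i ∈ sparseParts G A x v ∧ 2 ≤ #(sparseParts G A x v)}) := by
  rw [sum_add_distrib, ← mul_sum]
  simp_rw [card_filter]
  rw [sum_comm, sum_comm (s := (univ : Finset (Fin q))), mul_sum, ← sum_add_distrib,
    ← card_univ, mul_comm, ← smul_eq_mul, ← sum_const]
  refine sum_le_sum fun v _ => ?_
  have h1 := card_pos.2 (h v)
  rcases (by omega : #(sparseParts G A x v) = 1 ∨ 2 ≤ #(sparseParts G A x v)) with h | h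
  · obtain ⟨i, hi⟩ := card_eq_one.1 h
    simp [hi]
  · simp only [h, and_true]
    have : ∑ i, (if i ∈ sparseParts G A x v then 1 else 0) = #(sparseParts G A x v) := by simp
    omega

theorem exists_multipartite_or_spine_of_two_le (k q t : ℕ) (hk : 1 ≤ k) (hq : 2 ≤ q) :
    ∃ D : ℕ, ∀ (V : Type) [Fintype V] (G : SimpleGraph V) (n : ℕ) (a : Fin (q + 1) → ℕ),
      (∀ i, 1 ≤ a i) → a 0 = 1 → (∀ i : Fin (q + 1), (i : ℕ) < q → a i ≤ t) →
      D * a (Fin.last q) ≤ n →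
      Fintype.card V = q * (n - 1) + k * q * (a ⟨1, by omega⟩ - 1) + 1 →
      (∃ T : Fin (q + 1) → Finset V, (∀ i, #(T i) = a i) ∧ CrossComplete G T) ∨
        ∃ S : Finset V, #S = k ∧ Independent G S ∧ n ≤ #(nonNeighbours G S) := by
  obtain ⟨E, hE⟩ : ∃ E, E = 2 + t + q * k + (2 * k + 1) * (q * t) := ⟨_, rfl⟩
  obtain ⟨F, hF⟩ : ∃ F, F = q + k * t + (2 * k + 1) * (1 + t) := ⟨_, rfl⟩
  obtain ⟨D, hD⟩ := exists_partition k q t (2 * E) (by omega)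
  refine ⟨D + 2 * F + k * t + k + 1, fun V _ G n a ha ha0 hat hn hV => ?_⟩
  obtain ⟨m, hm⟩ : ∃ m, m = a (Fin.last q) := ⟨_, rfl⟩
  obtain ⟨α, hα⟩ : ∃ α, α = a ⟨1, by omega⟩ := ⟨_, rfl⟩
  rw [← hm] at hn
  rw [← hα] at hV
  have hm1 : 1 ≤ m := hm ▸ ha _
  have hα1 : 1 ≤ α := hα ▸ ha _
  have hαt : α ≤ t := hα ▸ hat ⟨1, by omega⟩ (by simp; omega)
  simp only [add_mul, one_mul] at hn
  have hktm : k * t ≤ k * t * m := Nat.le_mul_of_pos_right _ hm1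
  have hkm : k ≤ k * m := Nat.le_mul_of_pos_right _ hm1
  by_contra! hcon
  obtain ⟨hT, hS⟩ := hcon
  have hctx : BookContext G k q t n m := by
    refine ⟨by omega, hm1, ?_, ?_, fun T hTc hTx Y hY => ?_, hS⟩
    · rw [hV]
      have : q * n = q * (n - 1) + q := by
        conv_lhs => rw [show n = n - 1 + 1 by omega, mul_add, mul_one]
      omega
    · rw [hV]
      have h1 : q * n = q * (n - 1) + q := by
        conv_lhs => rw [show n = n - 1 + 1 by omega, mul_add, mul_one]
      have h2 : k * q * (α - 1) ≤ q * n := by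
        calc k * q * (α - 1) ≤ k * q * t := by gcongr; omega
          _ = q * (k * t) := by ring
          _ ≤ q * n := by gcongr; omega
      nlinarith
    · by_contra! hmY
      obtain ⟨Y', hY'Y, hY'c⟩ := exists_subset_card_eq hmY
      choose T' hT'T hT'c using fun i : Fin q => exists_subset_card_eq
        (show a i.castSucc ≤ #(T i) by rw [hTc]; exact hat _ (by simp))
      refine hT (Fin.snoc T' Y') (Fin.lastCases (by simp [hY'c, hm]) (by simpa using hT'c)) ?_
      intro i₁ i₂
      refine Fin.lastCases ?_ (fun i₁ => ?_) i₁ <;> refine Fin.lastCases ?_ (fun i₂ => ?_) i₂ <;>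
        simp only [Fin.snoc_last, Fin.snoc_castSucc]
      · exact fun h => absurd rfl h
      · exact fun _ u hu v hv => (hY u (hY'Y hu) i₂ v (hT'T i₂ hv)).symm
      · exact fun _ u hu v hv => hY v (hY'Y hv) i₁ u (hT'T i₁ hu)
      · exact fun hi u hu v hv => hTx i₁ i₂ (fun h => hi (congrArg _ h)) u (hT'T i₁ hu) v
          (hT'T i₂ hv)
  obtain ⟨A, hAd, hrest, hmis⟩ := hD V G n m hctx (by omega)
  obtain ⟨r, hr⟩ : ∃ r, r = n / (2 * E) := ⟨_, rfl⟩
  have hEpos : 0 < 2 * E := by omega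
  have hrE : 2 * (E * r) ≤ n := by
    rw [← mul_assoc, hr]
    exact Nat.mul_div_le n _
  have hrest' : #(univ \ univ.biUnion A) ≤ r := by
    rw [hr, Nat.le_div_iff_mul_le hEpos, mul_comm]
    exact hrest
  have hmis' : ∀ i, ∀ v ∈ A i, #(misplaced G A i v) ≤ r := fun i v hv => by
    rw [hr, Nat.le_div_iff_mul_le hEpos, mul_comm]
    exact hmis i v hv
  obtain ⟨x, hx⟩ : ∃ x, x = m + t + r * (q * t) := ⟨_, rfl⟩
  have hdeg := card_adj_lt_of_partition hq a ha0 hat hm.symm hT A hmis'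
  rw [← hx, ← hα] at hdeg
  have hlarge : ∀ i, r + x + r * α + 2 * k * x + k * α ≤ #(A i) := by
    intro i
    have h1 : Fintype.card V ≤ r + (#(A i) + (q - 1) * (n + k * r)) := by
      have h2 : Fintype.card V = #(univ \ univ.biUnion A) + #(univ.biUnion A) := by
        rw [card_sdiff_add_card_eq_card (subset_univ _), card_univ]
      rw [h2]
      refine add_le_add hrest' (card_biUnion_le.trans ?_)
      rw [← add_sum_erase _ _ (mem_univ i)]
      gcongr
      refine (sum_le_sum fun j _ => hctx.card_part_le (by omega) A hmis' j).trans ?_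
      simp
    have h3 : 2 * (F * m) ≤ n := by
      have : 2 * F * m ≤ n := by omega
      rwa [mul_assoc] at this
    exact large_part_bound hE hF hx hq hm1 hαt (by omega) hctx.card_ge h1
  have hI : ∀ v, (sparseParts G A x v).Nonempty := by
    intro v
    by_contra! hne
    have hall : ∀ j, x ≤ #{u ∈ A j | G.Adj v u} := fun j => by
      by_contra! hlt
      have : j ∈ sparseParts G A x v := mem_filter.2 ⟨mem_univ _, hlt⟩
      rw [hne] at this
      simp at this
    have h1 := hdeg v ⟨0, by omega⟩ fun j _ => hall j
    have h2 := hall ⟨0, by omega⟩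
    omega
  have hAB : ∀ i, ∀ v ∈ A i, sparseParts G A x v = {i} := by
    intro i v hv
    refine (hI v).subset_singleton_iff.1 fun j hj => ?_
    rw [mem_singleton]
    by_contra hji
    have h1 := (mem_filter.1 hj).2
    have h2 := card_filter_add_card_filter_not (s := A j) (fun u => G.Adj v u)
    have h3 : #{u ∈ A j | ¬ G.Adj v u} ≤ r := by
      refine (card_le_card fun u hu => ?_).trans (hmis' i v hv)
      simp only [mem_filter, misplaced, mem_univ, true_and] at hu ⊢
      exact ⟨j, hu.1, iff_of_false hji hu.2⟩
    have h4 := hlarge j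
    omega
  have hdeg' : ∀ v i, sparseParts G A x v = {i} → #{u ∈ A i | G.Adj v u} < α := by
    intro v i hv
    refine hdeg v i fun j hj => ?_
    by_contra! hlt
    have : j ∈ sparseParts G A x v := mem_filter.2 ⟨mem_univ _, hlt⟩
    rw [hv, mem_singleton] at this
    exact hj this
  choose S hSc hSi hSn using fun i => exists_spine hk hα1 A hAB hrest' hdeg' i
    (by have := hlarge i; omega)
  have hcount := two_mul_card_le_sum_sparseParts hI
  have hup : ∑ i, (2 * #{v : V | sparseParts G A x v = {i}} +
      #{v : V | i ∈ sparseParts G A x v ∧ 2 ≤ #(sparseParts G A x v)}) ≤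
      ∑ _i : Fin q, 2 * (n - 1 + k * (α - 1)) := by
    refine sum_le_sum fun i _ => (hSn i).trans ?_
    have := hS (S i) (hSc i) (hSi i)
    omega
  rw [sum_const, card_univ, Fintype.card_fin, smul_eq_mul] at hup
  have hfin := hcount.trans hup
  rw [hV] at hfin
  have : q * (2 * (n - 1 + k * (α - 1))) = 2 * (q * (n - 1) + k * q * (α - 1)) := by ring
  omega

theorem exists_multipartite_or_spine (k q t : ℕ) (hk : 1 ≤ k) (hq : 1 ≤ q) :
    ∃ D : ℕ, ∀ (V : Type) [Fintype V] (G : SimpleGraph V) (n : ℕ) (a : Fin (q + 1) → ℕ),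
      (∀ i, 1 ≤ a i) → a 0 = 1 → (∀ i : Fin (q + 1), (i : ℕ) < q → a i ≤ t) →
      D * a (Fin.last q) ≤ n →
      Fintype.card V = q * (n - 1) + k * q * (a ⟨1, by omega⟩ - 1) + 1 →
      (∃ T : Fin (q + 1) → Finset V, (∀ i, #(T i) = a i) ∧ CrossComplete G T) ∨
        ∃ S : Finset V, #S = k ∧ Independent G S ∧ n ≤ #(nonNeighbours G S) := by
  rcases (by omega : 2 ≤ q ∨ q = 1) with hq2 | rfl
  · exact exists_multipartite_or_spine_of_two_le k q t hk hq2
  refine ⟨k + 1, fun V _ G n a ha ha0 _ hn hV => ?_⟩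
  obtain ⟨m, hm⟩ : ∃ m, m = a 1 := ⟨_, rfl⟩
  have hm1 : 1 ≤ m := hm ▸ ha 1
  change (k + 1) * a 1 ≤ n at hn
  change Fintype.card V = 1 * (n - 1) + k * 1 * (a 1 - 1) + 1 at hV
  rw [← hm] at hn hV
  by_cases hdeg : ∀ v, #{u | G.Adj v u} ≤ m - 1
  · right
    have hV' : Fintype.card V = n + k * (m - 1) := by
      rw [hV]
      have : 1 ≤ n := le_trans (by nlinarith) hn
      simp only [one_mul, mul_one]
      omega
    obtain ⟨S, -, hSc, hSi⟩ := exists_independent_of_degree_le (G := G) k (m - 1) univ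
      (fun v _ => hdeg v) (by
        rw [Nat.sub_add_cancel hm1, card_univ, hV']
        nlinarith)
    refine ⟨S, hSc, hSi, ?_⟩
    have hsub : univ ⊆ nonNeighbours G S ∪ S.biUnion fun w => {u | G.Adj w u} := by
      intro v _
      simp only [mem_union, mem_nonNeighbours, mem_biUnion, mem_filter, mem_univ, true_and]
      by_cases hc : ∀ u ∈ S, ¬ G.Adj u v
      · exact Or.inl hc
      · push Not at hc
        exact Or.inr hc
    have h1 := (card_le_card hsub).trans (card_union_le _ _)
    have h2 : #(S.biUnion fun w => {u | G.Adj w u}) ≤ k * (m - 1) := by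
      rw [← hSc]
      exact card_biUnion_le_card_mul _ _ _ fun w _ => hdeg w
    rw [card_univ, hV'] at h1
    omega
  · left
    push Not at hdeg
    obtain ⟨v, hv⟩ := hdeg
    obtain ⟨Y, hY, hYc⟩ := exists_subset_card_eq (by omega : m ≤ #{u | G.Adj v u})
    have hadj : ∀ u ∈ Y, G.Adj v u := fun u hu => (mem_filter.1 (hY hu)).2
    refine ⟨![{v}, Y], ?_, ?_⟩
    · rw [Fin.forall_fin_two]
      exact ⟨by simp [ha0], by simp [hYc, hm]⟩
    · intro i j
      fin_cases i <;> fin_cases j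
      · exact fun h => absurd rfl h
      · intro _ u hu w hw
        obtain rfl : u = v := by simpa using hu
        exact hadj w hw
      · intro _ u hu w hw
        obtain rfl : w = v := by simpa using hw
        exact (hadj u hu).symm
      · exact fun h => absurd rfl h

lemma hasCopy_of_crossComplete {ι V : Type*} {G : SimpleGraph V} {b : ι → ℕ} {T : ι → Finset V}
    (hb : ∀ i, #(T i) = b i) (hT : CrossComplete G T) :
    HasCopy G (completeMultipartiteGraph fun i => Fin (b i)) := by
  let e := fun i => ((T i).equivFinOfCardEq (hb i)).symm
  refine ⟨⟨fun z => e z.1 z.2, fun {z w} h => hT _ _ h _ (e _ _).2 _ (e _ _).2⟩, ?_⟩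
  rintro ⟨i, x⟩ ⟨j, y⟩ h
  change ((e i x : T i) : V) = e j y at h
  have hij : i = j := by
    by_contra hij
    have hadj := hT i j hij _ (e i x).2 _ (e j y).2
    rw [h] at hadj
    exact G.loopless.irrefl _ hadj
  subst hij
  rw [(e i).injective (Subtype.ext h)]

lemma hasCopy_compl_book {S : Finset V} (hS : #S = k) (hSi : Independent G S)
    (hn : n ≤ #(nonNeighbours G S)) : HasCopy Gᶜ (Book k n) := by
  have hsub : S ⊆ nonNeighbours G S := fun v hv =>
    mem_nonNeighbours.2 fun u hu => hSi u hu v hv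
  obtain ⟨P, hP, hPc⟩ := exists_subset_card_eq
    (show n - k ≤ #(nonNeighbours G S \ S) by rw [card_sdiff_of_subset hsub, hS]; omega)
  have hPS : ∀ u ∈ S, ∀ v ∈ P, Gᶜ.Adj u v := fun u hu v hv => by
    have hv' := mem_sdiff.1 (hP hv)
    exact ⟨fun h => hv'.2 (h ▸ hu), mem_nonNeighbours.1 hv'.1 u hu⟩
  let e := (S.equivFinOfCardEq hS).symm
  refine hasCopy_of_crossComplete
    (T := Fin.snoc (α := fun _ => Finset V) (fun i => {(e i : V)}) P)
    (Fin.lastCases (by simp [hPc]) (by simp)) ?_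
  intro i j
  refine Fin.lastCases ?_ (fun i => ?_) i <;> refine Fin.lastCases ?_ (fun j => ?_) j <;>
    simp only [Fin.snoc_last, Fin.snoc_castSucc, mem_singleton]
  · exact fun h => absurd rfl h
  · rintro - u hu v rfl
    exact (hPS _ (e j).2 u hu).symm
  · rintro - u rfl v hv
    exact hPS _ (e i).2 v hv
  · rintro hij u rfl v rfl
    exact ⟨fun h => hij (congrArg _ (e.injective (Subtype.ext h))), hSi _ (e i).2 _ (e j).2⟩

lemma HasCopy.of_comap {U V W : Type*} {G : SimpleGraph V} {H : SimpleGraph W} (f : U ↪ V)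
    (h : HasCopy (G.comap f) H) : HasCopy G H := by
  obtain ⟨g, hg⟩ := h
  exact ⟨⟨fun w => f (g w), fun hw => g.map_rel hw⟩, f.injective.comp hg⟩

lemma HasCopy.of_compl_comap {U V W : Type*} {G : SimpleGraph V} {H : SimpleGraph W} (f : U ↪ V)
    (h : HasCopy (G.comap f)ᶜ H) : HasCopy Gᶜ H := by
  refine HasCopy.of_comap f ?_
  convert h using 1
  ext u v
  simp

/-- The join of `q` graphs, each the disjoint union of `c` cliques of size `α`. -/
def joinOfCliques (q c α : ℕ) : SimpleGraph (Fin q × Fin c × Fin α) where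
  Adj u v := u.1 ≠ v.1 ∨ u.2.1 = v.2.1 ∧ u.2.2 ≠ v.2.2
  symm := ⟨fun _ _ h => h.imp Ne.symm fun h => ⟨h.1.symm, h.2.symm⟩⟩
  loopless := ⟨fun _ h => h.elim (fun h => h rfl) fun h => h.2 rfl⟩

lemma joinOfCliques_adj_of_fst_eq {c α : ℕ} {u v : Fin q × Fin c × Fin α}
    (h : (joinOfCliques q c α).Adj u v) (huv : u.1 = v.1) : u.2.1 = v.2.1 :=
  (h.resolve_left fun h => h huv).1

lemma joinOfCliques_compl_adj {c α : ℕ} {u v : Fin q × Fin c × Fin α}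
    (h : (joinOfCliques q c α)ᶜ.Adj u v) : u.1 = v.1 ∧ u.2.1 ≠ v.2.1 := by
  obtain ⟨hne, hadj⟩ := h
  simp only [joinOfCliques, not_or, not_and, not_not] at hadj
  exact ⟨hadj.1, fun h => hne (Prod.ext hadj.1 (Prod.ext h (hadj.2 h)))⟩

lemma not_hasCopy_joinOfCliques {c α : ℕ} (hα : 1 ≤ α) {a : Fin (q + 1) → ℕ} (ha0 : a 0 = 1)
    (ha : ∀ l, l ≠ 0 → α ≤ a l) : ¬ HasCopy (joinOfCliques q c α) (KMulti a) := by
  rintro ⟨f, hf⟩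
  have hadj : ∀ z w : Σ i : Fin (q + 1), Fin (a i), z.1 ≠ w.1 → (f z).1 = (f w).1 →
      (f z).2.1 = (f w).2.1 := fun z w h =>
    joinOfCliques_adj_of_fst_eq (f.map_rel h)
  have hα0 : (0 : ℚ) < α := by exact_mod_cast hα
  let o : Σ i : Fin (q + 1), Fin (a i) := ⟨0, ⟨0, by omega⟩⟩
  let Z : Fin q → Finset (Σ i : Fin (q + 1), Fin (a i)) := fun i => {z | z.1 ≠ 0 ∧ (f z).1 = i}
  have htotal : ∑ i, ∑ z ∈ Z i, (a z.1 : ℚ)⁻¹ = q := by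
    have h1 : ∀ i, ∑ z ∈ Z i, (a z.1 : ℚ)⁻¹ =
        ∑ z, if (f z).1 = i then (if z.1 ≠ 0 then (a z.1 : ℚ)⁻¹ else 0) else 0 := fun i => by
      rw [sum_filter]
      refine sum_congr rfl fun z _ => ?_
      split_ifs <;> simp_all
    simp_rw [h1]
    rw [sum_comm]
    simp only [sum_ite_eq, mem_univ, if_true]
    rw [Fintype.sum_sigma, Fin.sum_univ_succ]
    simp only [ne_eq, not_true_eq_false, if_false, sum_const_zero, zero_add, Fin.succ_ne_zero,
      not_false_eq_true, if_true, sum_const, card_univ, Fintype.card_fin, nsmul_eq_mul]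
    rw [sum_congr rfl fun l _ => mul_inv_cancel₀ (a := (a (Fin.succ l) : ℚ)) ?_]
    · simp
    · have := ha _ (Fin.succ_ne_zero l)
      exact_mod_cast (by omega : a l.succ ≠ 0)
  have hclique : ∀ i (s : Finset (Fin α)) (d : Fin c), (∀ z ∈ Z i, (f z).2.1 = d) →
      (∀ z ∈ Z i, (f z).2.2 ∈ s) → ∑ z ∈ Z i, (a z.1 : ℚ)⁻¹ ≤ #s / α := by
    intro i s d hd hs
    have hcard : #(Z i) ≤ #s := by
      refine card_le_card_of_injOn (fun z => (f z).2.2) hs fun z hz w hw h => hf ?_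
      rw [mem_coe] at hz hw
      exact Prod.ext ((mem_filter.1 hz).2.2.trans (mem_filter.1 hw).2.2.symm)
        (Prod.ext ((hd z hz).trans (hd w hw).symm) h)
    calc ∑ z ∈ Z i, (a z.1 : ℚ)⁻¹ ≤ ∑ z ∈ Z i, (α : ℚ)⁻¹ := by
          refine sum_le_sum fun z hz => inv_anti₀ hα0 ?_
          exact_mod_cast ha _ (mem_filter.1 hz).2.1
      _ = #(Z i) / α := by simp [div_eq_mul_inv]
      _ ≤ #s / α := by gcongr
  have hle : ∀ i, ∑ z ∈ Z i, (a z.1 : ℚ)⁻¹ ≤ 1 := by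
    intro i
    rcases (Z i).eq_empty_or_nonempty with h | ⟨z, hz⟩
    · simp [h]
    by_cases hpart : ∀ w ∈ Z i, w.1 = z.1
    · have hcard : #(Z i) ≤ a z.1 := by
        calc #(Z i) ≤ #(univ.map (Function.Embedding.sigmaMk (β := fun j => Fin (a j)) z.1)) := by
              refine card_le_card fun w hw => ?_
              obtain ⟨j, y⟩ := w
              obtain rfl : j = z.1 := hpart _ hw
              simp
          _ = a z.1 := by simp
      have hpos : (0 : ℚ) < a z.1 := by
        exact_mod_cast hα.trans (ha _ (mem_filter.1 hz).2.1)
      rw [sum_congr rfl fun w hw => by rw [hpart w hw], sum_const, nsmul_eq_mul,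
        ← div_eq_mul_inv, div_le_one hpos]
      exact_mod_cast hcard
    · push Not at hpart
      obtain ⟨w, hw, hwz⟩ := hpart
      have hZ : ∀ y ∈ Z i, ∀ y' ∈ Z i, y.1 ≠ y'.1 → (f y).2.1 = (f y').2.1 :=
        fun y hy y' hy' h =>
          hadj y y' h ((mem_filter.1 hy).2.2.trans (mem_filter.1 hy').2.2.symm)
      refine (hclique i univ (f z).2.1 (fun y hy => ?_) fun y _ => mem_univ _).trans ?_
      · by_cases hyz : y.1 = z.1
        · exact (hZ y hy w hw fun h => hwz (h.symm.trans hyz)).trans (hZ w hw z hz hwz)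
        · exact hZ y hy z hz hyz
      · rw [card_univ, Fintype.card_fin, div_self hα0.ne']
  have hlt : ∑ z ∈ Z (f o).1, (a z.1 : ℚ)⁻¹ < 1 := by
    have hd : ∀ z ∈ Z (f o).1, (f z).2.1 = (f o).2.1 := fun z hz =>
      hadj z o (mem_filter.1 hz).2.1 (mem_filter.1 hz).2.2
    refine (hclique _ (univ.erase (f o).2.2) (f o).2.1 hd fun z hz => ?_).trans_lt ?_
    · refine mem_erase.2 ⟨fun h => (mem_filter.1 hz).2.1 ?_, mem_univ _⟩
      have : z = o := hf (Prod.ext (mem_filter.1 hz).2.2 (Prod.ext (hd z hz) h))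
      rw [this]
    · rw [card_erase_of_mem (mem_univ _), card_univ, Fintype.card_fin, div_lt_one hα0]
      exact_mod_cast (by omega : α - 1 < α)
  have hsum := sum_lt_sum (fun i _ => hle i) ⟨(f o).1, mem_univ _, hlt⟩
  rw [htotal] at hsum
  simp at hsum

lemma not_hasCopy_compl_joinOfCliques {c α : ℕ} (hk : 1 ≤ k) (hn : k + 1 ≤ n)
    (hc : (c - k) * α = n - 1 - k) : ¬ HasCopy (joinOfCliques q c α)ᶜ (Book k n) := by
  rintro ⟨f, hf⟩
  have hadj : ∀ z w, z.1 ≠ w.1 → (f z).1 = (f w).1 ∧ (f z).2.1 ≠ (f w).2.1 := fun z w h =>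
    joinOfCliques_compl_adj (f.map_rel h)
  let spine : Fin k → Σ i : Fin (k + 1), Fin (if (i : ℕ) < k then 1 else n - k) :=
    fun i => ⟨i.castSucc, ⟨0, by simp⟩⟩
  let page : Fin (n - k) → Σ i : Fin (k + 1), Fin (if (i : ℕ) < k then 1 else n - k) :=
    fun x => ⟨Fin.last k, ⟨x, by simp⟩⟩
  have hpage : Function.Injective page := fun x y h => by
    simpa [page, Fin.ext_iff] using h
  have hps : ∀ x i, (page x).1 ≠ (spine i).1 := fun x i h => (Fin.castSucc_lt_last i).ne h.symm
  have hcol : Function.Injective fun i => (f (spine i)).2.1 := by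
    intro i j hij
    by_contra hne
    exact (hadj (spine i) (spine j) fun h => hne (Fin.castSucc_injective _ h)).2 hij
  let R : Finset (Fin c) := univ \ univ.image fun i => (f (spine i)).2.1
  have hR : #R = c - k := by
    rw [card_sdiff_of_subset (subset_univ _), card_image_of_injective _ hcol]
    simp
  have hcard : #(univ : Finset (Fin (n - k))) ≤ #(R ×ˢ (univ : Finset (Fin α))) := by
    refine card_le_card_of_injOn (fun x => (f (page x)).2) (fun x _ => ?_) fun x _ y _ h => ?_
    · simp only [coe_product, Set.mem_prod, mem_coe, mem_univ, and_true, R, mem_sdiff, true_and,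
        mem_image, not_exists]
      exact fun i h => (hadj (page x) (spine i) (hps x i)).2 h.symm
    · have h1 := (hadj (page x) (spine ⟨0, hk⟩) (hps x _)).1
      have h2 := (hadj (page y) (spine ⟨0, hk⟩) (hps y _)).1
      exact hpage (hf (Prod.ext (h1.trans h2.symm) h))
  rw [card_product, hR, card_univ, card_univ, Fintype.card_fin, Fintype.card_fin, hc] at hcard
  omega

lemma lt_of_forall_hasCopy {α N : ℕ} (hk : 1 ≤ k) (hn : k + 1 ≤ n) (hα : 1 ≤ α)
    (hdvd : α ∣ n - 1 - k) {a : Fin (q + 1) → ℕ} (ha0 : a 0 = 1) (ha : ∀ l, l ≠ 0 → α ≤ a l)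
    (hN : ∀ G : SimpleGraph (Fin N), HasCopy G (KMulti a) ∨ HasCopy Gᶜ (Book k n)) :
    q * (n - 1) + k * q * (α - 1) < N := by
  obtain ⟨d, hd⟩ := hdvd
  by_contra! hle
  have hcard : Fintype.card (Fin N) ≤ Fintype.card (Fin q × Fin (d + k) × Fin α) := by
    simp only [Fintype.card_fin, Fintype.card_prod]
    refine hle.trans (le_of_eq ?_)
    obtain ⟨β, rfl⟩ : ∃ β, α = β + 1 := ⟨α - 1, by omega⟩
    have : n - 1 = (β + 1) * d + k := by omega
    rw [this, Nat.add_sub_cancel]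
    ring
  obtain ⟨e⟩ := Function.Embedding.nonempty_of_card_le hcard
  rcases hN ((joinOfCliques q (d + k) α).comap e) with h | h
  · exact not_hasCopy_joinOfCliques hα ha0 ha (h.of_comap e)
  · refine not_hasCopy_compl_joinOfCliques hk hn ?_ (h.of_compl_comap e)
    rw [Nat.add_sub_cancel, hd, mul_comm]

end RamseyBook

/-- Theorem 1.5 (equality case): moreover, if `a₂ ∣ (n-1-k)` then
`r(K_p(a₁,…,a_p), B_{k,n}) = (p-1)(n-1) + k(p-1)(a₂-1) + 1`. -/
theorem ramsey_multipartite_book_eq (k p t : ℕ) (hk : 2 ≤ k) (hp : 2 ≤ p) (ht : 2 ≤ t) :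
    ∃ δ : ℝ, 0 < δ ∧ ∃ n₀ : ℕ, ∀ n : ℕ, n₀ ≤ n →
      ∀ a : Fin p → ℕ, (∀ i, 1 ≤ a i) → Monotone a →
        (∀ i : Fin p, (i : ℕ) < p - 1 → a i ≤ t) →
        ((a ⟨p - 1, by omega⟩ : ℕ) : ℝ) ≤ δ * n →
        a ⟨0, by omega⟩ = 1 →
        a ⟨1, by omega⟩ ∣ (n - 1 - k) →
        ramseyNumber (KMulti a) (Book k n) =
          (p - 1) * (n - 1) + k * (p - 1) * (a ⟨1, by omega⟩ - 1) + 1 := by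
  obtain ⟨q, rfl⟩ : ∃ q, p = q + 1 := ⟨p - 1, by omega⟩
  obtain ⟨D, hD⟩ := exists_multipartite_or_spine k q t (by omega) (by omega)
  refine ⟨1 / (D + k + 1), by positivity, 0, fun n _ a ha hmono hat han ha0 hdvd => ?_⟩
  have hn : (D + k + 1) * a (Fin.last q) ≤ n := by
    have h : (a (Fin.last q) : ℝ) ≤ 1 / (D + k + 1) * n := han
    rw [one_div, ← div_eq_inv_mul, le_div_iff₀ (by positivity), mul_comm] at h
    exact_mod_cast h
  have hDn : D * a (Fin.last q) ≤ n := le_trans (by gcongr; omega) hn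
  have hkn : k + 1 ≤ n := le_trans (by nlinarith [ha (Fin.last q)]) hn
  have hone : ∀ l : Fin (q + 1), l ≠ 0 → a ⟨1, by omega⟩ ≤ a l := fun l hl =>
    hmono (Fin.le_def.2 (Nat.one_le_iff_ne_zero.2 fun h => hl (Fin.ext h)))
  have hmem : ∀ G : SimpleGraph (Fin (q * (n - 1) + k * q * (a ⟨1, by omega⟩ - 1) + 1)),
      HasCopy G (KMulti a) ∨ HasCopy Gᶜ (Book k n) := fun G => by
    rcases hD (Fin _) G n a ha ha0 hat hDn (Fintype.card_fin _) with
      ⟨T, hTc, hT⟩ | ⟨S, hS, hSi, hSn⟩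
    · exact Or.inl (hasCopy_of_crossComplete hTc hT)
    · exact Or.inr (hasCopy_compl_book hS hSi hSn)
  refine le_antisymm (Nat.sInf_le hmem) (le_csInf ⟨_, hmem⟩ fun N hN => ?_)
  exact lt_of_forall_hasCopy (by omega) hkn (ha _) hdvd ha0 hone hN
end
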